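/- arXiv:2403.10270 — 7 statements merged into one kernel-verified Lean document; each statement's English description precedes it below -/
import Mathlib

section
/- Fix an integer k ≥ 0. For u : ℤ^d → ℝ define Δu(n) := Σ_{j=1}^{d} (2u(n) − u(n − e_j) − u(n + e_j)) and |Du(n)|² := Σ_{j=1}^{d} |u(n) − u(n − e_j)|², where e_j is the j-th standard basis vector, and let |n| denote the Euclidean norm of n. Then there exist positive constants c₁, c₂ and a natural number N, independent of d, such that for every d ≥ N: (i) for every finitely supported u : ℤ^d → ℝ with u(0) = 0, Σ_{n∈ℤ^d} |D(Δ^k u)(n)|² ≥ c₁ d^{2k+1} Σ_{n∈ℤ^d, n≠0} |u(n)|²/|n|^{4k+2}; and (ii) there exists a finitely supported u : ℤ^d → ℝ with u(0) = 0, not identically zero, such that Σ_{n∈ℤ^d} |D(Δ^k u)(n)|² ≤ c₂ d^{2k+1} Σ_{n∈ℤ^d, n≠0} |u(n)|²/|n|^{4k+2}. In other words, the sharp constant C₁(k,d) in the discrete higher-order Hardy inequality on ℤ^d grows like d^{2k+1} as d → ∞. -/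
/-- The discrete Laplacian on the lattice `ℤ^d`:
`Δu(n) = Σ_j (2u(n) − u(n − e_j) − u(n + e_j))`. -/
def latticeDelta (d : ℕ) (u : (Fin d → ℤ) → ℝ) (n : Fin d → ℤ) : ℝ :=
  ∑ j : Fin d, (2 * u n - u (n - Pi.single j 1) - u (n + Pi.single j 1))

section FiniteSupport

variable {d : ℕ}

private lemma summable_of_vanishing {ι : Type*} {u f : ι → ℝ}
    (hu : (Function.support u).Finite) (h : ∀ n, u n = 0 → f n = 0) : Summable f :=
  summable_of_hasFiniteSupport (hu.subset fun n hn hun => hn (h n hun))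

private lemma finite_support_shift {u : (Fin d → ℤ) → ℝ} (hu : (Function.support u).Finite)
    (a : Fin d → ℤ) : (Function.support fun n => u (n + a)).Finite :=
  hu.preimage (f := fun n => n + a) (add_left_injective a).injOn

private lemma tsum_shift (f : (Fin d → ℤ) → ℝ) (a : Fin d → ℤ) :
    ∑' n, f (n + a) = ∑' n, f n :=
  (Equiv.addRight a).tsum_eq f

lemma finite_support_latticeDelta {u : (Fin d → ℤ) → ℝ} (hu : (Function.support u).Finite) :
    (Function.support (latticeDelta d u)).Finite := by
  have hfin : (Function.support u ∪ ⋃ j : Fin d,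
      (Function.support (fun n => u (n + -Pi.single j 1)) ∪
        Function.support (fun n => u (n + Pi.single j 1)))).Finite :=
    hu.union (Set.finite_iUnion fun j =>
      (finite_support_shift hu _).union (finite_support_shift hu _))
  refine hfin.subset fun n hn => ?_
  by_contra hcon
  simp only [Set.mem_union, Set.mem_iUnion, Function.mem_support, not_or, not_exists, not_not]
    at hcon
  refine hn (Finset.sum_eq_zero fun j _ => ?_)
  have h := hcon.2 j
  rw [← sub_eq_add_neg] at h
  rw [hcon.1, h.1, h.2]
  ring

lemma finite_support_iterate_latticeDelta (k : ℕ) {u : (Fin d → ℤ) → ℝ}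
    (hu : (Function.support u).Finite) :
    (Function.support ((latticeDelta d)^[k] u)).Finite := by
  induction k generalizing u with
  | zero => exact hu
  | succ k ih => exact ih (finite_support_latticeDelta hu)

private lemma summable_mul_shift {g : (Fin d → ℤ) → ℝ} (hg : (Function.support g).Finite)
    (f : (Fin d → ℤ) → ℝ) (a : Fin d → ℤ) : Summable fun n => f n * g (n + a) :=
  summable_of_vanishing (finite_support_shift hg a) fun n hn => by simp [hn]

private lemma tsum_mul_shift (f g : (Fin d → ℤ) → ℝ) (a : Fin d → ℤ) :
    ∑' n, f n * g (n + a) = ∑' n, f (n + -a) * g n := by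
  rw [← tsum_shift (fun n => f (n + -a) * g n) a]
  simp

/-- Summation by parts: the lattice Laplacian is symmetric. -/
lemma tsum_mul_latticeDelta (f : (Fin d → ℤ) → ℝ) {g : (Fin d → ℤ) → ℝ}
    (hg : (Function.support g).Finite) :
    ∑' n, f n * latticeDelta d g n = ∑' n, latticeDelta d f n * g n := by
  have hs (a : Fin d → ℤ) : Summable fun n => f (n + a) * g n :=
    summable_of_vanishing hg fun n hn => by simp [hn]
  have hs0 : Summable fun n => 2 * (f n * g n) :=
    summable_of_vanishing hg fun n hn => by simp [hn]
  have hl (n : Fin d → ℤ) : f n * latticeDelta d g n = ∑ j : Fin d,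
      (2 * (f n * g n) - f n * g (n + -Pi.single j 1) - f n * g (n + Pi.single j 1)) := by
    simp only [latticeDelta, Finset.mul_sum, ← sub_eq_add_neg]
    exact Finset.sum_congr rfl fun j _ => by ring
  have hr (n : Fin d → ℤ) : latticeDelta d f n * g n = ∑ j : Fin d,
      (2 * (f n * g n) - f (n + - -Pi.single j 1) * g n - f (n + -Pi.single j 1) * g n) := by
    simp only [latticeDelta, Finset.sum_mul, neg_neg, ← sub_eq_add_neg]
    exact Finset.sum_congr rfl fun j _ => by ring
  simp only [hl, hr]
  rw [Summable.tsum_finsetSum fun j _ =>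
      (hs0.sub (summable_mul_shift hg f _)).sub (summable_mul_shift hg f _),
    Summable.tsum_finsetSum fun j _ => (hs0.sub (hs _)).sub (hs _)]
  refine Finset.sum_congr rfl fun j _ => ?_
  rw [(hs0.sub (summable_mul_shift hg f _)).tsum_sub (summable_mul_shift hg f _),
    hs0.tsum_sub (summable_mul_shift hg f _), (hs0.sub (hs _)).tsum_sub (hs _),
    hs0.tsum_sub (hs _), tsum_mul_shift, tsum_mul_shift]

/-- The Dirichlet energy of a finitely supported function. -/
lemma tsum_sq_gradient {v : (Fin d → ℤ) → ℝ} (hv : (Function.support v).Finite) :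
    ∑' n, ∑ j : Fin d, |v n - v (n - Pi.single j 1)| ^ 2 = ∑' n, v n * latticeDelta d v n := by
  have hs (a : Fin d → ℤ) : Summable fun n => v n * v (n + a) := summable_mul_shift hv v a
  have hs1 : Summable fun n => v n * v n := by simpa using hs 0
  have hs2 (a : Fin d → ℤ) : Summable fun n => v (n + a) * v (n + a) :=
    summable_of_vanishing (finite_support_shift hv a) fun n hn => by simp [hn]
  have hl (n : Fin d → ℤ) : ∑ j : Fin d, |v n - v (n - Pi.single j 1)| ^ 2 = ∑ j : Fin d,
      (v n * v n + v (n + -Pi.single j 1) * v (n + -Pi.single j 1)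
        - (v n * v (n + -Pi.single j 1) + v n * v (n + -Pi.single j 1))) := by
    simp only [sq_abs, ← sub_eq_add_neg]
    exact Finset.sum_congr rfl fun j _ => by ring
  have hr (n : Fin d → ℤ) : v n * latticeDelta d v n = ∑ j : Fin d,
      (v n * v n + v n * v n - (v n * v (n + -Pi.single j 1) + v n * v (n + Pi.single j 1))) := by
    simp only [latticeDelta, Finset.mul_sum, ← sub_eq_add_neg]
    exact Finset.sum_congr rfl fun j _ => by ring
  simp only [hl, hr]
  rw [Summable.tsum_finsetSum fun j _ => (hs1.add (hs2 _)).sub ((hs _).add (hs _)),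
    Summable.tsum_finsetSum fun j _ => (hs1.add hs1).sub ((hs _).add (hs _))]
  refine Finset.sum_congr rfl fun j _ => ?_
  rw [(hs1.add (hs2 _)).tsum_sub ((hs _).add (hs _)), (hs1.add hs1).tsum_sub ((hs _).add (hs _)),
    hs1.tsum_add (hs2 _), hs1.tsum_add hs1, (hs _).tsum_add (hs _), (hs _).tsum_add (hs _),
    tsum_shift (fun n => v n * v n), tsum_mul_shift v v (Pi.single j 1)]
  simp only [mul_comm]

end FiniteSupport

section Inequalities

variable {d : ℕ}

/-- Hardy's inequality from a positive function (ground state representation). -/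
lemma hardy_of_pos {φ v : (Fin d → ℤ) → ℝ} (hφ : ∀ n, 0 < φ n)
    (hv : (Function.support v).Finite) :
    ∑' n, v n ^ 2 / φ n * latticeDelta d φ n ≤ ∑' n, v n * latticeDelta d v n := by
  set g : (Fin d → ℤ) → ℝ := fun n => v n ^ 2 / φ n with hg
  have hgs : (Function.support g).Finite := hv.subset fun n hn hvn => hn (by simp [hg, hvn])
  have h1 : Summable fun n => latticeDelta d φ n * g n :=
    summable_of_vanishing hgs fun n hn => by simp [hn]
  have h2 : Summable fun n => φ n * latticeDelta d g n :=
    summable_of_vanishing (finite_support_latticeDelta hgs) fun n hn => by simp [hn]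
  have h3 : Summable fun n => v n * latticeDelta d v n :=
    summable_of_vanishing hv fun n hn => by simp [hn]
  have edge (n m : Fin d → ℤ) : v n * v m ≤ (g n * φ m + φ n * g m) / 2 := by
    have h := mul_nonneg (mul_pos (hφ n) (hφ m)).le (sq_nonneg (v n / φ n - v m / φ m))
    have e : φ n * φ m * (v n / φ n - v m / φ m) ^ 2 =
        g n * φ m + φ n * g m - 2 * (v n * v m) := by
      have := (hφ n).ne'
      have := (hφ m).ne'
      simp only [hg]
      field_simp
      ring
    linarith
  have pt (n : Fin d → ℤ) : (latticeDelta d φ n * g n + φ n * latticeDelta d g n) / 2 ≤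
      v n * latticeDelta d v n := by
    simp only [latticeDelta, Finset.mul_sum, Finset.sum_mul]
    rw [← Finset.sum_add_distrib, Finset.sum_div]
    refine Finset.sum_le_sum fun j _ => ?_
    have e : g n * φ n = v n ^ 2 := div_mul_cancel₀ _ (hφ n).ne'
    linarith [edge n (n - Pi.single j 1), edge n (n + Pi.single j 1)]
  have key := ((h1.add h2).div_const 2).tsum_le_tsum pt h3
  rw [tsum_div_const, h1.tsum_add h2, tsum_mul_latticeDelta φ hgs] at key
  calc _ = ∑' n, latticeDelta d φ n * g n := tsum_congr fun n => mul_comm _ _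
    _ ≤ _ := by linarith

lemma latticeDelta_sq_le (u : (Fin d → ℤ) → ℝ) (n : Fin d → ℤ) :
    latticeDelta d (fun m => u m ^ 2) n ≤ 2 * (u n * latticeDelta d u n) := by
  rw [latticeDelta, latticeDelta, Finset.mul_sum, Finset.mul_sum]
  refine Finset.sum_le_sum fun j _ => ?_
  nlinarith [sq_nonneg (u n - u (n - Pi.single j 1)), sq_nonneg (u n - u (n + Pi.single j 1))]

/-- A weighted Rellich inequality, for weights `w` with `Δw` bounded below. -/
lemma rellich_of_superharmonic {w p q u : (Fin d → ℤ) → ℝ} {b : ℝ} (hb : 0 ≤ b)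
    (hw : ∀ n, 0 ≤ w n) (hwpq : ∀ n, w n ^ 2 = p n * q n)
    (hq : ∀ n, 0 < q n)
    (hΔ : ∀ n, 2 * b * q n ≤ latticeDelta d w n) (hu : (Function.support u).Finite) :
    b ^ 2 * ∑' n, u n ^ 2 * q n ≤ ∑' n, latticeDelta d u n ^ 2 * p n := by
  have hu2 : (Function.support fun n => u n ^ 2).Finite :=
    hu.subset fun n hn hun => hn (by simp [hun])
  have h1 : Summable fun n => w n * latticeDelta d (fun m => u m ^ 2) n :=
    summable_of_vanishing (finite_support_latticeDelta hu2) fun n hn => by simp [hn]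
  have h2 : Summable fun n => u n ^ 2 * q n := summable_of_vanishing hu fun n hn => by simp [hn]
  have h3 : Summable fun n => latticeDelta d u n ^ 2 * p n :=
    summable_of_vanishing (finite_support_latticeDelta hu) fun n hn => by simp [hn]
  have h4 : Summable fun n => latticeDelta d w n * u n ^ 2 :=
    summable_of_vanishing hu fun n hn => by simp [hn]
  have pt (n : Fin d → ℤ) : b * (w n * latticeDelta d (fun m => u m ^ 2) n)
      - b ^ 2 * (u n ^ 2 * q n) ≤ latticeDelta d u n ^ 2 * p n := by
    have i1 := mul_le_mul_of_nonneg_left (latticeDelta_sq_le u n) (mul_nonneg hb (hw n))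
    have i2 : 0 ≤ (latticeDelta d u n * w n - b * u n * q n) ^ 2 / q n :=
      div_nonneg (sq_nonneg _) (hq n).le
    have e : (latticeDelta d u n * w n - b * u n * q n) ^ 2 / q n =
        latticeDelta d u n ^ 2 * p n - 2 * b * w n * (u n * latticeDelta d u n)
          + b ^ 2 * (u n ^ 2 * q n) := by
      rw [div_eq_iff (hq n).ne']
      linear_combination latticeDelta d u n ^ 2 * hwpq n
    nlinarith
  have lower : 2 * b * ∑' n, u n ^ 2 * q n ≤ ∑' n, latticeDelta d w n * u n ^ 2 := by
    rw [← tsum_mul_left]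
    refine (h2.mul_left _).tsum_le_tsum (fun n => ?_) h4
    nlinarith [mul_le_mul_of_nonneg_right (hΔ n) (sq_nonneg (u n))]
  have key := ((h1.mul_left b).sub (h2.mul_left (b ^ 2))).tsum_le_tsum pt h3
  rw [(h1.mul_left b).tsum_sub (h2.mul_left _), tsum_mul_left, tsum_mul_left,
    tsum_mul_latticeDelta w hu2] at key
  nlinarith [mul_le_mul_of_nonneg_left lower hb]

lemma tsum_sq_latticeDelta_le {u : (Fin d → ℤ) → ℝ} (hu : (Function.support u).Finite) :
    ∑' n, latticeDelta d u n ^ 2 ≤ (4 * d) ^ 2 * ∑' n, u n ^ 2 := by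
  have hs : Summable fun n => u n ^ 2 := summable_of_vanishing hu fun n hn => by simp [hn]
  have hsh (a : Fin d → ℤ) : Summable fun n => u (n + a) ^ 2 :=
    summable_of_vanishing (finite_support_shift hu a) fun n hn => by simp [hn]
  have hterm (j : Fin d) : Summable fun n => 4 * d *
      (2 * u n ^ 2 + u (n + -Pi.single j 1) ^ 2 + u (n + Pi.single j 1) ^ 2) :=
    (((hs.mul_left 2).add (hsh _)).add (hsh _)).mul_left _
  have pt (n : Fin d → ℤ) : latticeDelta d u n ^ 2 ≤ ∑ j : Fin d, 4 * d *
      (2 * u n ^ 2 + u (n + -Pi.single j 1) ^ 2 + u (n + Pi.single j 1) ^ 2) := by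
    refine (sq_sum_le_card_mul_sum_sq (s := Finset.univ)).trans ?_
    rw [Finset.mul_sum, Finset.card_univ, Fintype.card_fin]
    refine Finset.sum_le_sum fun j _ => ?_
    rw [mul_comm 4 (d : ℝ), mul_assoc]
    refine mul_le_mul_of_nonneg_left ?_ (Nat.cast_nonneg d)
    rw [← sub_eq_add_neg]
    nlinarith [sq_nonneg (u n + u (n - Pi.single j 1)), sq_nonneg (u n + u (n + Pi.single j 1)),
      sq_nonneg (u (n - Pi.single j 1) - u (n + Pi.single j 1))]
  have key := Summable.tsum_le_tsum pt
    (summable_of_vanishing (finite_support_latticeDelta hu) fun n hn => by simp [hn])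
    (summable_sum fun j _ => hterm j)
  rw [Summable.tsum_finsetSum fun j _ => hterm j] at key
  refine key.trans_eq ?_
  have (j : Fin d) : ∑' n, 4 * d *
      (2 * u n ^ 2 + u (n + -Pi.single j 1) ^ 2 + u (n + Pi.single j 1) ^ 2) =
      4 * d * (4 * ∑' n, u n ^ 2) := by
    rw [tsum_mul_left, ((hs.mul_left 2).add (hsh _)).tsum_add (hsh _),
      (hs.mul_left 2).tsum_add (hsh _), tsum_mul_left, tsum_shift (fun n => u n ^ 2),
      tsum_shift (fun n => u n ^ 2)]
    ring
  simp only [this, Finset.sum_const, Finset.card_univ, Fintype.card_fin, nsmul_eq_mul]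
  ring

lemma tsum_sq_iterate_latticeDelta_le (k : ℕ) {u : (Fin d → ℤ) → ℝ}
    (hu : (Function.support u).Finite) :
    ∑' n, ((latticeDelta d)^[k] u) n ^ 2 ≤ (4 * d) ^ (2 * k) * ∑' n, u n ^ 2 := by
  induction k generalizing u with
  | zero => simp
  | succ k ih =>
    refine (ih (finite_support_latticeDelta hu)).trans ?_
    refine (mul_le_mul_of_nonneg_left (tsum_sq_latticeDelta_le hu) (by positivity)).trans_eq ?_
    ring

lemma tsum_sq_gradient_le {v : (Fin d → ℤ) → ℝ} (hv : (Function.support v).Finite) :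
    ∑' n, ∑ j : Fin d, |v n - v (n - Pi.single j 1)| ^ 2 ≤ 4 * d * ∑' n, v n ^ 2 := by
  have hs : Summable fun n => v n ^ 2 := summable_of_vanishing hv fun n hn => by simp [hn]
  have hsh (a : Fin d → ℤ) : Summable fun n => v (n + a) ^ 2 :=
    summable_of_vanishing (finite_support_shift hv a) fun n hn => by simp [hn]
  have hterm (j : Fin d) : Summable fun n => 2 * (v n ^ 2 + v (n + -Pi.single j 1) ^ 2) :=
    (hs.add (hsh _)).mul_left _
  have pt (n : Fin d → ℤ) : ∑ j : Fin d, |v n - v (n - Pi.single j 1)| ^ 2 ≤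
      ∑ j : Fin d, 2 * (v n ^ 2 + v (n + -Pi.single j 1) ^ 2) := by
    refine Finset.sum_le_sum fun j _ => ?_
    rw [sq_abs, ← sub_eq_add_neg]
    nlinarith [sq_nonneg (v n + v (n - Pi.single j 1))]
  have hsum := summable_sum (s := Finset.univ) fun j _ => hterm j
  have key := (hsum.of_nonneg_of_le (fun n => by positivity) pt).tsum_le_tsum pt hsum
  rw [Summable.tsum_finsetSum fun j _ => hterm j] at key
  refine key.trans_eq ?_
  simp only [tsum_mul_left, hs.tsum_add (hsh _), tsum_shift (fun n => v n ^ 2), Finset.sum_const,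
    Finset.card_univ, Fintype.card_fin, nsmul_eq_mul]
  ring

end Inequalities

section Weight

variable {d : ℕ}

private def shiftedNormSq (n : Fin d → ℤ) : ℝ := 3 + ∑ j, (n j : ℝ) ^ 2

private lemma three_le_shiftedNormSq (n : Fin d → ℤ) : 3 ≤ shiftedNormSq n :=
  le_add_of_nonneg_right (Finset.sum_nonneg fun _ _ => sq_nonneg _)

private lemma shiftedNormSq_pos (n : Fin d → ℤ) : 0 < shiftedNormSq n :=
  three_pos.trans_le (three_le_shiftedNormSq n)

private lemma shiftedNormSq_add_single (n : Fin d → ℤ) (j : Fin d) (c : ℤ) :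
    shiftedNormSq (n + Pi.single j c) = shiftedNormSq n + 2 * c * n j + c ^ 2 := by
  have h (i : Fin d) : (((n + Pi.single j c : Fin d → ℤ) i : ℤ) : ℝ) ^ 2 =
      (n i : ℝ) ^ 2 + if i = j then 2 * (c : ℝ) * n j + (c : ℝ) ^ 2 else 0 := by
    by_cases hij : i = j
    · subst hij
      simp
      ring
    · simp [hij]
  simp only [shiftedNormSq, h, Finset.sum_add_distrib, Finset.sum_ite_eq', Finset.mem_univ, if_true]
  ring

/-- A second order Taylor bound for `x ↦ (1 + x)⁻ᵗ`. -/
private lemma exists_inv_pow_taylor_bound (t : ℕ) :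
    ∃ C : ℝ, 0 ≤ C ∧ ∀ x : ℝ, -(1 / 2) ≤ x → ((1 + x) ^ t)⁻¹ ≤ 1 - t * x + C * x ^ 2 := by
  induction t with
  | zero => exact ⟨0, le_rfl, fun x _ => by simp⟩
  | succ t ih =>
    obtain ⟨C, hC, h⟩ := ih
    refine ⟨2 * (C + (t + 1)), by positivity, fun x hx => ?_⟩
    have h1 : 0 < 1 + x := by linarith
    have h2 : (1 + x)⁻¹ ≤ 2 := by
      rw [inv_le_comm₀ h1 two_pos]
      linarith
    calc ((1 + x) ^ (t + 1))⁻¹ = ((1 + x) ^ t)⁻¹ * (1 + x)⁻¹ := by rw [pow_succ, mul_inv]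
      _ ≤ (1 - t * x + C * x ^ 2) * (1 + x)⁻¹ :=
        mul_le_mul_of_nonneg_right (h x hx) (inv_nonneg.2 h1.le)
      _ = 1 - (t + 1) * x + (C + (t + 1)) * x ^ 2 * (1 + x)⁻¹ := by
        field_simp
        ring
      _ ≤ 1 - (t + 1) * x + (C + (t + 1)) * x ^ 2 * 2 := by gcongr
      _ = _ := by
        push_cast
        ring

private lemma inv_pow_add_le {t : ℕ} {C : ℝ}
    (hC : ∀ x : ℝ, -(1 / 2) ≤ x → ((1 + x) ^ t)⁻¹ ≤ 1 - t * x + C * x ^ 2)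
    {R y : ℝ} (hR : 0 < R) (hy : |y| ≤ R / 2) :
    ((R + y) ^ t)⁻¹ ≤ (R ^ t)⁻¹ * (1 - t * (y / R) + C * (y / R) ^ 2) := by
  have e : R + y = R * (1 + y / R) := by field_simp
  rw [e, mul_pow, mul_inv]
  refine mul_le_mul_of_nonneg_left (hC _ ?_) (by positivity)
  rw [le_div_iff₀ hR]
  linarith [neg_le_of_abs_le hy]

/-- Powers of the shifted squared norm are strictly superharmonic in high dimension. -/
private lemma exists_superharmonic_bound (t : ℕ) (ht : 1 ≤ t) :
    ∃ N : ℕ, ∀ d : ℕ, N ≤ d → ∀ n : Fin d → ℤ,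
      d * ((2 * shiftedNormSq n) ^ (t + 1))⁻¹ ≤
        latticeDelta d (fun m => (shiftedNormSq m ^ t)⁻¹) n := by
  obtain ⟨C, hC0, hC⟩ := exists_inv_pow_taylor_bound t
  refine ⟨⌈8 * C⌉₊, fun d hd n => ?_⟩
  have hdC : 8 * C ≤ d := (Nat.le_ceil _).trans (by exact_mod_cast hd)
  set ρ := shiftedNormSq n with hρ
  have hρ3 : 3 ≤ ρ := three_le_shiftedNormSq n
  set R := ρ + 1 with hR
  have hR0 : 0 < R := by linarith
  have step (j : Fin d) :
      2 * (ρ ^ t)⁻¹ - 2 * (R ^ t)⁻¹ - 8 * C * (R ^ t)⁻¹ * (n j : ℝ) ^ 2 / R ^ 2 ≤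
      2 * (ρ ^ t)⁻¹ - (shiftedNormSq (n - Pi.single j 1) ^ t)⁻¹
        - (shiftedNormSq (n + Pi.single j 1) ^ t)⁻¹ := by
    have hj : 3 + (n j : ℝ) ^ 2 ≤ ρ :=
      add_le_add_right (Finset.single_le_sum (f := fun i => (n i : ℝ) ^ 2)
        (fun i _ => sq_nonneg _) (Finset.mem_univ j)) 3
    have habs : |2 * (n j : ℝ)| ≤ R / 2 := by
      rw [abs_le]
      constructor <;> nlinarith [sq_nonneg ((n j : ℝ) - 2), sq_nonneg ((n j : ℝ) + 2)]
    have e1 : shiftedNormSq (n + Pi.single j 1) = R + 2 * n j := by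
      rw [shiftedNormSq_add_single, hR, hρ]
      push_cast
      ring
    have e2 : shiftedNormSq (n - Pi.single j 1) = R + -(2 * n j) := by
      rw [sub_eq_add_neg, ← Pi.single_neg, shiftedNormSq_add_single, hR, hρ]
      push_cast
      ring
    have b1 := inv_pow_add_le hC hR0 habs
    have b2 := inv_pow_add_le hC hR0 ((abs_neg _).trans_le habs)
    rw [e1, e2]
    have e3 : 8 * C * (R ^ t)⁻¹ * (n j : ℝ) ^ 2 / R ^ 2 =
        2 * (R ^ t)⁻¹ * (C * (2 * (n j : ℝ) / R) ^ 2) := by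
      clear_value R
      ring
    have e4 : -(2 * (n j : ℝ)) / R = -(2 * (n j : ℝ) / R) := neg_div _ _
    rw [e4] at b2
    rw [e3]
    linarith
  have hsum : ∑ j, (n j : ℝ) ^ 2 ≤ R := by
    have : ρ = 3 + ∑ j, (n j : ℝ) ^ 2 := rfl
    linarith
  have gain : (R ^ (t + 1))⁻¹ ≤ (ρ ^ t)⁻¹ - (R ^ t)⁻¹ := by
    have hρ0 : 0 < ρ := by linarith
    have h1 : 1 + R⁻¹ ≤ R / ρ := by
      rw [le_div_iff₀ hρ0]
      have : R⁻¹ * ρ ≤ 1 := by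
        rw [inv_mul_le_iff₀ hR0]
        linarith
      linarith
    have h2 : R / ρ ≤ (R / ρ) ^ t :=
      le_self_pow₀ (by rw [one_le_div hρ0]; linarith) (by omega)
    have h3 := mul_le_mul_of_nonneg_left (h1.trans h2) (inv_nonneg.2 (pow_pos hR0 t).le)
    have h4 : (R ^ t)⁻¹ * (R / ρ) ^ t = (ρ ^ t)⁻¹ := by
      rw [div_pow]
      field_simp
    rw [h4] at h3
    rw [pow_succ, mul_inv]
    linarith
  calc d * ((2 * ρ) ^ (t + 1))⁻¹ ≤ d * (R ^ (t + 1))⁻¹ := by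
        gcongr
        linarith
    _ ≤ 2 * d * (R ^ (t + 1))⁻¹ - 8 * C * (R ^ (t + 1))⁻¹ := by
        have : 0 < (R ^ (t + 1))⁻¹ := by positivity
        nlinarith
    _ ≤ 2 * d * ((ρ ^ t)⁻¹ - (R ^ t)⁻¹) -
          8 * C * (R ^ t)⁻¹ * (∑ j, (n j : ℝ) ^ 2) / R ^ 2 := by
        refine sub_le_sub (mul_le_mul_of_nonneg_left gain (by positivity)) ?_
        calc 8 * C * (R ^ t)⁻¹ * (∑ j, (n j : ℝ) ^ 2) / R ^ 2
            ≤ 8 * C * (R ^ t)⁻¹ * R / R ^ 2 := by gcongr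
          _ = 8 * C * (R ^ (t + 1))⁻¹ := by
            field_simp
            ring
    _ = ∑ j : Fin d,
          (2 * (ρ ^ t)⁻¹ - 2 * (R ^ t)⁻¹ - 8 * C * (R ^ t)⁻¹ * (n j : ℝ) ^ 2 / R ^ 2) := by
        rw [Finset.sum_sub_distrib, ← Finset.sum_div, ← Finset.mul_sum]
        simp
        ring
    _ ≤ _ := Finset.sum_le_sum fun j _ => step j

/-- The higher-order Hardy inequality with the weight `(3 + |n|²)^{-(2k+1)}`. -/
private lemma exists_shifted_hardy (k : ℕ) :
    ∃ c : ℝ, ∃ N : ℕ, 0 < c ∧ ∀ d : ℕ, N ≤ d → ∀ u : (Fin d → ℤ) → ℝ,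
      (Function.support u).Finite →
        c * (d : ℝ) ^ (2 * k + 1) * ∑' n, u n ^ 2 * (shiftedNormSq n ^ (2 * k + 1))⁻¹ ≤
          ∑' n, ∑ j : Fin d, |((latticeDelta d)^[k] u) n -
            ((latticeDelta d)^[k] u) (n - Pi.single j 1)| ^ 2 := by
  induction k with
  | zero =>
    obtain ⟨N, hN⟩ := exists_superharmonic_bound 1 le_rfl
    refine ⟨1 / 4, N, by norm_num, fun d hd u hu => ?_⟩
    rw [Function.iterate_zero, id, tsum_sq_gradient hu]
    refine le_trans ?_ (hardy_of_pos (φ := fun m => (shiftedNormSq m ^ 1)⁻¹)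
      (fun n => inv_pos.2 (pow_pos (shiftedNormSq_pos n) 1)) hu)
    rw [← tsum_mul_left]
    refine Summable.tsum_le_tsum (fun n => ?_)
      (summable_of_vanishing hu fun n hn => by simp [hn])
      (summable_of_vanishing hu fun n hn => by simp [hn])
    have hpos := shiftedNormSq_pos n
    refine le_trans (le_of_eq ?_) (mul_le_mul_of_nonneg_left (hN d hd n) (by positivity))
    field_simp
    ring
  | succ k ih =>
    obtain ⟨c, N, hc, h⟩ := ih
    obtain ⟨M, hM⟩ := exists_superharmonic_bound (2 * k + 2) (by omega)
    set a : ℝ := (2 ^ (2 * k + 4))⁻¹ with ha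
    have ha0 : 0 < a := by positivity
    refine ⟨c * a ^ 2, max N M, by positivity, fun d hd u hu => ?_⟩
    have hd' := max_le_iff.1 hd
    have h1 := h d hd'.1 _ (finite_support_latticeDelta hu)
    have h2 := rellich_of_superharmonic (b := a * d)
      (w := fun n => (shiftedNormSq n ^ (2 * k + 2))⁻¹)
      (p := fun n => (shiftedNormSq n ^ (2 * k + 1))⁻¹)
      (q := fun n => (shiftedNormSq n ^ (2 * k + 3))⁻¹) (by positivity)
      (fun n => inv_nonneg.2 (pow_nonneg (shiftedNormSq_pos n).le _))
      (fun n => by ring)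
      (fun n => inv_pos.2 (pow_pos (shiftedNormSq_pos n) _))
      (fun n => by
        refine (le_of_eq ?_).trans (hM d hd'.2 n)
        rw [mul_pow, mul_inv, ha, pow_succ (2 : ℝ) (2 * k + 3), mul_inv]
        ring) hu
    rw [Function.iterate_succ, Function.comp_apply]
    refine le_trans ?_ h1
    refine le_trans (le_of_eq ?_) (mul_le_mul_of_nonneg_left h2
      (by positivity : (0 : ℝ) ≤ c * (d : ℝ) ^ (2 * k + 1)))
    ring_nf

private lemma tsum_punctured_le (m : ℕ) {u : (Fin d → ℤ) → ℝ}
    (hu : (Function.support u).Finite) :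
    ∑' n : {m : Fin d → ℤ // m ≠ 0}, |u n.1| ^ 2 / (∑ j : Fin d, ((n.1 j : ℝ)) ^ 2) ^ m ≤
      4 ^ m * ∑' n, u n ^ 2 * (shiftedNormSq n ^ m)⁻¹ := by
  have hs : Summable fun n => 4 ^ m * (u n ^ 2 * (shiftedNormSq n ^ m)⁻¹) :=
    summable_of_vanishing hu fun n hn => by simp [hn]
  have hnn (n : Fin d → ℤ) : 0 ≤ 4 ^ m * (u n ^ 2 * (shiftedNormSq n ^ m)⁻¹) := by
    have := shiftedNormSq_pos n
    positivity
  rw [← tsum_mul_left]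
  have pt (n : {m : Fin d → ℤ // m ≠ 0}) :
      |u n.1| ^ 2 / (∑ j : Fin d, ((n.1 j : ℝ)) ^ 2) ^ m ≤
        4 ^ m * (u n.1 ^ 2 * (shiftedNormSq n.1 ^ m)⁻¹) := by
    obtain ⟨n, hn⟩ := n
    obtain ⟨i, hi⟩ := Function.ne_iff.1 hn
    have h1 : (1 : ℝ) ≤ (n i : ℝ) ^ 2 := by
      have : 1 ≤ n i ^ 2 := Int.add_one_le_iff.2 (sq_pos_of_ne_zero hi)
      exact_mod_cast this
    have h2 : (1 : ℝ) ≤ ∑ j, (n j : ℝ) ^ 2 :=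
      h1.trans (Finset.single_le_sum (f := fun j => (n j : ℝ) ^ 2)
        (fun i _ => sq_nonneg _) (Finset.mem_univ i))
    have h3 : shiftedNormSq n ≤ 4 * ∑ j, (n j : ℝ) ^ 2 := by
      unfold shiftedNormSq
      linarith
    have hpos := shiftedNormSq_pos n
    have h4 : shiftedNormSq n ^ m ≤ 4 ^ m * (∑ j, (n j : ℝ) ^ 2) ^ m := by
      rw [← mul_pow]
      exact pow_le_pow_left₀ hpos.le h3 m
    dsimp only
    rw [sq_abs, ← div_eq_mul_inv, mul_div_assoc', div_le_div_iff₀ (by positivity) (by positivity)]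
    nlinarith [mul_le_mul_of_nonneg_left h4 (sq_nonneg (u n))]
  exact (Summable.tsum_le_tsum pt (Summable.of_nonneg_of_le (fun n => by positivity) pt
    (hs.subtype {m | m ≠ 0})) (hs.subtype {m | m ≠ 0})).trans
      (hs.tsum_subtype_le _ {m | m ≠ 0} hnn)

end Weight

/-- The sharp constant `C₁(k,d)` in the discrete higher-order Hardy inequality
`Σ |D(Δ^k u)|² ≥ C₁(k,d) Σ |u(n)|²/|n|^{4k+2}` on `ℤ^d` grows like `d^{2k+1}`
as `d → ∞`. -/
theorem discrete_hardy_sharp_constant_asymptotics (k : ℕ) :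
    ∃ c₁ c₂ : ℝ, ∃ N : ℕ, 0 < c₁ ∧ 0 < c₂ ∧
      ∀ d : ℕ, N ≤ d →
        (∀ u : (Fin d → ℤ) → ℝ, (Function.support u).Finite → u 0 = 0 →
          c₁ * (d : ℝ) ^ (2 * k + 1) *
              ∑' n : {m : Fin d → ℤ // m ≠ 0},
                |u n.1| ^ 2 / (∑ j : Fin d, ((n.1 j : ℝ)) ^ 2) ^ (2 * k + 1) ≤
            ∑' n : Fin d → ℤ, ∑ j : Fin d,
              |((latticeDelta d)^[k] u) n -
                ((latticeDelta d)^[k] u) (n - Pi.single j 1)| ^ 2) ∧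
        ∃ u : (Fin d → ℤ) → ℝ, (Function.support u).Finite ∧ u 0 = 0 ∧ u ≠ 0 ∧
          ∑' n : Fin d → ℤ, ∑ j : Fin d,
              |((latticeDelta d)^[k] u) n -
                ((latticeDelta d)^[k] u) (n - Pi.single j 1)| ^ 2 ≤
            c₂ * (d : ℝ) ^ (2 * k + 1) *
              ∑' n : {m : Fin d → ℤ // m ≠ 0},
                |u n.1| ^ 2 / (∑ j : Fin d, ((n.1 j : ℝ)) ^ 2) ^ (2 * k + 1) := by
  obtain ⟨c, N, hc, hN⟩ := exists_shifted_hardy k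
  refine ⟨c / 4 ^ (2 * k + 1), 4 ^ (2 * k + 1), max N 1, by positivity, by positivity,
    fun d hd => ⟨fun u hu _ => ?_, ?_⟩⟩
  · refine le_trans ?_ (hN d (le_of_max_le_left hd) u hu)
    refine (mul_le_mul_of_nonneg_left (tsum_punctured_le (2 * k + 1) hu)
      (by positivity)).trans_eq ?_
    field_simp
  · have : NeZero d := ⟨by have := le_of_max_le_right hd; omega⟩
    set e : Fin d → ℤ := Pi.single 0 1 with he
    have he0 : e ≠ 0 := by simp [he]
    have hfin : (Function.support (Pi.single e 1 : (Fin d → ℤ) → ℝ)).Finite :=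
      (Set.finite_singleton e).subset Pi.support_single_subset
    refine ⟨Pi.single e 1, hfin, by simp [he0.symm], by simp, ?_⟩
    have hr : ∑' n : {m : Fin d → ℤ // m ≠ 0}, |(Pi.single e 1 : (Fin d → ℤ) → ℝ) n.1| ^ 2 /
        (∑ j : Fin d, ((n.1 j : ℝ)) ^ 2) ^ (2 * k + 1) = 1 := by
      rw [tsum_eq_single ⟨e, he0⟩ fun n hn => by
        have : n.1 ≠ e := fun h => hn (Subtype.ext h)
        simp [this]]
      have : ∑ j : Fin d, (e j : ℝ) ^ 2 = 1 := by
        rw [Finset.sum_eq_single 0 (fun j _ hj => by simp [he, hj]) (by simp)]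
        simp [he]
      simp [this]
    have hl : ∑' n, (Pi.single e 1 : (Fin d → ℤ) → ℝ) n ^ 2 = 1 := by
      rw [tsum_eq_single e fun n hn => by simp [hn]]
      simp
    have h1 := tsum_sq_iterate_latticeDelta_le k hfin
    rw [hl] at h1
    rw [hr]
    refine (tsum_sq_gradient_le (finite_support_iterate_latticeDelta k hfin)).trans ?_
    refine (mul_le_mul_of_nonneg_left h1 (by positivity)).trans_eq ?_
    ring
end

section
/- Let d ≥ 3 and let ψ : ℝ^d → ℂ be a smooth function that is 2π-periodic in each coordinate and has zero average over the cube Q_d := (−π, π)^d, i.e. ∫_{Q_d} ψ(x) dx = 0. Then (d(d−2)²/(3d² + 8d + 4)) ∫_{Q_d} |ψ(x)|² / (Σ_{j=1}^{d} sin²(x_j/2)) dx ≤ ∫_{Q_d} |∇ψ(x)|² dx, where |∇ψ(x)|² := Σ_{j=1}^{d} |∂_{x_j} ψ(x)|². -/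
open Real MeasureTheory

/-- The integral of a partial derivative of a periodic `C¹` function over a period cell vanishes. -/
theorem integral_Icc_fderiv_single_eq_zero {d : ℕ} {E : Type*} [NormedAddCommGroup E]
    [NormedSpace ℝ E] (c : ℝ) {T : ℝ} (hT : 0 ≤ T) {g : (Fin d → ℝ) → E}
    (hg : ContDiff ℝ 1 g) (j : Fin d) (hper : ∀ x, g (x + Pi.single j T) = g x) :
    ∫ x in Set.Icc (fun _ : Fin d => c) (fun _ => c + T), fderiv ℝ g x (Pi.single j 1) = 0 := by
  cases d with
  | zero => exact j.elim0
  | succ n =>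
    have hcont : Continuous fun x => fderiv ℝ g x (Pi.single j 1) := by
      have := hg.continuous_fderiv (by norm_num)
      fun_prop
    have hsum : ∀ x : Fin (n + 1) → ℝ,
        (∑ i, (if i = j then fderiv ℝ g x else 0) (Pi.single i 1)) =
          fderiv ℝ g x (Pi.single j 1) := by
      intro x
      rw [Finset.sum_eq_single j (fun i _ hi => by simp [hi]) (by simp)]
      simp
    have hdiv := integral_divergence_of_hasFDerivAt_off_countable'
      (fun _ : Fin (n + 1) => c) (fun _ => c + T) (fun _ => by simpa using hT)
      (fun i x => if i = j then g x else 0) (fun i x => if i = j then fderiv ℝ g x else 0)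
      ∅ Set.countable_empty
      (fun i => by
        by_cases hi : i = j
        · simpa [hi] using hg.continuous.continuousOn
        · simpa [hi] using continuousOn_const)
      (fun x _ i => by
        by_cases hi : i = j
        · simpa [hi] using (hg.differentiable (by norm_num) x).hasFDerivAt
        · simpa [hi] using hasFDerivAt_const (0 : E) x)
      (by simpa only [hsum] using hcont.continuousOn.integrableOn_compact isCompact_Icc)
    simp only [hsum] at hdiv
    rw [hdiv]
    refine Finset.sum_eq_zero fun i _ => ?_
    by_cases hi : i = j
    · subst hi
      rw [sub_eq_zero]
      refine integral_congr_ae (.of_forall fun y => ?_)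
      have : (Fin.insertNth i (c + T) y : Fin (n + 1) → ℝ) =
          Fin.insertNth i c y + Pi.single i T := by
        ext k
        refine Fin.succAboveCases i ?_ (fun k => ?_) k <;> simp
      simp [this, hper]
    · simp [hi]

section UnitTorus

noncomputable local instance haarUnitAddCircle : MeasureSpace UnitAddCircle := ⟨AddCircle.haarAddCircle⟩

local instance : IsProbabilityMeasure (volume : Measure UnitAddCircle) :=
  inferInstanceAs (IsProbabilityMeasure AddCircle.haarAddCircle)

/-- **Parseval's identity** for a continuous function on the unit cell `[c, c + 1]^d`. -/
theorem hasSum_sq_norm_integral_exp_mul {d : ℕ} (c : ℝ) {f : (Fin d → ℝ) → ℂ}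
    (hf : Continuous f) :
    HasSum (fun n : Fin d → ℤ => ‖∫ x in Set.Icc (fun _ : Fin d => c) (fun _ => c + 1),
        Complex.exp (-(2 * π * Complex.I * ∑ j, (n j : ℂ) * (x j : ℂ))) * f x‖ ^ 2)
      (∫ x in Set.Icc (fun _ : Fin d => c) (fun _ => c + 1), ‖f x‖ ^ 2) := by
  have hpi : {x : Fin d → ℝ | ∀ i, x i ∈ Set.Ioc c (c + 1)} =
      Set.univ.pi fun _ => Set.Ioc c (c + 1) := by
    ext x
    simp
  have hset : {x : Fin d → ℝ | ∀ i, x i ∈ Set.Ioc c (c + 1)} =ᵐ[volume]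
      Set.Icc (fun _ : Fin d => c) (fun _ => c + 1) := by
    rw [hpi]
    exact Measure.univ_pi_Ioc_ae_eq_Icc
  have hmeas : MeasurableSet {x : Fin d → ℝ | ∀ i, x i ∈ Set.Ioc c (c + 1)} := by
    rw [hpi]
    exact .univ_pi fun _ => measurableSet_Ioc
  set e := UnitAddTorus.measurableEquivPiIoc (fun _ : Fin d => c)
  set g : UnitAddTorus (Fin d) → ℂ := fun x => f (e x).1 with hg
  have hgcoe : ∀ x : Fin d → ℝ, (∀ i, x i ∈ Set.Ioc c (c + 1)) →
      g (fun i => (x i : UnitAddCircle)) = f x := by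
    intro x hx
    have : e (fun i => (x i : UnitAddCircle)) = ⟨x, hx⟩ := by
      rw [← MeasurableEquiv.eq_symm_apply]
      rfl
    simp [hg, this]
  have hgm : Measurable g := hf.measurable.comp (measurable_subtype_coe.comp e.measurable)
  obtain ⟨C, hC⟩ := (isCompact_Icc (a := fun _ : Fin d => c)
    (b := fun _ => c + 1)).exists_bound_of_continuousOn hf.continuousOn
  have hLp : MemLp g 2 volume := by
    refine MemLp.of_bound hgm.aestronglyMeasurable C (.of_forall fun x => hC _ ?_)
    exact ⟨fun i => ((e x).2 i).1.le, fun i => ((e x).2 i).2⟩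
  have hparseval := UnitAddTorus.hasSum_sq_mFourierCoeff hLp.toLp
  convert hparseval using 1
  · ext n
    congr 2
    have : UnitAddTorus.mFourierCoeff hLp.toLp n = UnitAddTorus.mFourierCoeff g n :=
      integral_congr_ae (by filter_upwards [hLp.coeFn_toLp] with x hx; rw [hx])
    rw [this, UnitAddTorus.mFourierCoeff_eq_integral g n (fun _ => c), ← setIntegral_congr_set hset]
    refine setIntegral_congr_fun hmeas fun x hx => ?_
    simp only [hgcoe x hx, smul_eq_mul, UnitAddTorus.mFourier, ContinuousMap.coe_mk,
      fourier_coe_apply, ← Complex.exp_sum, Finset.mul_sum, ← Finset.sum_neg_distrib]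
    congr 3
    ext j
    simp
    ring
  · rw [integral_congr_ae (g := fun x => ‖g x‖ ^ 2)
      (by filter_upwards [hLp.coeFn_toLp] with x hx; rw [hx]),
      UnitAddTorus.integral_preimage _ (fun _ => c), ← setIntegral_congr_set hset]
    exact setIntegral_congr_fun hmeas fun x hx => by simp only [hgcoe x hx]

end UnitTorus

/-- Integration by parts: the Fourier coefficients of a partial derivative. -/
theorem integral_exp_mul_fderiv_single {d : ℕ} (c : ℝ) {f : (Fin d → ℝ) → ℂ}
    (hf : ContDiff ℝ 1 f) (j : Fin d) (hper : ∀ x, f (x + Pi.single j 1) = f x)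
    (n : Fin d → ℤ) :
    ∫ x in Set.Icc (fun _ : Fin d => c) (fun _ => c + 1),
        Complex.exp (-(2 * π * Complex.I * ∑ j, (n j : ℂ) * (x j : ℂ))) *
          fderiv ℝ f x (Pi.single j 1) =
      2 * π * Complex.I * n j * ∫ x in Set.Icc (fun _ : Fin d => c) (fun _ => c + 1),
        Complex.exp (-(2 * π * Complex.I * ∑ j, (n j : ℂ) * (x j : ℂ))) * f x := by
  set e : (Fin d → ℝ) → ℂ :=
    fun x => Complex.exp (-(2 * π * Complex.I * ∑ j, (n j : ℂ) * (x j : ℂ))) with he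
  have hed : ContDiff ℝ 1 e := by
    refine Complex.contDiff_exp.comp
      (ContDiff.neg (contDiff_const.mul (ContDiff.sum fun i _ => contDiff_const.mul ?_)))
    exact Complex.ofRealCLM.contDiff.comp (contDiff_apply ℝ ℝ i)
  have hep : ∀ x, e (x + Pi.single j 1) = e x := by
    intro x
    have : -(2 * π * Complex.I * ∑ k, (n k : ℂ) * ((x + Pi.single j 1 : Fin d → ℝ) k : ℂ)) =
        -(2 * π * Complex.I * ∑ k, (n k : ℂ) * (x k : ℂ)) +
          (-(n j) : ℤ) * (2 * π * Complex.I) := by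
      simp only [Pi.add_apply, Complex.ofReal_add, mul_add, Finset.sum_add_distrib]
      rw [Finset.sum_eq_single (s := Finset.univ)
        (f := fun k => (n k : ℂ) * ((Pi.single j 1 : Fin d → ℝ) k : ℂ)) j
        (fun i _ hi => by simp [hi]) (by simp)]
      simp
      ring
    simp only [he, this, Complex.exp_add, Complex.exp_int_mul_two_pi_mul_I, mul_one]
  have hde : ∀ x, fderiv ℝ e x (Pi.single j 1) = -(2 * π * Complex.I * n j) * e x := by
    intro x
    have h1 : HasFDerivAt
        (fun x : Fin d → ℝ => -(2 * π * Complex.I * ∑ j, (n j : ℂ) * (x j : ℂ)))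
        (-((2 * π * Complex.I) • ∑ k, (n k : ℂ) • (Complex.ofRealCLM.comp
          (ContinuousLinearMap.proj (R := ℝ) (φ := fun _ : Fin d => ℝ) k)))) x :=
      HasFDerivAt.neg (HasFDerivAt.const_mul (HasFDerivAt.fun_sum fun k _ =>
        HasFDerivAt.const_mul (Complex.ofRealCLM.comp
          (ContinuousLinearMap.proj (R := ℝ) (φ := fun _ : Fin d => ℝ) k)).hasFDerivAt _) _)
    rw [(h1.cexp).fderiv]
    have h2 : ∑ k, (n k : ℂ) * ((Pi.single j 1 : Fin d → ℝ) k : ℂ) = n j := by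
      rw [Finset.sum_eq_single j (fun i _ hi => by simp [hi]) (by simp)]
      simp
    simp [he, h2]
    ring
  have hzero := integral_Icc_fderiv_single_eq_zero c zero_le_one
    (g := fun x => e x * f x) (hed.mul hf) j (fun x => by simp only [hep, hper])
  have hcf := hf.continuous_fderiv (by norm_num)
  have hprod : ∀ x, fderiv ℝ (fun x => e x * f x) x (Pi.single j 1) =
      e x * fderiv ℝ f x (Pi.single j 1) - 2 * π * Complex.I * n j * (e x * f x) := by
    intro x
    rw [fderiv_fun_mul (hed.differentiable (by norm_num) x) (hf.differentiable (by norm_num) x)]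
    simp [hde]
    ring
  have hec := hed.continuous
  have hfc := hf.continuous
  have hI1 : IntegrableOn (fun x => e x * fderiv ℝ f x (Pi.single j 1))
      (Set.Icc (fun _ : Fin d => c) (fun _ => c + 1)) :=
    ContinuousOn.integrableOn_compact isCompact_Icc (by fun_prop)
  have hI2 : IntegrableOn (fun x => 2 * π * Complex.I * n j * (e x * f x))
      (Set.Icc (fun _ : Fin d => c) (fun _ => c + 1)) :=
    ContinuousOn.integrableOn_compact isCompact_Icc (by fun_prop)
  simp only [hprod] at hzero
  rw [integral_sub hI1 hI2, integral_const_mul, sub_eq_zero] at hzero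
  exact hzero

/-- The **Poincaré inequality** on a unit cell for periodic functions of zero average. -/
theorem poincare_unit_cell {d : ℕ} (c : ℝ) {f : (Fin d → ℝ) → ℂ}
    (hf : ContDiff ℝ 1 f) (hper : ∀ x j, f (x + Pi.single j 1) = f x)
    (havg : ∫ x in Set.Icc (fun _ : Fin d => c) (fun _ => c + 1), f x = 0) :
    (2 * π) ^ 2 * ∫ x in Set.Icc (fun _ : Fin d => c) (fun _ => c + 1), ‖f x‖ ^ 2 ≤
      ∫ x in Set.Icc (fun _ : Fin d => c) (fun _ => c + 1),
        ∑ j, ‖fderiv ℝ f x (Pi.single j 1)‖ ^ 2 := by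
  have hcf := hf.continuous_fderiv (by norm_num)
  rw [integral_finsetSum _ fun j _ =>
    ContinuousOn.integrableOn_compact isCompact_Icc (by fun_prop)]
  refine hasSum_le (fun n => ?_)
    ((hasSum_sq_norm_integral_exp_mul c hf.continuous).mul_left ((2 * π) ^ 2))
    (hasSum_sum fun j _ => hasSum_sq_norm_integral_exp_mul c
      (f := fun x => fderiv ℝ f x (Pi.single j 1)) (by fun_prop))
  simp only [integral_exp_mul_fderiv_single c hf _ (hper · _) n, norm_mul, mul_pow,
    ← Finset.sum_mul, Complex.norm_I, Complex.norm_real, Complex.norm_intCast,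
    Complex.norm_ofNat, norm_eq_abs, sq_abs, mul_one, ← Finset.mul_sum]
  by_cases hn : n = 0
  · simp [hn, havg]
  · obtain ⟨i, hi⟩ := Function.ne_iff.mp hn
    have h1 : (1 : ℝ) ≤ ∑ j, (n j : ℝ) ^ 2 := by
      have : (1 : ℤ) ≤ n i ^ 2 := by
        have hi' : n i ≠ 0 := hi
        have : 0 < n i ^ 2 := by positivity
        omega
      calc (1 : ℝ) ≤ (n i : ℝ) ^ 2 := by exact_mod_cast this
        _ ≤ _ := Finset.single_le_sum (f := fun j => (n j : ℝ) ^ 2)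
          (fun j _ => sq_nonneg _) (Finset.mem_univ i)
    refine mul_le_mul_of_nonneg_right (le_mul_of_one_le_right (by positivity) h1) (by positivity)

/-- The part of the weighted Hardy estimate that only involves the weight `w = ∑ sin²(x_j/2)`. -/
theorem hardy_weight_bound {d w s ε : ℝ} (hd : 3 ≤ d) (hw : 0 ≤ w) (hs : w ^ 2 ≤ d * s)
    (hε : 0 < ε) :
    (d - 2) / (2 * (w + ε)) - (3 * d - 2) / (2 * d) ≤
      (d - 2 * w) / (w + ε) - (2 + (d - 2) / 2) * (w - s) / (w + ε) ^ 2 := by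
  have hv : 0 < w + ε := by positivity
  have hd0 : 0 < d := by linarith
  have key : (d - 2 * w) / (w + ε) - (2 + (d - 2) / 2) * (w - s) / (w + ε) ^ 2 -
      ((d - 2) / (2 * (w + ε)) - (3 * d - 2) / (2 * d)) =
      ((d + 2) * (d * s - w ^ 2) + ε * (d * (d + 2) + (2 * d - 4) * w + (3 * d - 2) * ε)) /
        (2 * d * (w + ε) ^ 2) := by
    field_simp
    ring
  have : 0 ≤ ((d + 2) * (d * s - w ^ 2) +
      ε * (d * (d + 2) + (2 * d - 4) * w + (3 * d - 2) * ε)) / (2 * d * (w + ε) ^ 2) := by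
    have h1 : 0 ≤ d * s - w ^ 2 := by linarith
    have h2 : 0 ≤ 2 * d - 4 := by linarith
    have h3 : 0 ≤ 3 * d - 2 := by linarith
    positivity
  linarith

open Pointwise in
/-- The **Poincaré inequality** on a cell of side `2 * π` for periodic functions of zero average. -/
theorem poincare_two_pi_cell {d : ℕ} (c : ℝ) {f : (Fin d → ℝ) → ℂ}
    (hf : ContDiff ℝ 1 f) (hper : ∀ x j, f (x + Pi.single j (2 * π)) = f x)
    (havg : ∫ x in Set.Icc (fun _ : Fin d => c) (fun _ => c + 2 * π), f x = 0) :
    ∫ x in Set.Icc (fun _ : Fin d => c) (fun _ => c + 2 * π), ‖f x‖ ^ 2 ≤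
      ∫ x in Set.Icc (fun _ : Fin d => c) (fun _ => c + 2 * π),
        ∑ j, ‖fderiv ℝ f x (Pi.single j 1)‖ ^ 2 := by
  have h2π : 0 < 2 * π := by positivity
  have hbox : Set.Icc (fun _ : Fin d => c / (2 * π)) (fun _ => c / (2 * π) + 1) =
      (fun x => (2 * π) • x) ⁻¹' Set.Icc (fun _ : Fin d => c) (fun _ => c + 2 * π) := by
    ext x
    simp only [Set.mem_Icc, Set.mem_preimage, Pi.le_def, Pi.smul_apply, smul_eq_mul,
      div_le_iff₀ h2π, ← sub_le_iff_le_add, le_div_iff₀ h2π, sub_mul, one_mul, mul_comm (2 * π)]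
  have hscale : ∀ {F : Type} [NormedAddCommGroup F] [NormedSpace ℝ F] (g : (Fin d → ℝ) → F),
      ∫ x in Set.Icc (fun _ : Fin d => c / (2 * π)) (fun _ => c / (2 * π) + 1),
        g ((2 * π) • x) = ((2 * π) ^ d)⁻¹ •
          ∫ x in Set.Icc (fun _ : Fin d => c) (fun _ => c + 2 * π), g x := by
    intro F _ _ g
    rw [Measure.setIntegral_comp_smul_of_pos _ _ _ h2π, hbox, Set.preimage_smul₀ h2π.ne',
      smul_inv_smul₀ h2π.ne', Module.finrank_fin_fun]
  have hsm : ContDiff ℝ 1 fun x : Fin d → ℝ => (2 * π) • x := contDiff_const_smul _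
  have hder : ∀ x j, ‖fderiv ℝ (fun x => f ((2 * π) • x)) x (Pi.single j 1)‖ ^ 2 =
      (2 * π) ^ 2 * ‖fderiv ℝ f ((2 * π) • x) (Pi.single j 1)‖ ^ 2 := by
    intro x j
    rw [fderiv_comp_smul]
    simp [mul_pow]
  have key := poincare_unit_cell (c / (2 * π)) (f := fun x => f ((2 * π) • x)) (hf.comp hsm)
    (fun x j => by
      rw [smul_add, ← Pi.single_smul, smul_eq_mul, mul_one, hper])
    (by rw [hscale f, havg, smul_zero])
  simp only [hder, ← Finset.mul_sum] at key
  rw [integral_const_mul, hscale (fun x => ‖f x‖ ^ 2),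
    hscale (fun x => ∑ j, ‖fderiv ℝ f x (Pi.single j 1)‖ ^ 2), smul_eq_mul, smul_eq_mul] at key
  exact le_of_mul_le_mul_left (le_of_mul_le_mul_left key (by positivity)) (by positivity)

/-- The derivative of the weight `∑ sin²(x_k/2)` in the direction of a coordinate. -/
theorem hasFDerivAt_sum_sin_sq {d : ℕ} (x : Fin d → ℝ) :
    HasFDerivAt (fun x : Fin d → ℝ => ∑ k, sin (x k / 2) ^ 2)
      (∑ k, (sin (x k) / 2) • ContinuousLinearMap.proj (R := ℝ) (φ := fun _ : Fin d => ℝ) k) x := by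
  refine HasFDerivAt.fun_sum fun k _ => ?_
  have h1 : HasDerivAt (fun t : ℝ => sin (t / 2) ^ 2) (sin (x k) / 2) (x k) := by
    have := (((hasDerivAt_id (x k)).div_const 2).sin).pow 2
    refine this.congr_deriv ?_
    have h2 := Real.sin_two_mul (x k / 2)
    rw [mul_div_cancel₀ _ two_ne_zero] at h2
    simp [h2]
    ring
  have h2 : HasFDerivAt (fun y : Fin d → ℝ => y k)
      (ContinuousLinearMap.proj (R := ℝ) (φ := fun _ : Fin d => ℝ) k) x := hasFDerivAt_apply k x
  exact h1.comp_hasFDerivAt x h2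

/-- The derivative along a coordinate of the corresponding component of the vector field
`sin(x_j) / (∑ sin²(x_k/2) + ε)`. -/
theorem fderiv_hardy_field_single {d : ℕ} {ε : ℝ} (hε : 0 < ε) (x : Fin d → ℝ) (j : Fin d) :
    fderiv ℝ (fun x : Fin d → ℝ => sin (x j) / (∑ k, sin (x k / 2) ^ 2 + ε)) x (Pi.single j 1) =
      cos (x j) / (∑ k, sin (x k / 2) ^ 2 + ε) -
        sin (x j) ^ 2 / (2 * (∑ k, sin (x k / 2) ^ 2 + ε) ^ 2) := by
  have hv : 0 < ∑ k, sin (x k / 2) ^ 2 + ε := by positivity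
  have hsin := (Real.hasDerivAt_sin (x j)).comp_hasFDerivAt x (hasFDerivAt_apply (𝕜 := ℝ) j x)
  have hquot := hsin.mul
    ((hasDerivAt_inv hv.ne').comp_hasFDerivAt x ((hasFDerivAt_sum_sin_sq x).add_const ε))
  have hsum : ∑ k, sin (x k) / 2 * (Pi.single j 1 : Fin d → ℝ) k = sin (x j) / 2 := by
    rw [Finset.sum_eq_single j (fun i _ hi => by simp [hi]) (by simp)]
    simp
  simp only [div_eq_mul_inv (sin _) (_ + _)]
  refine (congrArg (· (Pi.single j 1)) hquot.fderiv).trans ?_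
  simp [hsum]
  field_simp
  ring

/-- The derivative of `‖f‖² g` along a coordinate. -/
theorem fderiv_norm_sq_mul_single {d : ℕ} {f : (Fin d → ℝ) → ℂ} {g : (Fin d → ℝ) → ℝ}
    {x : Fin d → ℝ} (hf : DifferentiableAt ℝ f x) (hg : DifferentiableAt ℝ g x) (j : Fin d) :
    fderiv ℝ (fun x => ‖f x‖ ^ 2 * g x) x (Pi.single j 1) =
      2 * inner ℝ (f x) (fderiv ℝ f x (Pi.single j 1)) * g x +
        ‖f x‖ ^ 2 * fderiv ℝ g x (Pi.single j 1) := by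
  have := (hf.hasFDerivAt.norm_sq).fun_mul hg.hasFDerivAt
  rw [this.fderiv]
  simp
  ring

/-- Completing the square in the pointwise Hardy estimate. -/
theorem hardy_pointwise {d : ℕ} (hd : 3 ≤ d) {ε : ℝ} (hε : 0 < ε) {f : (Fin d → ℝ) → ℂ}
    {x : Fin d → ℝ} (hf : DifferentiableAt ℝ f x) :
    ((d : ℝ) - 2) ^ 2 / 16 * (‖f x‖ ^ 2 / (∑ k, sin (x k / 2) ^ 2 + ε)) ≤
      ∑ j, ‖fderiv ℝ f x (Pi.single j 1)‖ ^ 2 +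
        ((d : ℝ) - 2) * (3 * d - 2) / (16 * d) * ‖f x‖ ^ 2 +
        ((d : ℝ) - 2) / 8 * ∑ j, fderiv ℝ (fun x => ‖f x‖ ^ 2 *
          (sin (x j) / (∑ k, sin (x k / 2) ^ 2 + ε))) x (Pi.single j 1) := by
  have hd' : (3 : ℝ) ≤ d := by exact_mod_cast hd
  have hv : 0 < ∑ k, sin (x k / 2) ^ 2 + ε := by positivity
  have hg : ∀ j : Fin d, DifferentiableAt ℝ
      (fun x : Fin d → ℝ => sin (x j) / (∑ k, sin (x k / 2) ^ 2 + ε)) x := fun j => by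
    fun_prop (disch := exact hv.ne')
  simp only [fun j => fderiv_norm_sq_mul_single hf (hg j) j, fderiv_hardy_field_single hε x]
  set w := ∑ k, sin (x k / 2) ^ 2 with hw
  set s := ∑ k, (sin (x k / 2) ^ 2) ^ 2 with hs
  have hsq : ∀ j, sin (x j) ^ 2 = 4 * (sin (x j / 2) ^ 2 - (sin (x j / 2) ^ 2) ^ 2) := by
    intro j
    have h2 := Real.sin_two_mul (x j / 2)
    rw [mul_div_cancel₀ _ two_ne_zero] at h2
    rw [h2, mul_pow, mul_pow, Real.cos_sq']
    ring
  have hcos : ∀ j, cos (x j) = 1 - 2 * sin (x j / 2) ^ 2 := by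
    intro j
    have h2 := Real.cos_two_mul (x j / 2)
    rw [mul_div_cancel₀ _ two_ne_zero] at h2
    rw [h2, Real.cos_sq']
    ring
  have hsum_sq : ∑ j, sin (x j) ^ 2 = 4 * (w - s) := by
    simp only [hsq, ← Finset.mul_sum, Finset.sum_sub_distrib, hw, hs]
  have hsum_cos : ∑ j, cos (x j) = d - 2 * w := by
    simp [hcos, Finset.sum_sub_distrib, ← Finset.mul_sum, hw]
  have hcs : w ^ 2 ≤ d * s := by
    simpa using sq_sum_le_card_mul_sum_sq (s := Finset.univ) (f := fun k => sin (x k / 2) ^ 2)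
  have hbound := hardy_weight_bound hd' (show 0 ≤ w by positivity) hcs hε
  have hsquare : 0 ≤ ∑ j, ‖fderiv ℝ f x (Pi.single j 1) +
      (((d : ℝ) - 2) / 8 * (sin (x j) / (w + ε))) • f x‖ ^ 2 := by positivity
  have hexpand : ∀ j, ‖fderiv ℝ f x (Pi.single j 1) +
      (((d : ℝ) - 2) / 8 * (sin (x j) / (w + ε))) • f x‖ ^ 2 =
      ‖fderiv ℝ f x (Pi.single j 1)‖ ^ 2 + ((d : ℝ) - 2) / 8 *
        (2 * inner ℝ (f x) (fderiv ℝ f x (Pi.single j 1)) * (sin (x j) / (w + ε))) +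
        ((d : ℝ) - 2) ^ 2 / 64 * ‖f x‖ ^ 2 / (w + ε) ^ 2 * sin (x j) ^ 2 := by
    intro j
    rw [norm_add_sq_real, inner_smul_right, norm_smul, mul_pow, norm_eq_abs, sq_abs,
      real_inner_comm]
    field_simp
    ring
  simp only [hexpand, Finset.sum_add_distrib, ← Finset.mul_sum, hsum_sq] at hsquare
  simp only [Finset.sum_add_distrib, ← Finset.mul_sum, Finset.sum_sub_distrib, ← Finset.sum_div,
    hsum_cos, hsum_sq]
  have hscaled := mul_le_mul_of_nonneg_left hbound
    (show 0 ≤ ((d : ℝ) - 2) / 8 * ‖f x‖ ^ 2 from mul_nonneg (by linarith) (by positivity))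
  have e1 : ((d : ℝ) - 2) / 8 * ‖f x‖ ^ 2 *
      (((d : ℝ) - 2) / (2 * (w + ε)) - (3 * d - 2) / (2 * d)) =
      ((d : ℝ) - 2) ^ 2 / 16 * (‖f x‖ ^ 2 / (w + ε)) -
        ((d : ℝ) - 2) * (3 * d - 2) / (16 * d) * ‖f x‖ ^ 2 := by
    field_simp
    ring
  have e2 : ((d : ℝ) - 2) / 8 * ‖f x‖ ^ 2 *
      ((d - 2 * w) / (w + ε) - (2 + ((d : ℝ) - 2) / 2) * (w - s) / (w + ε) ^ 2) =
      ((d : ℝ) - 2) / 8 * (‖f x‖ ^ 2 * ((d - 2 * w) / (w + ε) -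
        4 * (w - s) / (2 * (w + ε) ^ 2))) -
        ((d : ℝ) - 2) ^ 2 / 64 * ‖f x‖ ^ 2 / (w + ε) ^ 2 * (4 * (w - s)) := by
    field_simp
    ring
  rw [e1, e2] at hscaled
  linarith

/-- The Hardy inequality with the regularized weight `1 / (∑ sin²(x_k/2) + ε)`. -/
theorem regularized_torus_hardy {d : ℕ} (hd : 3 ≤ d) {ε : ℝ} (hε : 0 < ε) (c : ℝ)
    {f : (Fin d → ℝ) → ℂ} (hf : ContDiff ℝ 1 f)
    (hper : ∀ x j, f (x + Pi.single j (2 * π)) = f x)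
    (havg : ∫ x in Set.Icc (fun _ : Fin d => c) (fun _ => c + 2 * π), f x = 0) :
    (d : ℝ) * ((d : ℝ) - 2) ^ 2 / (3 * (d : ℝ) ^ 2 + 8 * (d : ℝ) + 4) *
        ∫ x in Set.Icc (fun _ : Fin d => c) (fun _ => c + 2 * π),
          ‖f x‖ ^ 2 / (∑ k, sin (x k / 2) ^ 2 + ε) ≤
      ∫ x in Set.Icc (fun _ : Fin d => c) (fun _ => c + 2 * π),
        ∑ j, ‖fderiv ℝ f x (Pi.single j 1)‖ ^ 2 := by
  have hd' : (3 : ℝ) ≤ d := by exact_mod_cast hd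
  have hv : ∀ x : Fin d → ℝ, ∑ k, sin (x k / 2) ^ 2 + ε ≠ 0 := fun x => by positivity
  have hfc := hf.continuous
  have hdfc := hf.continuous_fderiv (by norm_num)
  have hu : ∀ j : Fin d, ContDiff ℝ 1 fun x : Fin d → ℝ =>
      ‖f x‖ ^ 2 * (sin (x j) / (∑ k, sin (x k / 2) ^ 2 + ε)) := fun j =>
    (hf.norm_sq ℝ).mul (ContDiff.div (by fun_prop) (by fun_prop) hv)
  have hint : ∀ {g : (Fin d → ℝ) → ℝ}, Continuous g →
      IntegrableOn g (Set.Icc (fun _ : Fin d => c) (fun _ => c + 2 * π)) := fun hg =>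
    hg.continuousOn.integrableOn_compact isCompact_Icc
  have hperu : ∀ (j : Fin d) (x : Fin d → ℝ),
      ‖f (x + Pi.single j (2 * π))‖ ^ 2 * (sin ((x + Pi.single j (2 * π) : Fin d → ℝ) j) /
        (∑ k, sin ((x + Pi.single j (2 * π) : Fin d → ℝ) k / 2) ^ 2 + ε)) =
      ‖f x‖ ^ 2 * (sin (x j) / (∑ k, sin (x k / 2) ^ 2 + ε)) := by
    intro j x
    have hk : ∀ k, sin ((x + Pi.single j (2 * π) : Fin d → ℝ) k / 2) ^ 2 =
        sin (x k / 2) ^ 2 := by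
      intro k
      by_cases hkj : k = j
      · subst hkj
        simp [add_div, Real.sin_add_pi]
      · simp [hkj]
    simp only [hper, hk]
    simp
  have hdu : ∀ j : Fin d, Continuous fun x => fderiv ℝ (fun x : Fin d → ℝ =>
      ‖f x‖ ^ 2 * (sin (x j) / (∑ k, sin (x k / 2) ^ 2 + ε))) x (Pi.single j 1) := fun j => by
    have := (hu j).continuous_fderiv (by norm_num)
    fun_prop
  have hzero : ∫ x in Set.Icc (fun _ : Fin d => c) (fun _ => c + 2 * π),
      ∑ j, fderiv ℝ (fun x : Fin d → ℝ =>
        ‖f x‖ ^ 2 * (sin (x j) / (∑ k, sin (x k / 2) ^ 2 + ε))) x (Pi.single j 1) = 0 := by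
    rw [integral_finsetSum _ fun j _ => hint (hdu j)]
    exact Finset.sum_eq_zero fun j _ =>
      integral_Icc_fderiv_single_eq_zero c (by positivity) (hu j) j (hperu j)
  have hw : Continuous fun x : Fin d → ℝ => ‖f x‖ ^ 2 / (∑ k, sin (x k / 2) ^ 2 + ε) :=
    Continuous.div (by fun_prop) (by fun_prop) hv
  have hgrad : Continuous fun x => ∑ j, ‖fderiv ℝ f x (Pi.single j 1)‖ ^ 2 := by fun_prop
  have hnorm : Continuous fun x => ‖f x‖ ^ 2 := by fun_prop
  have hdivc : Continuous fun x => ∑ j, fderiv ℝ (fun x : Fin d → ℝ =>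
        ‖f x‖ ^ 2 * (sin (x j) / (∑ k, sin (x k / 2) ^ 2 + ε))) x (Pi.single j 1) :=
    continuous_finsetSum _ fun j _ => hdu j
  have hmono := integral_mono
    (μ := volume.restrict (Set.Icc (fun _ : Fin d => c) (fun _ => c + 2 * π)))
    (hint (hw.const_mul (((d : ℝ) - 2) ^ 2 / 16)))
    (((hint hgrad).add (hint (hnorm.const_mul (((d : ℝ) - 2) * (3 * d - 2) / (16 * d))))).add
      (hint (hdivc.const_mul (((d : ℝ) - 2) / 8))))
    (fun x => hardy_pointwise hd hε (hf.differentiable (by norm_num) x))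
  simp only [Pi.add_apply] at hmono
  rw [integral_add, integral_add, integral_const_mul, integral_const_mul, integral_const_mul,
    hzero] at hmono
  · have hpoinc := poincare_two_pi_cell c hf hper havg
    have hK := mul_le_mul_of_nonneg_left hpoinc
      (show 0 ≤ ((d : ℝ) - 2) * (3 * d - 2) / (16 * d) from
        div_nonneg (mul_nonneg (by linarith) (by linarith)) (by linarith))
    have hd0 : (0 : ℝ) < d := by linarith
    set G := ∫ x in Set.Icc (fun _ : Fin d => c) (fun _ => c + 2 * π),
        ∑ j, ‖fderiv ℝ f x (Pi.single j 1)‖ ^ 2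
    set H := ∫ x in Set.Icc (fun _ : Fin d => c) (fun _ => c + 2 * π),
          ‖f x‖ ^ 2 / (∑ k, sin (x k / 2) ^ 2 + ε)
    have hGH : ((d : ℝ) - 2) ^ 2 / 16 * H ≤
        (3 * (d : ℝ) ^ 2 + 8 * d + 4) / (16 * d) * G := by
      have : (3 * (d : ℝ) ^ 2 + 8 * d + 4) / (16 * d) * G =
          G + ((d : ℝ) - 2) * (3 * d - 2) / (16 * d) * G := by
        field_simp
        ring
      linarith
    calc _ = 16 * d / (3 * (d : ℝ) ^ 2 + 8 * d + 4) * (((d : ℝ) - 2) ^ 2 / 16 * H) := by ring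
      _ ≤ 16 * d / (3 * (d : ℝ) ^ 2 + 8 * d + 4) *
          ((3 * (d : ℝ) ^ 2 + 8 * d + 4) / (16 * d) * G) := by gcongr
      _ = G := by field_simp
  · exact hint hgrad
  · exact hint (hnorm.const_mul _)
  · exact (hint hgrad).add (hint (hnorm.const_mul _))
  · exact hint (hdivc.const_mul _)

/-- Hardy inequality on the torus `Q_d = (−π,π)^d` for smooth periodic functions
with zero average, `d ≥ 3`:
`(d(d−2)²/(3d²+8d+4)) ∫ |ψ|²/Σ_j sin²(x_j/2) ≤ ∫ |∇ψ|²`. -/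
theorem torus_hardy_inequality (d : ℕ) (hd : 3 ≤ d) (ψ : (Fin d → ℝ) → ℂ)
    (hsmooth : ContDiff ℝ (⊤ : ℕ∞) ψ)
    (hper : ∀ (x : Fin d → ℝ) (j : Fin d), ψ (x + Pi.single j (2 * π)) = ψ x)
    (havg : (∫ x in Set.pi Set.univ fun _ : Fin d => Set.Ioo (-π) π, ψ x) = 0) :
    ENNReal.ofReal ((d : ℝ) * ((d : ℝ) - 2) ^ 2 / (3 * (d : ℝ) ^ 2 + 8 * (d : ℝ) + 4)) *
        ∫⁻ x in Set.pi Set.univ fun _ : Fin d => Set.Ioo (-π) π,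
          ENNReal.ofReal (‖ψ x‖ ^ 2 / ∑ j : Fin d, Real.sin (x j / 2) ^ 2) ≤
      ∫⁻ x in Set.pi Set.univ fun _ : Fin d => Set.Ioo (-π) π,
        ENNReal.ofReal (∑ j : Fin d, ‖fderiv ℝ ψ x (Pi.single j 1)‖ ^ 2) := by
  have hf : ContDiff ℝ 1 ψ := hsmooth.of_le (by exact_mod_cast le_top)
  have hfc := hf.continuous
  have hdfc := hf.continuous_fderiv (by norm_num)
  have hbox : (Set.pi Set.univ fun _ : Fin d => Set.Ioo (-π) π) =ᵐ[volume]
      Set.Icc (fun _ : Fin d => -π) (fun _ => -π + 2 * π) := by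
    rw [show -π + 2 * π = π by ring]
    exact Measure.univ_pi_Ioo_ae_eq_Icc
  rw [setIntegral_congr_set hbox] at havg
  rw [setLIntegral_congr hbox, setLIntegral_congr hbox]
  set μ := (volume : Measure (Fin d → ℝ)).restrict
    (Set.Icc (fun _ : Fin d => -π) (fun _ => -π + 2 * π))
  have hint : ∀ {g : (Fin d → ℝ) → ℝ}, Continuous g → Integrable g μ := fun hg =>
    hg.continuousOn.integrableOn_compact isCompact_Icc
  have hε : ∀ n : ℕ, (0 : ℝ) < 1 / ((n : ℝ) + 1) := fun n => by positivity
  have hcont : ∀ n : ℕ, Continuous fun x : Fin d → ℝ =>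
      ‖ψ x‖ ^ 2 / (∑ k, sin (x k / 2) ^ 2 + 1 / ((n : ℝ) + 1)) := fun n =>
    Continuous.div (by fun_prop) (by fun_prop) fun x => by positivity
  have hfatou : ∫⁻ x, ENNReal.ofReal (‖ψ x‖ ^ 2 / ∑ j : Fin d, Real.sin (x j / 2) ^ 2) ∂μ ≤
      Filter.liminf (fun n : ℕ => ∫⁻ x, ENNReal.ofReal
        (‖ψ x‖ ^ 2 / (∑ k, sin (x k / 2) ^ 2 + 1 / ((n : ℝ) + 1))) ∂μ) Filter.atTop := by
    refine (lintegral_mono fun x => ?_).trans (lintegral_liminf_le fun n => by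
      have := (hcont n).measurable
      fun_prop)
    by_cases hx : ∑ j : Fin d, Real.sin (x j / 2) ^ 2 = 0
    · simp [hx]
    · refine (Filter.Tendsto.liminf_eq (ENNReal.tendsto_ofReal ?_)).ge
      refine Filter.Tendsto.div tendsto_const_nhds ?_ hx
      simpa using (tendsto_one_div_add_atTop_nhds_zero_nat (𝕜 := ℝ)).const_add
        (∑ j : Fin d, Real.sin (x j / 2) ^ 2)
  have hC : 0 ≤ (d : ℝ) * ((d : ℝ) - 2) ^ 2 / (3 * (d : ℝ) ^ 2 + 8 * (d : ℝ) + 4) := by positivity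
  refine (mul_le_mul_right hfatou _).trans ?_
  rw [← ENNReal.liminf_const_mul_of_ne_top ENNReal.ofReal_ne_top]
  refine (Filter.liminf_le_liminf (.of_forall fun n => ?_)).trans
    (Filter.liminf_const _).le
  rw [← ofReal_integral_eq_lintegral_ofReal (hint (hcont n)) (.of_forall fun x => by positivity),
    ← ofReal_integral_eq_lintegral_ofReal (hint (by fun_prop)) (.of_forall fun x => by positivity),
    ← ENNReal.ofReal_mul hC]
  exact ENNReal.ofReal_le_ofReal (regularized_torus_hardy hd (hε n) (-π) hf hper havg)
end

section
/- Let d ≥ 8 and let ψ : ℝ^d → ℂ be a smooth function that is 2π-periodic in each coordinate and has zero average over the cube Q_d := (−π, π)^d, i.e. ∫_{Q_d} ψ(x) dx = 0. Then (d²/(3d + 20)) ∫_{Q_d} |∇ψ(x)|² / (Σ_{j=1}^{d} sin²(x_j/2)) dx ≤ ∫_{Q_d} |Δψ(x)|² dx, where |∇ψ(x)|² := Σ_{j=1}^{d} |∂_{x_j} ψ(x)|² and Δψ := Σ_{j=1}^{d} ∂²_{x_j} ψ. -/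
open Real MeasureTheory

/-- **Wirtinger's inequality** on `(-π, π)`. -/
theorem integral_sq_le_integral_deriv_sq {f f' : ℝ → ℝ} (hf : ∀ x, HasDerivAt f (f' x) x)
    (hf' : Continuous f') (hper : f π = f (-π)) (hzero : ∫ x in (-π)..π, f x = 0) :
    ∫ x in (-π)..π, f x ^ 2 ≤ ∫ x in (-π)..π, f' x ^ 2 := by
  have hab : -π < π := by linarith [pi_pos]
  have hfc : Continuous f := continuous_iff_continuousAt.2 fun x => (hf x).continuousAt
  have parseval : ∀ g : ℝ → ℝ, Continuous g →
      HasSum (fun i => ‖fourierCoeffOn hab (fun x => (g x : ℂ)) i‖ ^ 2)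
        ((π - -π)⁻¹ • ∫ x in (-π)..π, g x ^ 2) := by
    intro g hg
    have hgc : Continuous fun x => (g x : ℂ) := by fun_prop
    have hL : MemLp (fun x => (g x : ℂ)) 2 (volume.restrict (Set.Ioc (-π) π)) := by
      rw [memLp_two_iff_integrable_sq_norm hgc.aestronglyMeasurable]
      exact ((hgc.norm.pow 2).integrableOn_Icc).mono_set Set.Ioc_subset_Icc_self
    simpa using hasSum_sq_fourierCoeffOn hab hL
  have hle : ∀ n : ℤ, ‖fourierCoeffOn hab (fun x => (f x : ℂ)) n‖ ^ 2 ≤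
      ‖fourierCoeffOn hab (fun x => (f' x : ℂ)) n‖ ^ 2 := by
    intro n
    rcases eq_or_ne n 0 with rfl | hn
    · have : fourierCoeffOn hab (fun x => (f x : ℂ)) 0 = 0 := by
        rw [fourierCoeffOn_eq_integral]
        simp [intervalIntegral.integral_ofReal, hzero]
      rw [this]
      simp
    · rw [fourierCoeffOn_of_hasDerivAt hab hn (f' := fun x => (f' x : ℂ))
        (fun x _ => (hf x).ofReal_comp)
        ((Complex.continuous_ofReal.comp hf').intervalIntegrable _ _), hper]
      have h1 : (1 : ℝ) ≤ |(n : ℝ)| := by exact_mod_cast Int.one_le_abs hn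
      have hp := pi_pos
      gcongr
      rw [sub_self, mul_zero, zero_sub, norm_mul, norm_neg, norm_mul]
      have e : ‖(1 : ℂ) / (-2 * π * Complex.I * n)‖ = 1 / (2 * π * |(n : ℝ)|) := by
        simp [abs_of_pos hp]
      have e2 : ‖((π : ℝ) : ℂ) - ((-π : ℝ) : ℂ)‖ = 2 * π := by
        rw [← Complex.ofReal_sub, Complex.norm_real, norm_eq_abs, abs_of_pos (by linarith)]
        ring
      rw [e, e2, ← mul_assoc]
      refine mul_le_of_le_one_left (norm_nonneg _) ?_
      rw [div_mul_eq_mul_div, one_mul, div_le_one (by positivity)]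
      nlinarith
  have h := hasSum_le hle (parseval f hfc) (parseval f' hf')
  exact le_of_mul_le_mul_left h (by have := pi_pos; simp; linarith)

/-- The measure on `ℝ^d` given by restricting Lebesgue measure to the cube `(-π, π)^d`. -/
noncomputable abbrev cubeMeasure (d : ℕ) : Measure (Fin d → ℝ) :=
  Measure.pi fun _ => volume.restrict (Set.Ioo (-π) π)

theorem volume_restrict_cube (d : ℕ) :
    (volume : Measure (Fin d → ℝ)).restrict (Set.pi Set.univ fun _ => Set.Ioo (-π) π) =
      cubeMeasure d := Measure.restrict_pi_pi _ _

theorem Continuous.integrable_cubeMeasure {d : ℕ} {f : (Fin d → ℝ) → ℝ}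
    (hf : Continuous f) : Integrable f (cubeMeasure d) := by
  rw [← volume_restrict_cube]
  refine (hf.continuousOn.integrableOn_compact
    (isCompact_univ_pi fun _ : Fin d => isCompact_Icc (a := -π) (b := π))).mono_set
    (Set.pi_mono fun _ _ => Set.Ioo_subset_Icc_self)

theorem measurePreserving_insertNth {n : ℕ} (j : Fin (n + 1)) :
    MeasurePreserving (fun p : ℝ × (Fin n → ℝ) => j.insertNth p.1 p.2 : _ → Fin (n + 1) → ℝ)
      ((volume.restrict (Set.Ioo (-π) π)).prod (cubeMeasure n)) (cubeMeasure (n + 1)) :=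
  (measurePreserving_piFinSuccAbove
    (fun _ : Fin (n + 1) => (volume : Measure ℝ).restrict (Set.Ioo (-π) π)) j).symm

/-- Fubini on the cube, integrating the `j`-th coordinate first. -/
theorem integral_cubeMeasure_succ {n : ℕ} (j : Fin (n + 1)) {f : (Fin (n + 1) → ℝ) → ℝ}
    (hf : Continuous f) :
    Integrable (fun y => ∫ t in (-π)..π, f (j.insertNth t y)) (cubeMeasure n) ∧
    ∫ x, f x ∂cubeMeasure (n + 1) =
      ∫ y, (∫ t in (-π)..π, f (j.insertNth t y)) ∂cubeMeasure n := by
  have hmp := measurePreserving_insertNth j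
  have hint : Integrable (fun p : ℝ × (Fin n → ℝ) => f (j.insertNth p.1 p.2))
      ((volume.restrict (Set.Ioo (-π) π)).prod (cubeMeasure n)) :=
    hmp.integrable_comp_of_integrable hf.integrable_cubeMeasure
  have hi : ∀ y, ∫ t in (-π)..π, f (j.insertNth t y) =
      ∫ t in Set.Ioo (-π) π, f (j.insertNth t y) := fun y => by
    rw [intervalIntegral.integral_of_le (by linarith [pi_pos]), integral_Ioc_eq_integral_Ioo]
  simp_rw [hi]
  refine ⟨hint.integral_prod_right, ?_⟩
  rw [← integral_prod_symm _ hint, ← hmp.map_eq,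
    integral_map hmp.measurable.aemeasurable (hmp.map_eq ▸ hf.aestronglyMeasurable)]

/-- The `i`-th partial derivative of a function on `ℝ^d`. -/
noncomputable def pderiv {d : ℕ} (i : Fin d) (f : (Fin d → ℝ) → ℝ) (x : Fin d → ℝ) : ℝ :=
  fderiv ℝ f x (Pi.single i 1)

/-- Smooth functions on `ℝ^d` that are `2π`-periodic in each coordinate. -/
structure SmoothPeriodic {d : ℕ} (f : (Fin d → ℝ) → ℝ) : Prop where
  contDiff : ContDiff ℝ (⊤ : ℕ∞) f
  periodic : ∀ (x : Fin d → ℝ) (j : Fin d), f (x + Pi.single j (2 * π)) = f x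

namespace SmoothPeriodic

variable {d : ℕ} {f g : (Fin d → ℝ) → ℝ}

theorem continuous (hf : SmoothPeriodic f) : Continuous f := hf.contDiff.continuous

theorem differentiable (hf : SmoothPeriodic f) : Differentiable ℝ f :=
  hf.contDiff.differentiable (by simp)

theorem integrable (hf : SmoothPeriodic f) : Integrable f (cubeMeasure d) :=
  hf.continuous.integrable_cubeMeasure

theorem const (c : ℝ) : SmoothPeriodic (fun _ : Fin d → ℝ => c) :=
  ⟨contDiff_const, fun _ _ => rfl⟩

theorem add (hf : SmoothPeriodic f) (hg : SmoothPeriodic g) :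
    SmoothPeriodic (fun x => f x + g x) :=
  ⟨hf.contDiff.add hg.contDiff, fun x j => by simp [hf.periodic, hg.periodic]⟩

theorem sub (hf : SmoothPeriodic f) (hg : SmoothPeriodic g) :
    SmoothPeriodic (fun x => f x - g x) :=
  ⟨hf.contDiff.sub hg.contDiff, fun x j => by simp [hf.periodic, hg.periodic]⟩

theorem mul (hf : SmoothPeriodic f) (hg : SmoothPeriodic g) :
    SmoothPeriodic (fun x => f x * g x) :=
  ⟨hf.contDiff.mul hg.contDiff, fun x j => by simp [hf.periodic, hg.periodic]⟩

theorem pow (hf : SmoothPeriodic f) (n : ℕ) : SmoothPeriodic (fun x => f x ^ n) :=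
  ⟨hf.contDiff.pow n, fun x j => by simp [hf.periodic]⟩

theorem div (hf : SmoothPeriodic f) (hg : SmoothPeriodic g) (h0 : ∀ x, g x ≠ 0) :
    SmoothPeriodic (fun x => f x / g x) :=
  ⟨hf.contDiff.div hg.contDiff h0, fun x j => by simp [hf.periodic, hg.periodic]⟩

theorem sum {ι : Type*} {s : Finset ι} {f : ι → (Fin d → ℝ) → ℝ}
    (hf : ∀ i ∈ s, SmoothPeriodic (f i)) : SmoothPeriodic (fun x => ∑ i ∈ s, f i x) :=
  ⟨ContDiff.sum fun i hi => (hf i hi).contDiff,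
    fun x j => Finset.sum_congr rfl fun i hi => (hf i hi).periodic x j⟩

theorem pderiv (hf : SmoothPeriodic f) (i : Fin d) : SmoothPeriodic (pderiv i f) := by
  refine ⟨(hf.contDiff.fderiv_right (m := (⊤ : ℕ∞)) (by simp)).clm_apply contDiff_const,
    fun x j => ?_⟩
  have h : (fun y => f (y + Pi.single j (2 * π))) = f := funext fun y => hf.periodic y j
  rw [_root_.pderiv, _root_.pderiv, ← fderiv_comp_add_right, h]

theorem pderiv_comm (hf : SmoothPeriodic f) (i j : Fin d) (x : Fin d → ℝ) :
    _root_.pderiv i (_root_.pderiv j f) x = _root_.pderiv j (_root_.pderiv i f) x := by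
  have hd : DifferentiableAt ℝ (fderiv ℝ f) x :=
    (hf.contDiff.fderiv_right (m := (⊤ : ℕ∞)) (by simp)).differentiable (by simp) x
  have key : ∀ k l : Fin d, _root_.pderiv k (_root_.pderiv l f) x =
      fderiv ℝ (fderiv ℝ f) x (Pi.single k 1) (Pi.single l 1) := fun k l => by
    have : _root_.pderiv l f = fun y => fderiv ℝ f y (Pi.single l 1) := rfl
    rw [this, _root_.pderiv, fderiv_clm_apply hd (differentiableAt_const _)]
    simp
  rw [key, key]
  exact (hf.contDiff.contDiffAt.isSymmSndFDerivAt (by simp; exact WithTop.coe_le_coe.2 le_top)) _ _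

theorem hasDerivAt_insertNth {n : ℕ} {f : (Fin (n + 1) → ℝ) → ℝ} (hf : SmoothPeriodic f)
    (j : Fin (n + 1)) (y : Fin n → ℝ) (t : ℝ) :
    HasDerivAt (fun t => f (j.insertNth t y)) (_root_.pderiv j f (j.insertNth t y)) t := by
  refine (hf.differentiable _).hasFDerivAt.comp_hasDerivAt t ?_
  rw [hasDerivAt_pi, j.forall_iff_succAbove]
  refine ⟨by simpa using hasDerivAt_id' t, fun k => ?_⟩
  simpa [Fin.succAbove_ne] using hasDerivAt_const t (y k)

theorem insertNth_pi {n : ℕ} {f : (Fin (n + 1) → ℝ) → ℝ} (hf : SmoothPeriodic f)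
    (j : Fin (n + 1)) (y : Fin n → ℝ) : f (j.insertNth π y) = f (j.insertNth (-π) y) := by
  rw [← hf.periodic (j.insertNth (-π) y) j]
  congr 1
  ext k
  rcases j.eq_self_or_eq_succAbove k with rfl | ⟨k, rfl⟩
  · simp; ring
  · simp [Fin.succAbove_ne]

theorem continuous_insertNth {n : ℕ} {f : (Fin (n + 1) → ℝ) → ℝ} (hf : SmoothPeriodic f)
    (j : Fin (n + 1)) (y : Fin n → ℝ) : Continuous fun t => f (j.insertNth t y) :=
  continuous_iff_continuousAt.2 fun t => (hf.hasDerivAt_insertNth j y t).continuousAt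

theorem intervalIntegral_pderiv {n : ℕ} {f : (Fin (n + 1) → ℝ) → ℝ} (hf : SmoothPeriodic f)
    (j : Fin (n + 1)) (y : Fin n → ℝ) :
    ∫ t in (-π)..π, _root_.pderiv j f (j.insertNth t y) = 0 := by
  rw [intervalIntegral.integral_eq_sub_of_hasDerivAt
    (fun t _ => hf.hasDerivAt_insertNth j y t)
    (((hf.pderiv j).continuous_insertNth j y).intervalIntegrable _ _), hf.insertNth_pi, sub_self]

theorem integral_pderiv (hf : SmoothPeriodic f) (j : Fin d) :
    ∫ x, _root_.pderiv j f x ∂cubeMeasure d = 0 := by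
  obtain ⟨n, rfl⟩ : ∃ n, d = n + 1 := ⟨d - 1, by have := j.pos; omega⟩
  rw [(integral_cubeMeasure_succ j (hf.pderiv j).continuous).2]
  simp [hf.intervalIntegral_pderiv]

theorem integral_sq_pderiv_le (hf : SmoothPeriodic f) (j : Fin d) :
    ∫ x, _root_.pderiv j f x ^ 2 ∂cubeMeasure d ≤
      ∫ x, _root_.pderiv j (_root_.pderiv j f) x ^ 2 ∂cubeMeasure d := by
  obtain ⟨n, rfl⟩ : ∃ n, d = n + 1 := ⟨d - 1, by have := j.pos; omega⟩
  have h1 := integral_cubeMeasure_succ j ((hf.pderiv j).pow 2).continuous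
  have h2 := integral_cubeMeasure_succ j (((hf.pderiv j).pderiv j).pow 2).continuous
  rw [h1.2, h2.2]
  refine integral_mono h1.1 h2.1 fun y => ?_
  exact integral_sq_le_integral_deriv_sq ((hf.pderiv j).hasDerivAt_insertNth j y)
    (((hf.pderiv j).pderiv j).continuous_insertNth j y) ((hf.pderiv j).insertNth_pi j y)
    (hf.intervalIntegral_pderiv j y)

theorem pderiv_mul (hf : SmoothPeriodic f) (hg : SmoothPeriodic g) (i : Fin d) (x : Fin d → ℝ) :
    _root_.pderiv i (fun x => f x * g x) x =
      f x * _root_.pderiv i g x + _root_.pderiv i f x * g x := by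
  rw [_root_.pderiv, ((hf.differentiable x).hasFDerivAt.fun_mul
    (hg.differentiable x).hasFDerivAt).fderiv]
  simp [_root_.pderiv, mul_comm]

theorem pderiv_sub (hf : SmoothPeriodic f) (hg : SmoothPeriodic g) (i : Fin d) (x : Fin d → ℝ) :
    _root_.pderiv i (fun x => f x - g x) x = _root_.pderiv i f x - _root_.pderiv i g x := by
  rw [_root_.pderiv, ((hf.differentiable x).hasFDerivAt.fun_sub
    (hg.differentiable x).hasFDerivAt).fderiv]
  simp [_root_.pderiv]

/-- The mixed second derivatives satisfy `∫ uᵢᵢ uⱼⱼ = ∫ uᵢⱼ²`. -/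
theorem integral_pderiv_pderiv_mul (hf : SmoothPeriodic f) (i j : Fin d) :
    ∫ x, _root_.pderiv i (_root_.pderiv i f) x * _root_.pderiv j (_root_.pderiv j f) x
        ∂cubeMeasure d =
      ∫ x, _root_.pderiv i (_root_.pderiv j f) x ^ 2 ∂cubeMeasure d := by
  have hi := hf.pderiv i
  have hj := hf.pderiv j
  have h1 := (hi.mul (hj.pderiv j)).integral_pderiv i
  have h2 := (hi.mul (hj.pderiv i)).integral_pderiv j
  rw [← sub_eq_zero, ← integral_sub ((hi.pderiv i).mul (hj.pderiv j)).integrable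
    ((hj.pderiv i).pow 2).integrable]
  rw [← sub_zero 0]
  nth_rw 1 [← h1]
  rw [← h2, ← integral_sub ((hi.mul (hj.pderiv j)).pderiv i).integrable
    ((hi.mul (hj.pderiv i)).pderiv j).integrable]
  congr 1 with x
  rw [hi.pderiv_mul (hj.pderiv j), hi.pderiv_mul (hj.pderiv i), hj.pderiv_comm i j,
    hf.pderiv_comm j i]
  ring

/-- Poincaré inequality for the gradient: `∫ |∇u|² ≤ ∫ (Δu)²`. -/
theorem integral_gradient_sq_le (hf : SmoothPeriodic f) :
    ∫ x, ∑ j, _root_.pderiv j f x ^ 2 ∂cubeMeasure d ≤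
      ∫ x, (∑ j, _root_.pderiv j (_root_.pderiv j f) x) ^ 2 ∂cubeMeasure d := by
  have hint : ∀ i j, Integrable (fun x =>
      _root_.pderiv i (_root_.pderiv i f) x * _root_.pderiv j (_root_.pderiv j f) x)
      (cubeMeasure d) :=
    fun i j => (((hf.pderiv i).pderiv i).mul ((hf.pderiv j).pderiv j)).integrable
  simp_rw [sq (∑ j, _root_.pderiv j (_root_.pderiv j f) _), Finset.sum_mul_sum]
  rw [integral_finsetSum _ fun j _ => ((hf.pderiv j).pow 2).integrable,
    integral_finsetSum _ fun i _ => integrable_finsetSum _ fun j _ => hint i j]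
  refine Finset.sum_le_sum fun i _ => ?_
  rw [integral_finsetSum _ fun j _ => hint i j]
  simp_rw [hf.integral_pderiv_pderiv_mul]
  exact (hf.integral_sq_pderiv_le i).trans (Finset.single_le_sum
    (f := fun j => ∫ x, _root_.pderiv i (_root_.pderiv j f) x ^ 2 ∂cubeMeasure d)
    (fun j _ => integral_nonneg fun x => sq_nonneg _) (Finset.mem_univ i))

end SmoothPeriodic

/-- The algebraic inequality behind the Hardy–Rellich estimate. -/
theorem sq_sub_divergence_ge {d : ℕ} (hd : 0 < d) {ε W : ℝ} (hε : 0 < ε) (a s c q : Fin d → ℝ)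
    (h : Fin d → Fin d → ℝ) (hsymm : ∀ i j, h i j = h j i) (hq : ∀ j, 0 ≤ q j)
    (hc : ∀ j, c j = 1 - 2 * q j) (hs : ∀ j, s j ^ 2 = 4 * q j * (1 - q j))
    (hW : W = ∑ j, q j + ε) (F : Fin d → Fin d → ℝ)
    (hF : ∀ i j, F i j = (if i = j then c j / W else 0) - s j * s i / (2 * W ^ 2)) :
    (d - 4 - 4 * ε / d) * ((∑ j, a j ^ 2) / W) - (2 - 2 / d) * ∑ j, a j ^ 2 ≤
      (∑ j, h j j) ^ 2 - ∑ i, ∑ j,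
        (2 * (a i * (s j / W * h i j + F i j * a j) + h i i * (s j / W * a j)) -
          (s i / W * (2 * (a j * h i j)) + F i i * a j ^ 2)) := by
  have hV : 0 ≤ ∑ j, q j := Finset.sum_nonneg fun j _ => hq j
  have hW0 : 0 < W := by linarith
  have hd0 : (0 : ℝ) < d := by exact_mod_cast hd
  set A := ∑ j, a j ^ 2 with hA
  set L := ∑ j, h j j with hL
  set T := ∑ j, s j * a j with hT
  set R := ∑ j, q j ^ 2 with hR
  set V := ∑ j, q j with hVdef
  have hA0 : 0 ≤ A := Finset.sum_nonneg fun j _ => sq_nonneg _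
  have hVR : V ^ 2 / d ≤ R := by
    rw [div_le_iff₀ hd0]
    have := sq_sum_le_card_mul_sum_sq (s := Finset.univ) (f := q)
    simpa [mul_comm] using this
  have hqa : 0 ≤ ∑ j, q j * a j ^ 2 :=
    Finset.sum_nonneg fun j _ => mul_nonneg (hq j) (sq_nonneg _)
  have hdiv : ∑ i, F i i = (d - 2 * V) / W - (4 * V - 4 * R) / (2 * W ^ 2) := by
    have : ∀ i, F i i = W⁻¹ - 2 / W * q i - 4 / (2 * W ^ 2) * q i +
        4 / (2 * W ^ 2) * q i ^ 2 := fun i => by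
      rw [hF, if_pos rfl, hc, ← sq, hs]; ring
    simp_rw [this, Finset.sum_add_distrib, Finset.sum_sub_distrib, ← Finset.mul_sum]
    simp only [Finset.sum_const, Finset.card_univ, Fintype.card_fin, nsmul_eq_mul]
    ring
  have hquad : ∑ i, ∑ j, a i * (F i j * a j) =
      A / W - 2 / W * (∑ j, q j * a j ^ 2) - T ^ 2 / (2 * W ^ 2) := by
    have h1 : ∀ i, ∑ j, a i * (F i j * a j) =
        a i ^ 2 / W - 2 / W * (q i * a i ^ 2) - s i * a i * T / (2 * W ^ 2) := fun i => by
      simp_rw [hF, sub_mul, mul_sub, Finset.sum_sub_distrib, ite_mul, mul_ite, zero_mul, mul_zero,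
        Finset.sum_ite_eq, Finset.mem_univ, if_true, hc, hT, Finset.mul_sum, Finset.sum_div]
      congr 1
      · ring
      · exact Finset.sum_congr rfl fun j _ => by ring
    simp_rw [h1, Finset.sum_sub_distrib, ← Finset.mul_sum, ← Finset.sum_div, ← Finset.sum_mul]
    rw [sq T]
  have hswap : ∑ i, ∑ j, s i * (a j * h i j) = ∑ i, ∑ j, a i * (s j * h i j) := by
    rw [Finset.sum_comm]
    exact Finset.sum_congr rfl fun i _ => Finset.sum_congr rfl fun j _ => by
      rw [hsymm j i]; ring
  have hE : ∑ i, ∑ j,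
        (2 * (a i * (s j / W * h i j + F i j * a j) + h i i * (s j / W * a j)) -
          (s i / W * (2 * (a j * h i j)) + F i i * a j ^ 2)) =
      2 * (∑ i, ∑ j, a i * (F i j * a j)) + 2 * L * T / W - (∑ i, F i i) * A := by
    have h1 : ∀ i j, (2 * (a i * (s j / W * h i j + F i j * a j) + h i i * (s j / W * a j)) -
          (s i / W * (2 * (a j * h i j)) + F i i * a j ^ 2)) =
        2 / W * (a i * (s j * h i j)) + 2 * (a i * (F i j * a j)) +
          2 / W * (h i i * (s j * a j)) - 2 / W * (s i * (a j * h i j)) -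
          F i i * a j ^ 2 := fun i j => by ring
    simp_rw [h1, Finset.sum_sub_distrib, Finset.sum_add_distrib, ← Finset.mul_sum,
      ← Finset.sum_mul]
    rw [← hL, ← hT, ← hA]
    simp_rw [← Finset.mul_sum] at hswap ⊢
    rw [hswap]
    ring
  rw [hE, hquad, hdiv]
  have key : (d - 4 - 4 * ε / d) / W - (2 - 2 / d) ≤
      (d - 2 * V) / W - (4 * V - 4 * R) / (2 * W ^ 2) - 2 / W := by
    have e : (d - 2 * V) / W - (4 * V - 4 * R) / (2 * W ^ 2) - 2 / W -
        ((d - 4 - 4 * ε / d) / W - (2 - 2 / d)) =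
        (2 * (R - V ^ 2 / d) + 2 * ε * W + 2 * ε + 2 * ε ^ 2 / d) / W ^ 2 := by
      have : V = W - ε := by rw [hW]; ring
      rw [this]
      field_simp
      ring
    have : 0 ≤ (2 * (R - V ^ 2 / d) + 2 * ε * W + 2 * ε + 2 * ε ^ 2 / d) / W ^ 2 := by
      have := sub_nonneg.2 hVR
      positivity
    linarith
  have k2 := mul_le_mul_of_nonneg_right key hA0
  have k3 : 0 ≤ 4 / W * ∑ j, q j * a j ^ 2 := by positivity
  have k4 := sq_nonneg (L - T / W)
  calc _ = ((d - 4 - 4 * ε / d) / W - (2 - 2 / d)) * A := by ring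
    _ ≤ _ := k2
    _ ≤ ((d - 2 * V) / W - (4 * V - 4 * R) / (2 * W ^ 2) - 2 / W) * A +
        4 / W * (∑ j, q j * a j ^ 2) + (L - T / W) ^ 2 := by linarith
    _ = _ := by ring

section Weight

variable {d : ℕ} {ε : ℝ}

/-- The regularised weight `∑ⱼ sin²(xⱼ/2) + ε`. -/
noncomputable def regWeight (ε : ℝ) (x : Fin d → ℝ) : ℝ := ∑ j, sin (x j / 2) ^ 2 + ε

theorem regWeight_pos (hε : 0 < ε) (x : Fin d → ℝ) : 0 < regWeight ε x :=
  add_pos_of_nonneg_of_pos (Finset.sum_nonneg fun _ _ => sq_nonneg _) hε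

theorem smoothPeriodic_sin (j : Fin d) : SmoothPeriodic fun x : Fin d → ℝ => sin (x j) := by
  refine ⟨by fun_prop, fun x k => ?_⟩
  rcases eq_or_ne j k with rfl | h
  · simp
  · simp [h]

theorem smoothPeriodic_regWeight (ε : ℝ) : SmoothPeriodic (regWeight (d := d) ε) := by
  refine ⟨by unfold regWeight; fun_prop, fun x k => ?_⟩
  unfold regWeight
  congr 1
  refine Finset.sum_congr rfl fun j _ => ?_
  rw [sin_sq_eq_half_sub, sin_sq_eq_half_sub]
  rcases eq_or_ne j k with rfl | h
  · rw [mul_div_cancel₀ _ two_ne_zero, mul_div_cancel₀ _ two_ne_zero]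
    simp
  · simp [h]

theorem pderiv_sin_div_regWeight (hε : 0 < ε) (i j : Fin d) (x : Fin d → ℝ) :
    pderiv i (fun x => sin (x j) / regWeight ε x) x =
      (if i = j then cos (x j) / regWeight ε x else 0) -
        sin (x j) * sin (x i) / (2 * regWeight ε x ^ 2) := by
  have hW0 := (regWeight_pos hε x).ne'
  have hcoord : ∀ k : Fin d, HasFDerivAt (fun y : Fin d → ℝ => y k)
      (ContinuousLinearMap.proj (R := ℝ) k) x := fun k => hasFDerivAt_apply k x
  have hsin := (hcoord j).sin
  have hW : HasFDerivAt (regWeight ε) (∑ k, (sin (x k) / 2) •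
      (ContinuousLinearMap.proj k : (Fin d → ℝ) →L[ℝ] ℝ)) x := by
    unfold regWeight
    refine HasFDerivAt.add_const ε (HasFDerivAt.fun_sum fun k _ => ?_)
    have hk : HasDerivAt (fun t : ℝ => sin (t / 2) ^ 2) (sin (x k) / 2) (x k) := by
      refine (((hasDerivAt_id' (x k)).div_const 2).sin.fun_pow 2).congr_deriv ?_
      have : sin (x k) = 2 * sin (x k / 2) * cos (x k / 2) := by
        rw [← sin_two_mul]; ring_nf
      rw [this]
      ring
    exact hk.comp_hasFDerivAt x (hcoord k)
  have hinv := (hasDerivAt_inv hW0).comp_hasFDerivAt x hW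
  rw [Function.comp_def] at hinv
  simp_rw [div_eq_mul_inv (sin _)]
  rw [pderiv, (hsin.fun_mul hinv).fderiv]
  simp only [smul_apply, add_apply,
    sum_apply, ContinuousLinearMap.proj_apply, Pi.single_apply, smul_eq_mul]
  by_cases h : i = j
  · subst h
    simp
    field_simp
    ring
  · simp [h, Ne.symm h]
    field_simp

/-- Hardy–Rellich inequality with regularised weight for real functions. -/
theorem hardy_rellich_regWeight {u : (Fin d → ℝ) → ℝ} (hu : SmoothPeriodic u) (hd : 0 < d)
    (hε : 0 < ε) :
    (d - 4 - 4 * ε / d) * ∫ x, (∑ j, pderiv j u x ^ 2) / regWeight ε x ∂cubeMeasure d ≤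
      (3 - 2 / d) * ∫ x, (∑ j, pderiv j (pderiv j u) x) ^ 2 ∂cubeMeasure d := by
  have hD := hu.pderiv
  have hF : ∀ j : Fin d, SmoothPeriodic fun x => sin (x j) / regWeight ε x := fun j =>
    (smoothPeriodic_sin j).div (smoothPeriodic_regWeight ε) fun x => (regWeight_pos hε x).ne'
  have hP : ∀ i j, SmoothPeriodic fun x =>
      pderiv i u x * (sin (x j) / regWeight ε x * pderiv j u x) :=
    fun i j => (hD i).mul ((hF j).mul (hD j))
  have hN : ∀ i j, SmoothPeriodic fun x =>
      sin (x i) / regWeight ε x * (pderiv j u x * pderiv j u x) :=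
    fun i j => (hF i).mul ((hD j).mul (hD j))
  set E : Fin d → Fin d → (Fin d → ℝ) → ℝ := fun i j x =>
    2 * pderiv i (fun x => pderiv i u x * (sin (x j) / regWeight ε x * pderiv j u x)) x -
      pderiv i (fun x => sin (x i) / regWeight ε x * (pderiv j u x * pderiv j u x)) x with hEdef
  have hE : ∀ i j, SmoothPeriodic (E i j) := fun i j =>
    ((SmoothPeriodic.const 2).mul ((hP i j).pderiv i)).sub ((hN i j).pderiv i)
  have hE0 : ∫ x, ∑ i, ∑ j, E i j x ∂cubeMeasure d = 0 := by
    rw [integral_finsetSum _ fun i _ => integrable_finsetSum _ fun j _ => (hE i j).integrable]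
    refine Finset.sum_eq_zero fun i _ => ?_
    rw [integral_finsetSum _ fun j _ => (hE i j).integrable]
    refine Finset.sum_eq_zero fun j _ => ?_
    rw [hEdef, integral_sub (((hP i j).pderiv i).integrable.const_mul 2)
      ((hN i j).pderiv i).integrable, integral_const_mul, (hP i j).integral_pderiv,
      (hN i j).integral_pderiv]
    simp
  have hpt : ∀ x, (d - 4 - 4 * ε / d) * ((∑ j, pderiv j u x ^ 2) / regWeight ε x) -
      (2 - 2 / d) * ∑ j, pderiv j u x ^ 2 ≤
      (∑ j, pderiv j (pderiv j u) x) ^ 2 - ∑ i, ∑ j, E i j x := by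
    intro x
    refine (sq_sub_divergence_ge hd hε (fun j => pderiv j u x) (fun j => sin (x j))
      (fun j => cos (x j)) (fun j => sin (x j / 2) ^ 2) (fun i j => pderiv i (pderiv j u) x)
      (fun i j => hu.pderiv_comm i j x) (fun j => sq_nonneg _) (fun j => ?_) (fun j => ?_)
      (rfl : regWeight ε x = _) _
      (fun i j => pderiv_sin_div_regWeight hε i j x)).trans_eq ?_
    · rw [sin_sq_eq_half_sub, mul_div_cancel₀ _ two_ne_zero]
      ring
    · have : sin (x j) = 2 * sin (x j / 2) * cos (x j / 2) := by
        rw [← sin_two_mul]; ring_nf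
      rw [this, mul_pow, cos_sq']
      ring
    · congr 1
      refine Finset.sum_congr rfl fun i _ => Finset.sum_congr rfl fun j _ => ?_
      simp only [hEdef]
      rw [(hD i).pderiv_mul ((hF j).mul (hD j)), (hF j).pderiv_mul (hD j),
        (hF i).pderiv_mul ((hD j).mul (hD j)), (hD j).pderiv_mul (hD j)]
      ring
  have hA : SmoothPeriodic fun x => ∑ j, pderiv j u x ^ 2 :=
    SmoothPeriodic.sum fun j _ => (hD j).pow 2
  have hAW := hA.div (smoothPeriodic_regWeight ε) fun x => (regWeight_pos hε x).ne'
  have hL : SmoothPeriodic fun x => (∑ j, pderiv j (pderiv j u) x) ^ 2 :=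
    (SmoothPeriodic.sum fun j _ => (hD j).pderiv j).pow 2
  have hES : SmoothPeriodic fun x => ∑ i, ∑ j, E i j x :=
    SmoothPeriodic.sum fun i _ => SmoothPeriodic.sum fun j _ => hE i j
  have h1 := integral_mono ((hAW.integrable.const_mul _).sub (hA.integrable.const_mul _))
    (hL.integrable.sub hES.integrable) hpt
  rw [integral_sub' (hAW.integrable.const_mul _) (hA.integrable.const_mul _),
    integral_sub' hL.integrable hES.integrable, hE0, integral_const_mul, integral_const_mul] at h1
  have h2 := hu.integral_gradient_sq_le
  have h3 : (0 : ℝ) ≤ 2 - 2 / d := by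
    have : (1 : ℝ) ≤ d := by exact_mod_cast hd
    rw [sub_nonneg, div_le_iff₀ (by linarith)]
    linarith
  nlinarith [mul_le_mul_of_nonneg_left h2 h3]

end Weight

section ComplexParts

variable {d : ℕ} {f : (Fin d → ℝ) → ℂ}

theorem pderiv_re (hf : Differentiable ℝ f) (j : Fin d) :
    pderiv j (fun x => (f x).re) = fun x => (fderiv ℝ f x (Pi.single j 1)).re := by
  ext x
  have h := Complex.reCLM.hasFDerivAt.comp x (hf x).hasFDerivAt
  rw [pderiv]
  exact congrArg (fun L => L (Pi.single j 1)) h.fderiv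

theorem pderiv_im (hf : Differentiable ℝ f) (j : Fin d) :
    pderiv j (fun x => (f x).im) = fun x => (fderiv ℝ f x (Pi.single j 1)).im := by
  ext x
  have h := Complex.imCLM.hasFDerivAt.comp x (hf x).hasFDerivAt
  rw [pderiv]
  exact congrArg (fun L => L (Pi.single j 1)) h.fderiv

end ComplexParts

/-- The singular weight `1 / ∑ⱼ sin²(xⱼ/2)` is controlled by the regularised weights. -/
theorem lintegral_div_le_of_regWeight {d : ℕ} {N : (Fin d → ℝ) → ℝ} (hN : Continuous N)
    (hN0 : ∀ x, 0 ≤ N x) {ε b : ℕ → ℝ} (hε : ∀ n, 0 < ε n)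
    (hε0 : Filter.Tendsto ε Filter.atTop (nhds 0)) {B : ℝ}
    (hb : Filter.Tendsto b Filter.atTop (nhds B))
    (h : ∀ n, ∫ x, N x / regWeight (ε n) x ∂cubeMeasure d ≤ b n) :
    ∫⁻ x, ENNReal.ofReal (N x / ∑ j, sin (x j / 2) ^ 2) ∂cubeMeasure d ≤ ENNReal.ofReal B := by
  have hcont : ∀ n, Continuous fun x => N x / regWeight (ε n) x := fun n =>
    hN.div (smoothPeriodic_regWeight _).continuous fun x => (regWeight_pos (hε n) x).ne'
  have hlim : ∀ x, ENNReal.ofReal (N x / ∑ j, sin (x j / 2) ^ 2) ≤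
      Filter.liminf (fun n => ENNReal.ofReal (N x / regWeight (ε n) x)) Filter.atTop := by
    intro x
    rcases eq_or_ne (∑ j, sin (x j / 2) ^ 2) 0 with h0 | h0
    · simp [h0]
    · refine (Filter.Tendsto.liminf_eq ?_).ge
      refine (ENNReal.continuous_ofReal.tendsto _).comp (tendsto_const_nhds.div ?_ h0)
      simpa [regWeight] using hε0.const_add (∑ j, sin (x j / 2) ^ 2)
  calc _ ≤ ∫⁻ x, Filter.liminf (fun n => ENNReal.ofReal (N x / regWeight (ε n) x)) Filter.atTop
        ∂cubeMeasure d := lintegral_mono hlim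
    _ ≤ Filter.liminf (fun n => ∫⁻ x, ENNReal.ofReal (N x / regWeight (ε n) x) ∂cubeMeasure d)
        Filter.atTop := lintegral_liminf_le fun n => (hcont n).measurable.ennreal_ofReal
    _ ≤ Filter.liminf (fun n => ENNReal.ofReal (b n)) Filter.atTop := by
      refine Filter.liminf_le_liminf (.of_forall fun n => ?_)
      rw [← ofReal_integral_eq_lintegral_ofReal (hcont n).integrable_cubeMeasure
        (.of_forall fun x => div_nonneg (hN0 x) (regWeight_pos (hε n) x).le)]
      exact ENNReal.ofReal_le_ofReal (h n)
    _ = _ := ((ENNReal.continuous_ofReal.tendsto _).comp hb).liminf_eq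

/-- Hardy–Rellich inequality on the torus `Q_d = (−π,π)^d` for smooth periodic
functions with zero average, `d ≥ 8`:
`(d²/(3d+20)) ∫ |∇ψ|²/Σ_j sin²(x_j/2) ≤ ∫ |Δψ|²`. -/
theorem torus_hardy_rellich_inequality (d : ℕ) (hd : 8 ≤ d) (ψ : (Fin d → ℝ) → ℂ)
    (hsmooth : ContDiff ℝ (⊤ : ℕ∞) ψ)
    (hper : ∀ (x : Fin d → ℝ) (j : Fin d), ψ (x + Pi.single j (2 * π)) = ψ x)
    (havg : (∫ x in Set.pi Set.univ fun _ : Fin d => Set.Ioo (-π) π, ψ x) = 0) :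
    ENNReal.ofReal ((d : ℝ) ^ 2 / (3 * (d : ℝ) + 20)) *
        ∫⁻ x in Set.pi Set.univ fun _ : Fin d => Set.Ioo (-π) π,
          ENNReal.ofReal ((∑ j : Fin d, ‖fderiv ℝ ψ x (Pi.single j 1)‖ ^ 2) /
            ∑ j : Fin d, Real.sin (x j / 2) ^ 2) ≤
      ∫⁻ x in Set.pi Set.univ fun _ : Fin d => Set.Ioo (-π) π,
        ENNReal.ofReal
          (‖∑ j : Fin d,
              fderiv ℝ (fun y => fderiv ℝ ψ y (Pi.single j 1)) x (Pi.single j 1)‖ ^ 2) := by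
  have hd8 : (8 : ℝ) ≤ d := by exact_mod_cast hd
  have hdiff : Differentiable ℝ ψ := hsmooth.differentiable (by simp)
  have hdiff' : ∀ j : Fin d, Differentiable ℝ fun y => fderiv ℝ ψ y (Pi.single j 1) := fun j =>
    ((hsmooth.fderiv_right (m := (⊤ : ℕ∞)) (by simp)).clm_apply contDiff_const).differentiable
      (by simp)
  have hu : SmoothPeriodic fun x => (ψ x).re :=
    ⟨Complex.reCLM.contDiff.comp hsmooth, fun x j => by rw [hper]⟩
  have hv : SmoothPeriodic fun x => (ψ x).im :=
    ⟨Complex.imCLM.contDiff.comp hsmooth, fun x j => by rw [hper]⟩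
  set u := fun x => (ψ x).re
  set v := fun x => (ψ x).im
  have hgrad : ∀ x, ∑ j, ‖fderiv ℝ ψ x (Pi.single j 1)‖ ^ 2 =
      ∑ j, pderiv j u x ^ 2 + ∑ j, pderiv j v x ^ 2 := fun x => by
    simp_rw [u, v, pderiv_re hdiff, pderiv_im hdiff, ← Finset.sum_add_distrib, Complex.sq_norm,
      Complex.normSq_apply, sq]
  have hlap : ∀ x, ‖∑ j, fderiv ℝ (fun y => fderiv ℝ ψ y (Pi.single j 1)) x (Pi.single j 1)‖ ^ 2 =
      (∑ j, pderiv j (pderiv j u) x) ^ 2 + (∑ j, pderiv j (pderiv j v) x) ^ 2 := fun x => by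
    simp_rw [u, v, pderiv_re hdiff, pderiv_im hdiff, pderiv_re (hdiff' _), pderiv_im (hdiff' _),
      Complex.sq_norm, Complex.normSq_apply, Complex.re_sum, Complex.im_sum, sq]
  have hgradc : ∀ {w}, SmoothPeriodic w → SmoothPeriodic fun x : Fin d → ℝ =>
      ∑ j, pderiv j w x ^ 2 := fun hw => SmoothPeriodic.sum fun j _ => (hw.pderiv j).pow 2
  have hlapc : ∀ {w}, SmoothPeriodic w → SmoothPeriodic fun x : Fin d → ℝ =>
      (∑ j, pderiv j (pderiv j w) x) ^ 2 := fun hw =>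
    (SmoothPeriodic.sum fun j _ => (hw.pderiv j).pderiv j).pow 2
  rw [volume_restrict_cube]
  simp_rw [hgrad, hlap]
  rw [← ofReal_integral_eq_lintegral_ofReal ((hlapc hu).add (hlapc hv)).integrable
    (.of_forall fun x => by positivity)]
  set K := ∫ x, (∑ j, pderiv j (pderiv j u) x) ^ 2 + (∑ j, pderiv j (pderiv j v) x) ^ 2
    ∂cubeMeasure d with hK
  have hK0 : 0 ≤ K := integral_nonneg fun x => by positivity
  have hreg : ∀ ε : ℝ, 0 < ε → (d - 4 - 4 * ε / d) *
      ∫ x, (∑ j, pderiv j u x ^ 2 + ∑ j, pderiv j v x ^ 2) / regWeight ε x ∂cubeMeasure d ≤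
        (3 - 2 / d) * K := fun ε hε => by
    have hint : ∀ {w}, SmoothPeriodic w → Integrable (fun x : Fin d → ℝ =>
        (∑ j, pderiv j w x ^ 2) / regWeight ε x) (cubeMeasure d) := fun hw =>
      ((hgradc hw).div (smoothPeriodic_regWeight ε) fun x => (regWeight_pos hε x).ne').integrable
    simp_rw [add_div]
    rw [hK, integral_add (hint hu) (hint hv),
      integral_add (hlapc hu).integrable (hlapc hv).integrable, mul_add, mul_add]
    exact add_le_add (hardy_rellich_regWeight hu (by omega) hε)
      (hardy_rellich_regWeight hv (by omega) hε)
  have hε0 := tendsto_one_div_add_atTop_nhds_zero_nat (𝕜 := ℝ)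
  have hlim : Filter.Tendsto (fun n : ℕ => (3 - 2 / d) * K / (d - 4 - 4 * (1 / (n + 1 : ℝ)) / d))
      Filter.atTop (nhds ((3 - 2 / d) * K / (d - 4))) := by
    refine tendsto_const_nhds.div ?_ (by linarith)
    simpa using tendsto_const_nhds.sub ((hε0.const_mul 4).div_const (d : ℝ))
  have hmain := lintegral_div_le_of_regWeight ((hgradc hu).add (hgradc hv)).continuous
    (fun x => by positivity) (fun n => by positivity) hε0 hlim fun n => by
      have hle : 1 / (n + 1 : ℝ) ≤ 1 := (div_le_one (by positivity)).2 (by simp)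
      have : 4 * (1 / (n + 1 : ℝ)) / d ≤ 1 := by
        rw [div_le_one (by linarith)]
        linarith
      rw [le_div_iff₀ (by linarith), mul_comm]
      exact hreg _ (by positivity)
  refine (mul_le_mul_right hmain _).trans ?_
  rw [← ENNReal.ofReal_mul (by positivity)]
  refine ENNReal.ofReal_le_ofReal ?_
  have hconst : (d : ℝ) ^ 2 / (3 * d + 20) * ((3 - 2 / d) / (d - 4)) ≤ 1 := by
    have : (d : ℝ) ^ 2 / (3 * d + 20) * ((3 - 2 / d) / (d - 4)) =
        (d * (3 * d - 2)) / ((3 * d + 20) * (d - 4)) := by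
      have : (d : ℝ) - 4 ≠ 0 := by linarith
      field_simp
    rw [this, div_le_one (mul_pos (by linarith) (by linarith))]
    nlinarith
  calc _ = (d : ℝ) ^ 2 / (3 * d + 20) * ((3 - 2 / d) / (d - 4)) * K := by ring
    _ ≤ 1 * K := mul_le_mul_of_nonneg_right hconst hK0
    _ = K := one_mul K
end

section
/- Let w : ℕ → ℝ be nonnegative and nondecreasing, let p ≥ 1 be real, and let u : ℕ → ℂ vanish at infinity. Let ũ : ℕ → ℝ be the decreasing rearrangement of u, i.e. ũ is nonnegative, nonincreasing, and for every t > 0 the sets {n : ũ(n) > t} and {n : |u(n)| > t} are finite with equal cardinality. Then Σ_{n=0}^∞ |u(n) − u(n+1)|^p w(n) ≥ Σ_{n=0}^∞ |ũ(n) − ũ(n+1)|^p w(n) (as an inequality in [0, ∞]). Moreover, if w(n) > 0 for all n and both sides are finite and equal, then |u(n)| = ũ(n) for all n; in particular |u| is nonincreasing. -/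
open Filter Topology Finset

section Rearrangement

variable {f v : ℕ → ℝ}

/-- A set of at least `n + 1` natural numbers has an element which is at least `n`. -/
theorem Set.exists_mem_ge_of_lt_ncard {s : Set ℕ} {n : ℕ} (h : n < s.ncard) :
    ∃ k ∈ s, n ≤ k := by
  by_contra! hs
  have h₁ : s.ncard ≤ (Set.Iio n).ncard :=
    Set.ncard_le_ncard (fun k hk => hs k hk) (Set.finite_Iio n)
  rw [Set.ncard_eq_toFinset_card' (Set.Iio n)] at h₁
  simp only [Set.toFinset_Iio, Nat.card_Iio] at h₁
  omega

/-- If `v` is antitone, then a superlevel set `{v > t}` with `v n ≤ t` has at most `n`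
elements. -/
theorem Antitone.ncard_setOf_lt_le (hv : Antitone v) {n : ℕ} {t : ℝ} (h : v n ≤ t) :
    {k | t < v k}.ncard ≤ n := by
  by_contra! hlt
  obtain ⟨k, hk, hnk⟩ := Set.exists_mem_ge_of_lt_ncard hlt
  exact absurd (hk.trans_le (hv hnk)) h.not_gt

/-- If `v` is antitone, then a finite superlevel set `{v > t}` with `t < v n` has more than `n`
elements. -/
theorem Antitone.lt_ncard_setOf_lt (hv : Antitone v) {n : ℕ} {t : ℝ}
    (hfin : {k | t < v k}.Finite) (h : t < v n) : n < {k | t < v k}.ncard := by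
  have h₁ : (Set.Iic n).ncard ≤ {k | t < v k}.ncard :=
    Set.ncard_le_ncard (fun k hk => h.trans_le (hv hk)) hfin
  rw [Set.ncard_eq_toFinset_card' (Set.Iic n)] at h₁
  simp only [Set.toFinset_Iic, Nat.card_Iic] at h₁
  omega

/-- Two equimeasurable antitone functions satisfy `f ≤ v`. -/
theorem Antitone.le_of_ncard_eq (hf : Antitone f) (hv : Antitone v) (hv0 : ∀ n, 0 ≤ v n)
    (hfin : ∀ t, 0 < t → {n | t < f n}.Finite)
    (hcard : ∀ t, 0 < t → {n | t < v n}.ncard = {n | t < f n}.ncard) (n : ℕ) : f n ≤ v n := by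
  by_contra! h
  obtain ⟨t, h₁, h₂⟩ := exists_between h
  have ht : 0 < t := (hv0 n).trans_lt h₁
  have := hf.lt_ncard_setOf_lt (hfin t ht) h₂
  have := hv.ncard_setOf_lt_le h₁.le
  have := hcard t ht
  omega

/-- If `v` is the decreasing rearrangement of `f`, then `f ≥ v n` holds at more than `n` points. -/
theorem Antitone.lt_ncard_setOf_le_of_ncard_eq (hv : Antitone v)
    (hfin : ∀ t, 0 < t → {n | t < f n}.Finite)
    (hcard : ∀ t, 0 < t → {n | t < v n}.Finite ∧ {n | t < v n}.ncard = {n | t < f n}.ncard)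
    {n : ℕ} (hn : 0 < v n) : n < {k | v n ≤ f k}.ncard := by
  have hS := hfin (v n / 2) (half_pos hn)
  have hev : ∀ᶠ t in 𝓝[<] v n, ∀ k ∈ {k | v n / 2 < f k}, f k < v n → f k < t := by
    rw [eventually_all_finite hS]
    intro k _
    by_cases hk : f k < v n
    · filter_upwards [Ioo_mem_nhdsLT hk] with t ht _ using ht.1
    · simp [hk]
  obtain ⟨t, ht, ht₁, ht₂⟩ := (hev.and (Ioo_mem_nhdsLT (half_lt_self hn))).exists
  have ht0 : 0 < t := (half_pos hn).trans ht₁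
  have h₁ := hv.lt_ncard_setOf_lt (hcard t ht0).1 ht₂
  rw [(hcard t ht0).2] at h₁
  refine h₁.trans_le (Set.ncard_le_ncard ?_ ((hfin _ (half_pos hn)).subset ?_))
  · intro k hk
    by_contra! hlt
    exact lt_asymm hk (ht k (ht₁.trans hk) (not_le.1 hlt))
  · intro k hk
    exact (half_lt_self hn).trans_le hk

/-- Every drop of the decreasing rearrangement `v` of `f` at `n` is covered by a drop of `f` at some
point to the right of `n`. -/
theorem Antitone.exists_ge_drop_of_ncard_eq (hv : Antitone v) (hv0 : ∀ n, 0 ≤ v n)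
    (hfin : ∀ t, 0 < t → {n | t < f n}.Finite)
    (hcard : ∀ t, 0 < t → {n | t < v n}.Finite ∧ {n | t < v n}.ncard = {n | t < f n}.ncard)
    {n : ℕ} (hn : v (n + 1) < v n) :
    ∃ m, n ≤ m ∧ v n ≤ f m ∧ f (m + 1) ≤ v (n + 1) := by
  have hpos : 0 < v n := (hv0 _).trans_lt hn
  have hlt := hv.lt_ncard_setOf_le_of_ncard_eq hfin hcard hpos
  have hS : {k | v n ≤ f k}.Finite :=
    (hfin _ (half_pos hpos)).subset fun k hk => (half_lt_self hpos).trans_le hk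
  obtain ⟨k, hk, hnk⟩ := Set.exists_mem_ge_of_lt_ncard hlt
  obtain ⟨m, hm, hmax⟩ := Set.exists_max_image _ id hS ⟨k, hk⟩
  refine ⟨m, hnk.trans (hmax k hk), hm, ?_⟩
  by_contra! hgt
  obtain ⟨t, ht₁, ht₂⟩ := exists_between (lt_min hgt hn)
  have ht0 : 0 < t := (hv0 _).trans_lt ht₁
  have hnot : m + 1 ∉ {k | v n ≤ f k} := fun h => by
    have := hmax _ h
    simp at this
  have h₁ : (insert (m + 1) {k | v n ≤ f k}).ncard ≤ {k | t < f k}.ncard := by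
    refine Set.ncard_le_ncard (Set.insert_subset ?_ ?_) (hfin t ht0)
    · exact ht₂.trans_le (min_le_left _ _)
    · exact fun k hk => (ht₂.trans_le (min_le_right _ _)).trans_le hk
  rw [Set.ncard_insert_of_notMem hnot hS, ← (hcard t ht0).2] at h₁
  have := hv.ncard_setOf_lt_le ht₁.le
  omega

end Rearrangement

/-- The drops of an antitone sequence that lie in `[y, x]` have total size at most `x - y`. -/
theorem Antitone.sum_sub_le {v : ℕ → ℝ} (hv : Antitone v) {S : Finset ℕ} (hS : S.Nonempty)
    {x y : ℝ} (hx : ∀ n ∈ S, v n ≤ x) (hy : ∀ n ∈ S, y ≤ v (n + 1)) :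
    ∑ n ∈ S, (v n - v (n + 1)) ≤ x - y := by
  have hle : S.min' hS ≤ S.max' hS + 1 := (S.min'_le_max' hS).trans (Nat.le_succ _)
  calc ∑ n ∈ S, (v n - v (n + 1))
      ≤ ∑ n ∈ Ico (S.min' hS) (S.max' hS + 1), (v n - v (n + 1)) := by
        refine sum_le_sum_of_subset_of_nonneg (fun n hn => ?_) fun n _ _ =>
          sub_nonneg.2 (hv n.le_succ)
        exact mem_Ico.2 ⟨S.min'_le n hn, Nat.lt_succ_of_le (S.le_max' n hn)⟩
    _ = v (S.min' hS) - v (S.max' hS + 1) := by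
        have := Finset.sum_Ico_sub v hle
        rw [← neg_sub, ← this, ← sum_neg_distrib]
        simp
    _ ≤ x - y := sub_le_sub (hx _ (S.min'_mem hS)) (hy _ (S.max'_mem hS))

/-- For `p ≥ 1` the function `x ↦ x ^ p` is superadditive over finite sums of nonnegative reals. -/
theorem Real.sum_rpow_le_rpow_sum {ι : Type*} (S : Finset ι) {a : ι → ℝ} (ha : ∀ i ∈ S, 0 ≤ a i)
    {p : ℝ} (hp : 1 ≤ p) : ∑ i ∈ S, a i ^ p ≤ (∑ i ∈ S, a i) ^ p := by
  classical
  induction S using Finset.induction_on with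
  | empty => simp [Real.zero_rpow (by linarith : p ≠ 0)]
  | insert i S hi ih =>
    rw [sum_insert hi, sum_insert hi]
    have hS : ∀ j ∈ S, 0 ≤ a j := fun j hj => ha j (mem_insert_of_mem hj)
    exact (add_le_add_right (ih hS) _).trans
      (Real.add_rpow_le_rpow_add (ha i (mem_insert_self i S)) (sum_nonneg hS) hp)

/-- If all drops of the antitone sequence `v` at points of `S` are covered by the drop of `f` at
`m`, and the points of `S` are at most `m`, then the weighted energy of these drops is at most the
energy of `f` at `m`. -/
theorem Antitone.sum_rpow_mul_le {v f w : ℕ → ℝ} (hv : Antitone v) (hw0 : ∀ n, 0 ≤ w n)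
    (hw : Monotone w) {p : ℝ} (hp : 1 ≤ p) {S : Finset ℕ} {m : ℕ}
    (hS : ∀ n ∈ S, n ≤ m ∧ v n ≤ f m ∧ f (m + 1) ≤ v (n + 1)) :
    ∑ n ∈ S, |v n - v (n + 1)| ^ p * w n ≤ |f m - f (m + 1)| ^ p * w m := by
  rcases S.eq_empty_or_nonempty with rfl | hne
  · simpa using mul_nonneg (Real.rpow_nonneg (abs_nonneg _) p) (hw0 m)
  have hd : ∀ n, 0 ≤ v n - v (n + 1) := fun n => sub_nonneg.2 (hv n.le_succ)
  have hsum := hv.sum_sub_le hne (fun n hn => (hS n hn).2.1) fun n hn => (hS n hn).2.2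
  calc ∑ n ∈ S, |v n - v (n + 1)| ^ p * w n
      ≤ ∑ n ∈ S, (v n - v (n + 1)) ^ p * w m := by
        refine sum_le_sum fun n hn => ?_
        rw [abs_of_nonneg (hd n)]
        exact mul_le_mul_of_nonneg_left (hw (hS n hn).1) (Real.rpow_nonneg (hd n) p)
    _ = (∑ n ∈ S, (v n - v (n + 1)) ^ p) * w m := (sum_mul ..).symm
    _ ≤ |f m - f (m + 1)| ^ p * w m := by
        refine mul_le_mul_of_nonneg_right ?_ (hw0 m)
        refine (Real.sum_rpow_le_rpow_sum S (fun n _ => hd n) hp).trans ?_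
        exact Real.rpow_le_rpow (sum_nonneg fun n _ => hd n) (hsum.trans (le_abs_self _))
          (by linarith)

/-- The weighted energy of the decreasing rearrangement `v` of `f` can be redistributed so that each
piece is dominated by the energy of `f`, and no energy is put at the ascents of `f`. -/
theorem Antitone.exists_tsum_eq_of_ncard_eq {v f w : ℕ → ℝ} (hv : Antitone v)
    (hv0 : ∀ n, 0 ≤ v n) (hw0 : ∀ n, 0 ≤ w n) (hw : Monotone w) {p : ℝ} (hp : 1 ≤ p)
    (hfin : ∀ t, 0 < t → {n | t < f n}.Finite)
    (hcard : ∀ t, 0 < t → {n | t < v n}.Finite ∧ {n | t < v n}.ncard = {n | t < f n}.ncard) :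
    ∃ G : ℕ → ENNReal,
      ∑' n, ENNReal.ofReal (|v n - v (n + 1)| ^ p * w n) = ∑' m, G m ∧
      (∀ m, G m ≤ ENNReal.ofReal (|f m - f (m + 1)| ^ p * w m)) ∧
      ∀ m, f m < f (m + 1) → G m = 0 := by
  have hex : ∀ n, ∃ m, v (n + 1) < v n → n ≤ m ∧ v n ≤ f m ∧ f (m + 1) ≤ v (n + 1) := by
    intro n
    by_cases hn : v (n + 1) < v n
    · obtain ⟨m, hm⟩ := hv.exists_ge_drop_of_ncard_eq hv0 hfin hcard hn
      exact ⟨m, fun _ => hm⟩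
    · exact ⟨0, fun h => absurd h hn⟩
  choose M hM using hex
  set F : ℕ → ENNReal := fun n => ENNReal.ofReal (|v n - v (n + 1)| ^ p * w n) with hF
  have hF0 : ∀ n, ¬ v (n + 1) < v n → F n = 0 := by
    intro n hn
    have : v n - v (n + 1) = 0 := sub_eq_zero.2 ((not_lt.1 hn).antisymm (hv n.le_succ))
    simp [hF, this, Real.zero_rpow (by linarith : p ≠ 0)]
  let S : ℕ → Finset ℕ := fun m => {n ∈ range (m + 1) | v (n + 1) < v n ∧ M n = m}
  have hS : ∀ m, ∀ n ∈ S m, n ≤ m ∧ v n ≤ f m ∧ f (m + 1) ≤ v (n + 1) := by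
    intro m n hn
    obtain ⟨-, hlt, rfl⟩ := mem_filter.1 hn
    exact hM n hlt
  have hG : ∀ m, ∑' n, (if m = M n then F n else 0) = ∑ n ∈ S m, F n := by
    intro m
    rw [tsum_eq_sum (s := S m)]
    · refine sum_congr rfl fun n hn => if_pos (mem_filter.1 hn).2.2.symm
    · intro n hn
      split_ifs with h
      · refine hF0 n fun hlt => hn ?_
        subst h
        exact mem_filter.2 ⟨mem_range.2 (Nat.lt_succ_of_le (hM n hlt).1), hlt, rfl⟩
      · rfl
  refine ⟨fun m => ∑ n ∈ S m, F n, ?_, fun m => ?_, fun m hm => ?_⟩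
  · simp only [← hG]
    rw [ENNReal.tsum_comm]
    exact tsum_congr fun n => (tsum_ite_eq (M n) fun _ => F n).symm
  · simp only [hF]
    rw [← ENNReal.ofReal_sum_of_nonneg fun n _ =>
      mul_nonneg (Real.rpow_nonneg (abs_nonneg _) p) (hw0 n)]
    exact ENNReal.ofReal_le_ofReal (hv.sum_rpow_mul_le hw0 hw hp (hS m))
  · refine sum_eq_zero fun n hn => absurd hm (not_lt.2 ?_)
    obtain ⟨-, h₁, h₂⟩ := hS m n hn
    exact h₂.trans ((hv n.le_succ).trans h₁)


/-- Weighted Polya–Szegő inequality for the decreasing rearrangement on `ℕ`,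
together with the characterization of the equality case. -/
theorem weighted_polya_szego_decreasing_rearrangement
    (w : ℕ → ℝ) (hw0 : ∀ n, 0 ≤ w n) (hwmono : Monotone w)
    (p : ℝ) (hp : 1 ≤ p) (u : ℕ → ℂ)
    (hu : ∀ t : ℝ, 0 < t → {n : ℕ | t < ‖u n‖}.Finite)
    (v : ℕ → ℝ) (hv0 : ∀ n, 0 ≤ v n) (hvmono : Antitone v)
    (hcard : ∀ t : ℝ, 0 < t → {n : ℕ | t < v n}.Finite ∧
      {n : ℕ | t < v n}.ncard = {n : ℕ | t < ‖u n‖}.ncard) :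
    (∑' n : ℕ, ENNReal.ofReal (|v n - v (n + 1)| ^ p * w n) ≤
        ∑' n : ℕ, ENNReal.ofReal (‖u n - u (n + 1)‖ ^ p * w n)) ∧
      ((∀ n, 0 < w n) →
        (∑' n : ℕ, ENNReal.ofReal (‖u n - u (n + 1)‖ ^ p * w n)) ≠ ⊤ →
        (∑' n : ℕ, ENNReal.ofReal (|v n - v (n + 1)| ^ p * w n)) =
          (∑' n : ℕ, ENNReal.ofReal (‖u n - u (n + 1)‖ ^ p * w n)) →
        ∀ n, ‖u n‖ = v n) := by
  obtain ⟨G, hGsum, hGle, hG0⟩ :=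
    hvmono.exists_tsum_eq_of_ncard_eq (f := fun n => ‖u n‖) hv0 hw0 hwmono hp hu hcard
  have hfu : ∀ n, ENNReal.ofReal (|‖u n‖ - ‖u (n + 1)‖| ^ p * w n) ≤
      ENNReal.ofReal (‖u n - u (n + 1)‖ ^ p * w n) := fun n =>
    ENNReal.ofReal_le_ofReal <| mul_le_mul_of_nonneg_right
      (Real.rpow_le_rpow (abs_nonneg _) (abs_norm_sub_norm_le _ _) (by linarith)) (hw0 n)
  have hGu := fun n => (hGle n).trans (hfu n)
  rw [hGsum]
  refine ⟨ENNReal.tsum_le_tsum hGu, fun hwpos hfinite heq => ?_⟩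
  have hanti : Antitone fun n => ‖u n‖ := by
    refine antitone_nat_of_succ_le fun m => ?_
    by_contra! hm
    refine (ENNReal.tsum_lt_tsum (i := m) (heq ▸ hfinite) hGu ?_).ne heq
    rw [hG0 m hm]
    refine lt_of_lt_of_le (ENNReal.ofReal_pos.2 ?_) (hfu m)
    exact mul_pos (Real.rpow_pos_of_pos (abs_pos.2 (sub_ne_zero.2 hm.ne)) p) (hwpos m)
  intro n
  exact (hanti.le_of_ncard_eq hvmono hv0 hu (fun t ht => (hcard t ht).2) n).antisymm
    (hvmono.le_of_ncard_eq hanti (fun n => norm_nonneg (u n)) (fun t ht => (hcard t ht).1)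
      (fun t ht => (hcard t ht).2.symm) n)
end

section
/- Let G = (V, E) be an infinite, connected, locally finite graph with countable vertex set in which every vertex has degree at most D. For a finite set X ⊆ V let ∂_V(X) := {y ∈ V \ X : y is adjacent to some x ∈ X}, and let ∂_V^n := min{|∂_V(X)| : X ⊆ V, |X| = n}. Assume ∂_V^{n+1} ≥ ∂_V^n ≥ ∂_V^1 ≥ 2 for all n ≥ 1. Let c ≥ 1 be an integer and let v₁, v₂, ... be an enumeration (bijection ℕ≥1 → V) of the vertices such that for every n ≥ 1, ∂_V({v₁, ..., vₙ}) ⊆ {v_{n+1}, ..., v_{n + c·∂_V^n}}. Let f : V → ℝ be nonnegative and vanishing at infinity, and let f* : V → ℝ be the rearrangement of f with respect to this enumeration, i.e. the function with f*(v₁) ≥ f*(v₂) ≥ ⋯ and, for every t > 0, |{k : f*(v_k) > t}| = |{x ∈ V : f(x) > t}|. Then for every real p with 1 ≤ p < ∞, Σ_{{x,y}∈E} |f*(x) − f*(y)|^p ≤ (c+1)^p · D · Σ_{{x,y}∈E} |f(x) − f(y)|^p (as an inequality in [0, ∞], the sums running over unordered edges). -/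
/-- The `p`-th power of the positive part. -/
noncomputable def posPow (p x : ℝ) : ℝ := (max x 0) ^ p

theorem posPow_nonneg (p x : ℝ) : 0 ≤ posPow p x := Real.rpow_nonneg (le_max_right _ _) _

theorem posPow_of_nonneg {p x : ℝ} (hx : 0 ≤ x) : posPow p x = x ^ p := by
  rw [posPow, max_eq_left hx]

theorem posPow_of_nonpos {p x : ℝ} (hp : 1 ≤ p) (hx : x ≤ 0) : posPow p x = 0 := by
  rw [posPow, max_eq_right hx, Real.zero_rpow (by linarith)]

theorem posPow_mono {p x y : ℝ} (hp : 1 ≤ p) (hxy : x ≤ y) : posPow p x ≤ posPow p y :=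
  Real.rpow_le_rpow (le_max_right _ _) (max_le_max_right _ hxy) (by linarith)

theorem convexOn_posPow {p : ℝ} (hp : 1 ≤ p) : ConvexOn ℝ Set.univ (posPow p) := by
  refine ⟨convex_univ, fun x _ y _ s t hs ht hst => ?_⟩
  have h := (convexOn_rpow hp).2 (Set.mem_Ici.2 (le_max_right x 0))
    (Set.mem_Ici.2 (le_max_right y 0)) hs ht hst
  refine le_trans (Real.rpow_le_rpow (le_max_right _ _) ?_ (by linarith)) h
  simp only [smul_eq_mul]
  have hx := mul_le_mul_of_nonneg_left (le_max_left x 0) hs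
  have hy := mul_le_mul_of_nonneg_left (le_max_left y 0) ht
  have hx0 := mul_nonneg hs (le_max_right x 0)
  have hy0 := mul_nonneg ht (le_max_right y 0)
  exact max_le (by linarith) (by linarith)

theorem ConvexOn.mixed_diff_nonneg {φ : ℝ → ℝ} (hφ : ConvexOn ℝ Set.univ φ) (x : ℝ) {d e : ℝ}
    (hd : 0 ≤ d) (he : 0 ≤ e) : 0 ≤ φ (x + e) - φ (x + e - d) - φ x + φ (x - d) := by
  rcases (add_nonneg hd he).eq_or_lt with h | h
  · have hd0 : d = 0 := by linarith
    simp [hd0]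
  · have h1 := hφ.2 (Set.mem_univ (x + e)) (Set.mem_univ (x - d))
      (div_nonneg hd h.le) (div_nonneg he h.le) (by field_simp)
    have h2 := hφ.2 (Set.mem_univ (x + e)) (Set.mem_univ (x - d))
      (div_nonneg he h.le) (div_nonneg hd h.le) (by field_simp; ring)
    have e1 : (d / (d + e)) • (x + e) + (e / (d + e)) • (x - d) = x := by
      simp only [smul_eq_mul]; field_simp; ring
    have e2 : (e / (d + e)) • (x + e) + (d / (d + e)) • (x - d) = x + e - d := by
      simp only [smul_eq_mul]; field_simp; ring
    have e3 : d / (d + e) + e / (d + e) = 1 := by field_simp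
    rw [e1] at h1
    rw [e2] at h2
    simp only [smul_eq_mul] at h1 h2
    have e4 : e / (d + e) = 1 - d / (d + e) := by linarith
    rw [e4] at h1 h2
    linarith

/-- The mixed second difference of `(i, j) ↦ (a i - a j)₊ ^ p`. -/
noncomputable def bandWeight (p : ℝ) (a : ℕ → ℝ) (α β : ℕ) : ℝ :=
  posPow p (a α - a (β + 1)) - posPow p (a (α + 1) - a (β + 1)) - posPow p (a α - a β) +
    posPow p (a (α + 1) - a β)

section bandWeight

variable {p : ℝ} {a : ℕ → ℝ}

theorem bandWeight_nonneg (hp : 1 ≤ p) (ha : Antitone a) (α β : ℕ) : 0 ≤ bandWeight p a α β := by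
  have h := (convexOn_posPow hp).mixed_diff_nonneg (a α - a β)
    (sub_nonneg.2 (ha α.le_succ)) (sub_nonneg.2 (ha β.le_succ))
  rw [show a α - a β + (a β - a β.succ) - (a α - a α.succ) = a (α + 1) - a (β + 1) by
      simp only [Nat.succ_eq_add_one]; ring, sub_add_sub_cancel,
    show a α - a β - (a α - a α.succ) = a (α + 1) - a β by
      simp only [Nat.succ_eq_add_one]; ring] at h
  exact h

theorem bandWeight_eq_zero_of_left {α : ℕ} (h : a (α + 1) = a α) (β : ℕ) :
    bandWeight p a α β = 0 := by
  simp [bandWeight, h]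

theorem bandWeight_eq_zero_of_right {β : ℕ} (h : a (β + 1) = a β) (α : ℕ) :
    bandWeight p a α β = 0 := by
  simp [bandWeight, h]

theorem posPow_sub_eq_zero (hp : 1 ≤ p) (ha : Antitone a) {i j : ℕ} (h : j ≤ i) :
    posPow p (a i - a j) = 0 :=
  posPow_of_nonpos hp (sub_nonpos.2 (ha h))

theorem bandWeight_eq_zero_of_lt (hp : 1 ≤ p) (ha : Antitone a) {α β : ℕ} (h : β < α) :
    bandWeight p a α β = 0 := by
  unfold bandWeight
  rw [posPow_sub_eq_zero hp ha (show β + 1 ≤ α by omega),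
    posPow_sub_eq_zero hp ha (show β + 1 ≤ α + 1 by omega),
    posPow_sub_eq_zero hp ha (show β ≤ α by omega),
    posPow_sub_eq_zero hp ha (show β ≤ α + 1 by omega)]
  ring

open Finset in
theorem sum_bandWeight {i I j J : ℕ} (hi : i ≤ I) (hj : j ≤ J) :
    ∑ α ∈ Ico i I, ∑ β ∈ Ico j J, bandWeight p a α β =
      posPow p (a i - a J) - posPow p (a I - a J) - posPow p (a i - a j) +
        posPow p (a I - a j) := by
  have inner (α : ℕ) : ∑ β ∈ Ico j J, bandWeight p a α β =
      posPow p (a α - a J) - posPow p (a (α + 1) - a J) - posPow p (a α - a j) +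
        posPow p (a (α + 1) - a j) := by
    induction J, hj using Nat.le_induction with
    | base => simp
    | succ n hn ih => rw [sum_Ico_succ_top hn, ih, bandWeight]; ring
  simp only [inner]
  induction I, hi using Nat.le_induction with
  | base => simp
  | succ n hn ih => rw [sum_Ico_succ_top hn, ih]; ring

open scoped Classical in
theorem ofReal_posPow_le_tsum_bandWeight (hp : 1 ≤ p) (ha : Antitone a) (i j : ℕ) :
    ENNReal.ofReal (posPow p (a i - a j)) ≤
      ∑' q : ℕ × ℕ, if i ≤ q.1 ∧ q.2 < j then ENNReal.ofReal (bandWeight p a q.1 q.2) else 0 := by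
  rcases le_total j i with hij | hij
  · simp [posPow_sub_eq_zero hp ha hij]
  have h := sum_bandWeight (p := p) (a := a) hij hij
  rw [posPow_sub_eq_zero hp ha le_rfl, posPow_sub_eq_zero hp ha le_rfl,
    posPow_sub_eq_zero hp ha hij, ← Finset.sum_product'] at h
  simp only [sub_zero, add_zero] at h
  rw [← h, ENNReal.ofReal_sum_of_nonneg fun q _ => bandWeight_nonneg hp ha q.1 q.2]
  refine le_trans (Finset.sum_le_sum fun q hq => ?_) (ENNReal.sum_le_tsum _)
  simp only [Finset.mem_product, Finset.mem_Ico] at hq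
  rw [if_pos ⟨hq.1.1, hq.2.2⟩]

open scoped Classical in
theorem tsum_bandWeight_le_ofReal_posPow (hp : 1 ≤ p) (ha : Antitone a) (W Y : ℝ) :
    ∑' q : ℕ × ℕ, (if a q.1 ≤ W ∧ Y ≤ a (q.2 + 1) then
      ENNReal.ofReal (bandWeight p a q.1 q.2) else 0) ≤ ENNReal.ofReal (posPow p (W - Y)) := by
  rw [ENNReal.tsum_eq_iSup_sum' (fun N : ℕ => Finset.range N ×ˢ Finset.range N)]
  · refine iSup_le fun N => ?_
    have exi : ∃ i, a i ≤ W ∨ N ≤ i := ⟨N, Or.inr le_rfl⟩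
    have exj : ∃ j, ¬ Y ≤ a (j + 1) ∨ N ≤ j := ⟨N, Or.inr le_rfl⟩
    set i := Nat.find exi
    set j := Nat.find exj
    have hiN : i ≤ N := Nat.find_min' exi (Or.inr le_rfl)
    have hjN : j ≤ N := Nat.find_min' exj (Or.inr le_rfl)
    have hfilter : (Finset.range N ×ˢ Finset.range N).filter
        (fun q => a q.1 ≤ W ∧ Y ≤ a (q.2 + 1)) = Finset.Ico i N ×ˢ Finset.Ico 0 j := by
      ext ⟨α, β⟩
      simp only [Finset.mem_filter, Finset.mem_product, Finset.mem_range, Finset.mem_Ico]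
      constructor
      · rintro ⟨⟨hα, hβ⟩, hW, hY⟩
        refine ⟨⟨Nat.find_min' exi (Or.inl hW), hα⟩, Nat.zero_le _, ?_⟩
        by_contra hlt
        rcases Nat.find_spec exj with h | h
        · exact h (hY.trans (ha (by omega)))
        · exact absurd (le_trans h (not_lt.1 hlt)) (by omega)
      · rintro ⟨⟨hi, hα⟩, -, hβ⟩
        have hj := Nat.find_min exj hβ
        push Not at hj
        refine ⟨⟨hα, by omega⟩, ?_, hj.1⟩
        rcases Nat.find_spec exi with h | h
        · exact (ha hi).trans h
        · exact absurd (h.trans hi) (by omega)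
    rw [← Finset.sum_filter, hfilter,
      ← ENNReal.ofReal_sum_of_nonneg fun q _ => bandWeight_nonneg hp ha q.1 q.2,
      Finset.sum_product, sum_bandWeight hiN (Nat.zero_le j), posPow_sub_eq_zero hp ha hjN,
      posPow_sub_eq_zero hp ha (Nat.zero_le i), posPow_sub_eq_zero hp ha (Nat.zero_le N)]
    simp only [sub_zero, add_zero]
    refine ENNReal.ofReal_le_ofReal ?_
    rcases Nat.lt_or_ge i j with hij | hij
    · refine posPow_mono hp (sub_le_sub ?_ ?_)
      · rcases Nat.find_spec exi with h | h
        · exact h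
        · exact absurd (h.trans_lt hij) (by omega)
      · have hj := Nat.find_min exj (show j - 1 < j by omega)
        push Not at hj
        rw [Nat.sub_add_cancel (by omega)] at hj
        exact hj.1
    · rw [posPow_sub_eq_zero hp ha hij]
      exact posPow_nonneg _ _
  · intro t
    obtain ⟨N, hN⟩ := (t.image Prod.fst ∪ t.image Prod.snd).exists_nat_subset_range
    refine ⟨N, fun q hq => ?_⟩
    simp only [Finset.mem_product]
    exact ⟨hN (Finset.mem_union_left _ (Finset.mem_image_of_mem _ hq)),
      hN (Finset.mem_union_right _ (Finset.mem_image_of_mem _ hq))⟩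

end bandWeight

/-- At a strict drop of the decreasing sequence `a` equimeasurable with `f`, the superlevel set
of `f` is determined, and `f` takes no value in the gap. -/
theorem superlevel_of_drop {V : Type*} {f : V → ℝ} {a : ℕ → ℝ} (ha : Antitone a)
    (ha0 : ∀ k, 0 ≤ a k) (hfvan : ∀ t : ℝ, 0 < t → {x : V | t < f x}.Finite)
    (hcard : ∀ t : ℝ, 0 < t → {k : ℕ | t < a k}.ncard = {x : V | t < f x}.ncard)
    {k : ℕ} (hk : a (k + 1) < a k) :
    {x | a k ≤ f x}.Finite ∧ {x | a k ≤ f x}.ncard = k + 1 ∧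
      ∀ x, f x < a k → f x ≤ a (k + 1) := by
  have card_eq (t : ℝ) (h1 : a (k + 1) < t) (h2 : t < a k) : {x | t < f x}.ncard = k + 1 := by
    rw [← hcard t ((ha0 _).trans_lt h1)]
    have : {m : ℕ | t < a m} = (Finset.range (k + 1) : Set ℕ) := by
      ext m
      simp only [Set.mem_ofPred_eq, Finset.coe_range, Set.mem_Iio]
      constructor
      · intro hm
        by_contra hlt
        linarith [ha (not_lt.1 hlt)]
      · intro hm
        exact h2.trans_le (ha (by omega))
    rw [this, Set.ncard_coe_finset, Finset.card_range]
  have gap (x : V) (hx : f x < a k) : f x ≤ a (k + 1) := by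
    by_contra! hlt
    obtain ⟨t, ht1, ht2⟩ := exists_between hlt
    have hsub : {z | f x < f z} ⊆ {z | t < f z} := fun z hz => ht2.trans hz
    have heq := Set.eq_of_subset_of_ncard_le hsub
      (by rw [card_eq t ht1 (ht2.trans hx), card_eq (f x) hlt hx])
      (hfvan t ((ha0 _).trans_lt ht1))
    have hmem : x ∈ {z | t < f z} := ht2
    rw [← heq] at hmem
    exact lt_irrefl (f x) hmem
  obtain ⟨t, ht1, ht2⟩ := exists_between hk
  have heq : {x | a k ≤ f x} = {x | t < f x} := by
    ext x
    simp only [Set.mem_ofPred_eq]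
    refine ⟨ht2.trans_le, fun h => ?_⟩
    by_contra! hlt
    linarith [gap x hlt]
  exact ⟨heq ▸ hfvan t ((ha0 _).trans_lt ht1), heq ▸ card_eq t ht1 ht2, gap⟩

open scoped Classical in
/-- The isoperimetric comparison: the decreasing sequence `a` equimeasurable with `f`, differenced
at the scale of the isoperimetric profile `s`, is controlled by the increments of `f` from each
vertex to its largest neighbour `w`. -/
theorem tsum_profile_diff_le {V : Type*} (G : SimpleGraph V) {f : V → ℝ} {a : ℕ → ℝ}
    {p : ℝ} (hp : 1 ≤ p) (ha : Antitone a)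
    (ha0 : ∀ k, 0 ≤ a k) (hfvan : ∀ t : ℝ, 0 < t → {x : V | t < f x}.Finite)
    (hcard : ∀ t : ℝ, 0 < t → {k : ℕ | t < a k}.ncard = {x : V | t < f x}.ncard)
    {s : ℕ → ℕ} (hs : Monotone s)
    (hiso : ∀ n (X : Set V), X.Finite → X.ncard = n + 1 →
      s n ≤ {y | y ∉ X ∧ ∃ x ∈ X, G.Adj x y}.ncard)
    (w : V → V) (hw : ∀ x y, G.Adj x y → f x ≤ f (w y)) :
    ∑' m, ENNReal.ofReal (posPow p (a m - a (m + s m))) ≤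
      ∑' y, ENNReal.ofReal (posPow p (f (w y) - f y)) := by
  calc ∑' m, ENNReal.ofReal (posPow p (a m - a (m + s m)))
      ≤ ∑' m, ∑' q : ℕ × ℕ, (if m ≤ q.1 ∧ q.2 < m + s m then
          ENNReal.ofReal (bandWeight p a q.1 q.2) else 0) :=
        ENNReal.tsum_le_tsum fun m => ofReal_posPow_le_tsum_bandWeight hp ha _ _
    _ = ∑' q : ℕ × ℕ, ∑' m, (if m ≤ q.1 ∧ q.2 < m + s m then
          ENNReal.ofReal (bandWeight p a q.1 q.2) else 0) := ENNReal.tsum_comm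
    _ ≤ ∑' q : ℕ × ℕ, ∑' y, (if a q.1 ≤ f (w y) ∧ f y ≤ a (q.2 + 1) then
          ENNReal.ofReal (bandWeight p a q.1 q.2) else 0) := by
        refine ENNReal.tsum_le_tsum fun ⟨α, β⟩ => ?_
        dsimp only
        by_cases h0 : bandWeight p a α β = 0
        · simp [h0]
        have hαβ : α ≤ β := not_lt.1 fun h => h0 (bandWeight_eq_zero_of_lt hp ha h)
        have hα : a (α + 1) < a α :=
          lt_of_le_of_ne (ha α.le_succ) fun h => h0 (bandWeight_eq_zero_of_left h β)
        have hβ : a (β + 1) < a β :=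
          lt_of_le_of_ne (ha β.le_succ) fun h => h0 (bandWeight_eq_zero_of_right h α)
        obtain ⟨hSα, hSαc, -⟩ := superlevel_of_drop ha ha0 hfvan hcard hα
        obtain ⟨hSβ, hSβc, hgap⟩ := superlevel_of_drop ha ha0 hfvan hcard hβ
        set Sα := {x | a α ≤ f x}
        set Sβ := {x | a β ≤ f x}
        set B := {y | y ∉ Sα ∧ ∃ x ∈ Sα, G.Adj x y}
        have hB : s α ≤ B.ncard := hiso α Sα hSα hSαc
        rcases Nat.eq_zero_or_pos (s α) with hs0 | hspos
        · have : ∀ m, ¬ (m ≤ α ∧ β < m + s m) := by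
            rintro m ⟨h1, h2⟩
            have := hs h1
            omega
          simp [this]
        have hBfin : B.Finite := Set.finite_of_ncard_pos (hspos.trans_le hB)
        have hsub : Sα ⊆ Sβ := fun x hx => (ha hαβ).trans hx
        have hcardF : s α + α ≤ (B \ Sβ).ncard + β := by
          have h1 : (B ∩ Sβ).ncard ≤ (Sβ \ Sα).ncard :=
            Set.ncard_le_ncard (fun y hy => ⟨hy.2, hy.1.1⟩) (hSβ.subset Set.sdiff_subset)
          have h2 := Set.ncard_sdiff_add_ncard_of_subset hsub hSβ
          have h3 := Set.ncard_inter_add_ncard_sdiff_eq_ncard B Sβ hBfin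
          omega
        have hFfin : (B \ Sβ).Finite := hBfin.subset Set.sdiff_subset
        have hle : ∀ m, (m ≤ α ∧ β < m + s m) → m ∈ Finset.Ico (β + 1 - s α) (α + 1) := by
          rintro m ⟨h1, h2⟩
          have := hs h1
          simp only [Finset.mem_Ico]
          omega
        calc ∑' m, (if m ≤ α ∧ β < m + s m then ENNReal.ofReal (bandWeight p a α β) else 0)
            = ∑ m ∈ Finset.Ico (β + 1 - s α) (α + 1),
                (if m ≤ α ∧ β < m + s m then ENNReal.ofReal (bandWeight p a α β) else 0) :=
              tsum_eq_sum fun m hm => if_neg fun h => hm (hle m h)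
          _ ≤ ∑ m ∈ Finset.Ico (β + 1 - s α) (α + 1), ENNReal.ofReal (bandWeight p a α β) :=
              Finset.sum_le_sum fun m _ => by split_ifs <;> simp
          _ ≤ ∑ y ∈ hFfin.toFinset, ENNReal.ofReal (bandWeight p a α β) := by
              simp only [Finset.sum_const, nsmul_eq_mul]
              gcongr
              rw [← Set.ncard_eq_toFinset_card _ hFfin, Nat.card_Ico]
              omega
          _ ≤ ∑ y ∈ hFfin.toFinset, (if a α ≤ f (w y) ∧ f y ≤ a (β + 1) then
                ENNReal.ofReal (bandWeight p a α β) else 0) := by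
              refine Finset.sum_le_sum fun y hy => ?_
              obtain ⟨⟨-, x, hx, hxy⟩, hyβ⟩ := hFfin.mem_toFinset.1 hy
              rw [if_pos ⟨le_trans hx (hw x y hxy), hgap y (not_le.1 hyβ)⟩]
          _ ≤ _ := ENNReal.sum_le_tsum _
    _ = ∑' y, ∑' q : ℕ × ℕ, (if a q.1 ≤ f (w y) ∧ f y ≤ a (q.2 + 1) then
          ENNReal.ofReal (bandWeight p a q.1 q.2) else 0) := ENNReal.tsum_comm
    _ ≤ ∑' y, ENNReal.ofReal (posPow p (f (w y) - f y)) :=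
        ENNReal.tsum_le_tsum fun y => tsum_bandWeight_le_ofReal_posPow hp ha _ _

/-- Differences at scale `c * s` are controlled by those at scale `s`. -/
theorem tsum_dilated_diff_le {a : ℕ → ℝ} {p : ℝ} (hp : 1 ≤ p) (ha : Antitone a)
    {s : ℕ → ℕ} (hs : Monotone s) {c : ℕ} (hc : 1 ≤ c) :
    ∑' i, ENNReal.ofReal (posPow p (a i - a (i + c * s i))) ≤
      ENNReal.ofReal ((c : ℝ) ^ p) * ∑' i, ENNReal.ofReal (posPow p (a i - a (i + s i))) := by
  have hc0 : (0 : ℝ) < c := by exact_mod_cast hc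
  have pointwise (i : ℕ) : posPow p (a i - a (i + c * s i)) ≤
      (c : ℝ) ^ (p - 1) *
        ∑ k ∈ Finset.range c, posPow p (a (i + k * s i) - a (i + k * s i + s (i + k * s i))) := by
    have htel : a i - a (i + c * s i) =
        ∑ k ∈ Finset.range c, |a (i + k * s i) - a (i + (k + 1) * s i)| := by
      have := Finset.sum_range_sub' (fun k => a (i + k * s i)) c
      simp only [zero_mul, add_zero] at this
      rw [← this]
      refine Finset.sum_congr rfl fun k _ => (abs_of_nonneg (sub_nonneg.2 (ha ?_))).symm
      gcongr
      omega
    rw [posPow_of_nonneg (sub_nonneg.2 (ha (Nat.le_add_right _ _))), htel]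
    refine (Real.rpow_sum_le_const_mul_sum_rpow _ _ hp).trans ?_
    rw [Finset.card_range]
    gcongr with k _
    rw [abs_of_nonneg (sub_nonneg.2 (ha (by gcongr; omega))),
      ← posPow_of_nonneg (sub_nonneg.2 (ha (by gcongr; omega)))]
    refine posPow_mono hp (sub_le_sub_left (ha ?_) _)
    have := hs (Nat.le_add_right i (k * s i))
    rw [add_mul, one_mul]
    omega
  calc ∑' i, ENNReal.ofReal (posPow p (a i - a (i + c * s i)))
      ≤ ∑' i, ENNReal.ofReal ((c : ℝ) ^ (p - 1)) * ∑ k ∈ Finset.range c,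
          ENNReal.ofReal (posPow p (a (i + k * s i) - a (i + k * s i + s (i + k * s i)))) := by
        refine ENNReal.tsum_le_tsum fun i => ?_
        rw [← ENNReal.ofReal_sum_of_nonneg fun _ _ => posPow_nonneg _ _,
          ← ENNReal.ofReal_mul (by positivity)]
        exact ENNReal.ofReal_le_ofReal (pointwise i)
    _ = ENNReal.ofReal ((c : ℝ) ^ (p - 1)) * ∑ k ∈ Finset.range c, ∑' i,
          ENNReal.ofReal (posPow p (a (i + k * s i) - a (i + k * s i + s (i + k * s i)))) := by
        rw [ENNReal.tsum_mul_left, Summable.tsum_finsetSum fun _ _ => ENNReal.summable]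
    _ ≤ ENNReal.ofReal ((c : ℝ) ^ (p - 1)) * ∑ k ∈ Finset.range c, ∑' i,
          ENNReal.ofReal (posPow p (a i - a (i + s i))) := by
        refine mul_le_mul_right (Finset.sum_le_sum fun k _ => ?_) _
        refine ENNReal.tsum_comp_le_tsum_of_injective (f := fun i => i + k * s i) ?_
          (fun m => ENNReal.ofReal (posPow p (a m - a (m + s m))))
        refine StrictMono.injective fun i j hij => ?_
        exact add_lt_add_of_lt_of_le hij (Nat.mul_le_mul_left k (hs hij.le))
    _ = _ := by
        rw [Finset.sum_const, Finset.card_range, nsmul_eq_mul, ← mul_assoc,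
          ← ENNReal.ofReal_natCast, ← ENNReal.ofReal_mul (by positivity)]
        congr 2
        rw [Real.rpow_sub_one hc0.ne']
        field_simp

/-- The `p`-th power of the increment of `f` along an edge. -/
noncomputable def edgeEnergy {V : Type*} (p : ℝ) (f : V → ℝ) : Sym2 V → ENNReal :=
  Sym2.lift ⟨fun x y => ENNReal.ofReal (|f x - f y| ^ p),
    fun x y => by dsimp only; rw [abs_sub_comm]⟩

theorem edgeEnergy_mk {V : Type*} (p : ℝ) (f : V → ℝ) (x y : V) :
    edgeEnergy p f s(x, y) = ENNReal.ofReal (|f x - f y| ^ p) := rfl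

theorem tsum_upward_le_tsum_edgeEnergy {V : Type*} (G : SimpleGraph V) {f : V → ℝ} {p : ℝ}
    (hp : 1 ≤ p) (w : V → V) (hw : ∀ y, f y < f (w y) → G.Adj (w y) y) :
    ∑' y, ENNReal.ofReal (posPow p (f (w y) - f y)) ≤
      ∑' e : G.edgeSet, edgeEnergy p f e := by
  rw [← tsum_subtype_eq_of_support_subset (s := {y | f y < f (w y)})]
  · let g : {y | f y < f (w y)} → G.edgeSet := fun y => ⟨s(w y, y), hw y y.2⟩
    have hg : Function.Injective g := by
      rintro ⟨x, hx⟩ ⟨y, hy⟩ h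
      have h' : s(w x, x) = s(w y, y) := congrArg Subtype.val h
      rcases Sym2.eq_iff.1 h' with h | h
      · exact Subtype.ext h.2
      · simp only [Set.mem_ofPred_eq, h.1, ← h.2] at hx hy
        exact absurd hx hy.not_gt
    refine le_trans (ENNReal.tsum_le_tsum fun y => ?_)
      (ENNReal.tsum_comp_le_tsum_of_injective hg fun e => edgeEnergy p f e)
    have hy : 0 ≤ f (w y) - f y := sub_nonneg.2 (le_of_lt y.2)
    change _ ≤ edgeEnergy p f s(w y, y)
    rw [edgeEnergy_mk, posPow_of_nonneg hy, abs_of_nonneg hy]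
  · intro y hy
    by_contra hlt
    exact hy (by simp [posPow_of_nonpos hp (sub_nonpos.2 (not_lt.1 hlt))])

theorem tsum_edgeEnergy_le_of_enumeration {V : Type*} (G : SimpleGraph V) {D : ℕ}
    (hlf : ∀ x : V, {y : V | G.Adj x y}.Finite)
    (hdeg : ∀ x : V, {y : V | G.Adj x y}.ncard ≤ D) {v : ℕ → V} (hv : Function.Bijective v)
    {f : V → ℝ} (hf : Antitone fun k => f (v k)) {p : ℝ} (hp : 1 ≤ p) {r : ℕ → ℕ}
    (hr : ∀ i j, i < j → G.Adj (v i) (v j) → j ≤ i + r i) :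
    ∑' e : G.edgeSet, edgeEnergy p f e ≤
      D * ∑' i, ENNReal.ofReal (posPow p (f (v i) - f (v (i + r i)))) := by
  have orient (e : G.edgeSet) : ∃ q : (i : ℕ) × {y : V | G.Adj (v i) y},
      (e : Sym2 V) = s(v q.1, q.2) ∧
        edgeEnergy p f e ≤ ENNReal.ofReal (posPow p (f (v q.1) - f (v (q.1 + r q.1)))) := by
    have key (i j : ℕ) (hij : i < j) (hadj : G.Adj (v i) (v j)) :
        edgeEnergy p f s(v i, v j) ≤ ENNReal.ofReal (posPow p (f (v i) - f (v (i + r i)))) := by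
      have h0 : 0 ≤ f (v i) - f (v j) := sub_nonneg.2 (hf hij.le)
      rw [edgeEnergy_mk, abs_of_nonneg h0, ← posPow_of_nonneg h0]
      exact ENNReal.ofReal_le_ofReal (posPow_mono hp (sub_le_sub_left (hf (hr i j hij hadj)) _))
    obtain ⟨e, he⟩ := e
    induction e using Sym2.ind with | _ x y
    obtain ⟨i, rfl⟩ := hv.2 x
    obtain ⟨j, rfl⟩ := hv.2 y
    have hadj : G.Adj (v i) (v j) := he
    rcases lt_trichotomy i j with hij | hij | hij
    · exact ⟨⟨i, v j, hadj⟩, rfl, key i j hij hadj⟩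
    · exact absurd (hij ▸ hadj) (G.loopless.irrefl _)
    · refine ⟨⟨j, v i, hadj.symm⟩, Sym2.eq_swap, ?_⟩
      change edgeEnergy p f s(v i, v j) ≤ _
      rw [Sym2.eq_swap]
      exact key j i hij hadj.symm
  choose g hg1 hg2 using orient
  have hg : Function.Injective g := fun e e' h => Subtype.ext (by rw [hg1 e, hg1 e', h])
  refine (ENNReal.tsum_le_tsum hg2).trans ((ENNReal.tsum_comp_le_tsum_of_injective hg
    fun q => ENNReal.ofReal (posPow p (f (v q.1) - f (v (q.1 + r q.1))))).trans ?_)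
  rw [ENNReal.tsum_sigma', ← ENNReal.tsum_mul_left]
  refine ENNReal.tsum_le_tsum fun i => ?_
  have := (hlf (v i)).fintype
  dsimp only
  rw [tsum_fintype, Finset.sum_const, nsmul_eq_mul, Finset.card_univ, ← Nat.card_eq_fintype_card,
    Nat.card_coe_set_eq]
  gcongr
  exact hdeg (v i)

theorem exists_largest_neighbour {V : Type*} (G : SimpleGraph V)
    (hlf : ∀ x : V, {y : V | G.Adj x y}.Finite) (f : V → ℝ) (y : V) :
    ∃ w, (∀ x, G.Adj x y → f x ≤ f w) ∧ (f y < f w → G.Adj w y) := by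
  rcases {x | G.Adj y x}.eq_empty_or_nonempty with h | h
  · refine ⟨y, fun x hx => ?_, fun h => absurd h (lt_irrefl _)⟩
    have : x ∈ {x | G.Adj y x} := hx.symm
    simp [h] at this
  · obtain ⟨w, hw, hmax⟩ := Set.exists_max_image _ f (hlf y) h
    exact ⟨w, fun x hx => hmax x hx.symm, fun _ => hw.symm⟩


/-- Boundedness of rearrangements along enumerations that approximately solve the
vertex-isoperimetric problem, on an infinite connected graph of bounded degree:
`‖∇f*‖_p ≤ (c+1) D^{1/p} ‖∇f‖_p`, i.e. the `p`-th powers satisfy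
`Σ |∇f*|^p ≤ (c+1)^p D Σ |∇f|^p`. -/
theorem rearrangement_bounded_general_graph
    {V : Type*} [Infinite V] [Countable V] (G : SimpleGraph V)
    (hconn : G.Connected) (D : ℕ)
    (hlf : ∀ x : V, {y : V | G.Adj x y}.Finite)
    (hdeg : ∀ x : V, {y : V | G.Adj x y}.ncard ≤ D)
    -- `bd X` is the vertex boundary `∂_V(X)`
    (bd : Set V → Set V)
    (hbd : ∀ X : Set V, bd X = {y : V | y ∉ X ∧ ∃ x ∈ X, G.Adj x y})
    -- `iso n` is the isoperimetric number `∂_V^n`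
    (iso : ℕ → ℕ)
    (hiso : ∀ n : ℕ,
      IsLeast {m : ℕ | ∃ X : Set V, X.Finite ∧ X.ncard = n ∧ (bd X).ncard = m} (iso n))
    (hmono : ∀ n : ℕ, 1 ≤ n → iso n ≤ iso (n + 1))
    (hiso1 : 2 ≤ iso 1)
    -- the enumeration `v₁, v₂, …` (here `v k = v_{k+1}`)
    (c : ℕ) (hc : 1 ≤ c) (v : ℕ → V) (hv : Function.Bijective v)
    (henum : ∀ n : ℕ, 1 ≤ n → bd (v '' Set.Iio n) ⊆ v '' Set.Ico n (n + c * iso n))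
    -- `f` nonnegative, vanishing at infinity, and `fstar` its rearrangement
    (f : V → ℝ) (hf0 : ∀ x, 0 ≤ f x)
    (hfvan : ∀ t : ℝ, 0 < t → {x : V | t < f x}.Finite)
    (fstar : V → ℝ) (hfs0 : ∀ x, 0 ≤ fstar x)
    (hfsmono : ∀ k : ℕ, fstar (v (k + 1)) ≤ fstar (v k))
    (hfscard : ∀ t : ℝ, 0 < t → {x : V | t < fstar x}.Finite ∧
      {x : V | t < fstar x}.ncard = {x : V | t < f x}.ncard)
    (p : ℝ) (hp : 1 ≤ p) :
    ∑' e : G.edgeSet,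
        Sym2.lift ⟨fun x y => ENNReal.ofReal (|fstar x - fstar y| ^ p),
          fun x y => by dsimp only; rw [abs_sub_comm]⟩ (e : Sym2 V) ≤
      ENNReal.ofReal (((c : ℝ) + 1) ^ p * (D : ℝ)) *
        ∑' e : G.edgeSet,
          Sym2.lift ⟨fun x y => ENNReal.ofReal (|f x - f y| ^ p),
            fun x y => by dsimp only; rw [abs_sub_comm]⟩ (e : Sym2 V) := by
  set a : ℕ → ℝ := fun k => fstar (v k)
  set s : ℕ → ℕ := fun m => iso (m + 1)
  have ha : Antitone a := antitone_nat_of_succ_le hfsmono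
  have hs : Monotone s := monotone_nat_of_le_succ fun n => hmono (n + 1) (by omega)
  have hcard (t : ℝ) (ht : 0 < t) : {k : ℕ | t < a k}.ncard = {x : V | t < f x}.ncard := by
    rw [← (hfscard t ht).2, ← Set.ncard_image_of_injective _ hv.1]
    exact congrArg Set.ncard (Set.image_preimage_eq {x | t < fstar x} hv.2)
  have hprofile (n : ℕ) (X : Set V) (hX : X.Finite) (hXn : X.ncard = n + 1) :
      s n ≤ {y | y ∉ X ∧ ∃ x ∈ X, G.Adj x y}.ncard := by
    rw [← hbd X]
    exact (hiso (n + 1)).2 ⟨X, hX, hXn, rfl⟩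
  have hrange (i j : ℕ) (hij : i < j) (hadj : G.Adj (v i) (v j)) : j ≤ i + c * s i := by
    have hmem : v j ∈ bd (v '' Set.Iio (i + 1)) := by
      rw [hbd]
      refine ⟨?_, v i, ⟨i, Nat.lt_succ_self i, rfl⟩, hadj⟩
      rintro ⟨k, hk, hkj⟩
      rw [hv.1 hkj, Set.mem_Iio] at hk
      omega
    obtain ⟨k, hk, hkj⟩ := henum (i + 1) (by omega) hmem
    rw [hv.1 hkj] at hk
    have : j < i + 1 + c * s i := hk.2
    omega
  choose w hw hw' using exists_largest_neighbour G hlf f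
  change ∑' e : G.edgeSet, edgeEnergy p fstar e ≤ _ * ∑' e : G.edgeSet, edgeEnergy p f e
  calc ∑' e : G.edgeSet, edgeEnergy p fstar e
      ≤ D * ∑' i, ENNReal.ofReal (posPow p (a i - a (i + c * s i))) :=
        tsum_edgeEnergy_le_of_enumeration G hlf hdeg hv ha hp hrange
    _ ≤ D * (ENNReal.ofReal ((c : ℝ) ^ p) *
          ∑' i, ENNReal.ofReal (posPow p (a i - a (i + s i)))) := by
        gcongr
        exact tsum_dilated_diff_le hp ha hs hc
    _ ≤ D * (ENNReal.ofReal ((c : ℝ) ^ p) * ∑' e : G.edgeSet, edgeEnergy p f e) := by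
        gcongr
        exact (tsum_profile_diff_le G hp ha (fun k => hfs0 _) hfvan hcard hs hprofile w
          fun x y h => hw y x h).trans (tsum_upward_le_tsum_edgeEnergy G hp w hw')
    _ ≤ _ := by
        rw [← mul_assoc, ← ENNReal.ofReal_natCast, ← ENNReal.ofReal_mul (Nat.cast_nonneg D),
          mul_comm (D : ℝ)]
        gcongr
        linarith
end

section
/- Let u : ℤ² → ℝ be finitely supported and antisymmetric, i.e. u(n₁, n₂) = −u(n₂, n₁) for all (n₁, n₂) ∈ ℤ². Then 4 sin²(π/8) · Σ_{n∈ℤ², n≠0} |u(n)|² / ‖n‖_∞² ≤ Σ_{n∈ℤ²} Σ_{j=1}^{2} |u(n) − u(n − e_j)|², where ‖n‖_∞ := max(|n₁|, |n₂|) and e₁ = (1,0), e₂ = (0,1). -/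
open Real

namespace DiscreteHardy

/-- The `ℓ^∞` norm on `ℤ²`. -/
def supNorm (n : ℤ × ℤ) : ℤ := max |n.1| |n.2|

/-- The ground state, which on each sphere of the `ℓ^∞` norm is the first Dirichlet eigenfunction
of the two paths obtained by removing the diagonal. -/
noncomputable def groundState (n : ℤ × ℤ) : ℝ :=
  cos (π / (4 * (supNorm n : ℝ)) * ((n.1 + n.2 : ℤ) : ℝ))

/-- The potential contributed at `n` by the edge from `n` to `m`, when both endpoints lie on the
same sphere. -/
noncomputable def edgeTerm (u : ℤ × ℤ → ℝ) (n m : ℤ × ℤ) : ℝ :=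
  if supNorm n = supNorm m then u n ^ 2 * (1 - groundState m / groundState n) else 0

lemma supNorm_pos {n : ℤ × ℤ} (hn : n.1 ≠ n.2) : 0 < supNorm n := by
  simp only [supNorm, abs_eq_max_neg]
  omega

lemma groundState_pos {n : ℤ × ℤ} (hn : n.1 ≠ n.2) : 0 < groundState n := by
  have hk : (0 : ℝ) < supNorm n := by exact_mod_cast supNorm_pos hn
  have h1 : n.1 + n.2 < 2 * supNorm n := by simp only [supNorm, abs_eq_max_neg]; omega
  have h2 : -(2 * supNorm n) < n.1 + n.2 := by simp only [supNorm, abs_eq_max_neg]; omega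
  have h1' : ((n.1 + n.2 : ℤ) : ℝ) < 2 * supNorm n := by exact_mod_cast h1
  have h2' : -(2 * (supNorm n : ℝ)) < ((n.1 + n.2 : ℤ) : ℝ) := by exact_mod_cast h2
  have hc : 0 < π / (4 * (supNorm n : ℝ)) := by positivity
  have he : π / (4 * (supNorm n : ℝ)) * (2 * supNorm n) = π / 2 := by field_simp; norm_num
  apply cos_pos_of_mem_Ioo
  constructor
  · nlinarith [mul_lt_mul_of_pos_left h2' hc]
  · nlinarith [mul_lt_mul_of_pos_left h1' hc]

lemma groundState_eq_zero {n : ℤ × ℤ} (hn : n.1 = n.2) (hk : supNorm n ≠ 0) :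
    groundState n = 0 := by
  have hk' : (supNorm n : ℝ) ≠ 0 := by exact_mod_cast hk
  have h : n.1 + n.2 = 2 * supNorm n ∨ n.1 + n.2 = -(2 * supNorm n) := by
    simp only [supNorm, abs_eq_max_neg]; omega
  unfold groundState
  rcases h with h | h <;> rw [h] <;> push_cast
  · rw [← cos_pi_div_two]; congr 1; field_simp; norm_num
  · rw [← cos_pi_div_two, ← cos_neg (π / 2)]; congr 1; field_simp; norm_num

lemma edgeTerm_add_edgeTerm_le {u : ℤ × ℤ → ℝ} (hdiag : ∀ n : ℤ × ℤ, n.1 = n.2 → u n = 0)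
    (n m : ℤ × ℤ) : edgeTerm u n m + edgeTerm u m n ≤ |u n - u m| ^ 2 := by
  rw [sq_abs]
  by_cases h : supNorm n = supNorm m
  swap
  · simp only [edgeTerm, h, Ne.symm h, if_false, add_zero]
    exact sq_nonneg _
  simp only [edgeTerm, h, if_true]
  by_cases hn : n.1 = n.2 <;> by_cases hm : m.1 = m.2
  · simp [hdiag n hn, hdiag m hm]
  · rw [hdiag n hn, groundState_eq_zero hn (by rw [h]; exact (supNorm_pos hm).ne')]
    simp
  · rw [hdiag m hm, groundState_eq_zero hm (by rw [← h]; exact (supNorm_pos hn).ne')]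
    simp
  · have hp := groundState_pos hn
    have hq := groundState_pos hm
    generalize groundState n = p at *
    generalize groundState m = q at *
    have key : (u n - u m) ^ 2 - (u n ^ 2 * (1 - q / p) + u m ^ 2 * (1 - p / q)) =
        (u n * q - u m * p) ^ 2 / (p * q) := by
      field_simp
      ring
    have : 0 ≤ (u n * q - u m * p) ^ 2 / (p * q) := by positivity
    linarith

lemma edgeTerm_forward_sum (u : ℤ × ℤ → ℝ) {n : ℤ × ℤ} (hn : n.1 ≠ n.2) :
    edgeTerm u n (n.1 + 1, n.2) + edgeTerm u n (n.1, n.2 + 1) =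
      u n ^ 2 * (1 - cos (π / (4 * (supNorm n : ℝ)) * ((n.1 + n.2 : ℤ) : ℝ) +
        π / (4 * (supNorm n : ℝ))) / groundState n) := by
  have h : (supNorm n = supNorm (n.1 + 1, n.2) ∧ supNorm n ≠ supNorm (n.1, n.2 + 1)) ∨
      (supNorm n ≠ supNorm (n.1 + 1, n.2) ∧ supNorm n = supNorm (n.1, n.2 + 1)) := by
    simp only [supNorm, abs_eq_max_neg]; omega
  rcases h with ⟨h1, h2⟩ | ⟨h1, h2⟩
  · rw [edgeTerm, edgeTerm, if_pos h1, if_neg h2, add_zero, groundState, ← h1]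
    push_cast
    ring_nf
  · rw [edgeTerm, edgeTerm, if_neg h1, if_pos h2, zero_add, groundState, ← h2]
    push_cast
    ring_nf

lemma edgeTerm_backward_sum (u : ℤ × ℤ → ℝ) {n : ℤ × ℤ} (hn : n.1 ≠ n.2) :
    edgeTerm u n (n.1 - 1, n.2) + edgeTerm u n (n.1, n.2 - 1) =
      u n ^ 2 * (1 - cos (π / (4 * (supNorm n : ℝ)) * ((n.1 + n.2 : ℤ) : ℝ) -
        π / (4 * (supNorm n : ℝ))) / groundState n) := by
  have h : (supNorm n = supNorm (n.1 - 1, n.2) ∧ supNorm n ≠ supNorm (n.1, n.2 - 1)) ∨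
      (supNorm n ≠ supNorm (n.1 - 1, n.2) ∧ supNorm n = supNorm (n.1, n.2 - 1)) := by
    simp only [supNorm, abs_eq_max_neg]; omega
  rcases h with ⟨h1, h2⟩ | ⟨h1, h2⟩
  · rw [edgeTerm, edgeTerm, if_pos h1, if_neg h2, add_zero, groundState, ← h1]
    push_cast
    ring_nf
  · rw [edgeTerm, edgeTerm, if_neg h1, if_pos h2, zero_add, groundState, ← h2]
    push_cast
    ring_nf

lemma edgeTerm_neighbors_sum (u : ℤ × ℤ → ℝ) {n : ℤ × ℤ} (hn : n.1 ≠ n.2) :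
    (edgeTerm u n (n.1 + 1, n.2) + edgeTerm u n (n.1, n.2 + 1)) +
      (edgeTerm u n (n.1 - 1, n.2) + edgeTerm u n (n.1, n.2 - 1)) =
      4 * sin (π / 8 / (supNorm n : ℝ)) ^ 2 * u n ^ 2 := by
  rw [edgeTerm_forward_sum u hn, edgeTerm_backward_sum u hn, cos_add, cos_sub]
  have hp := groundState_pos hn
  have hd : π / (4 * (supNorm n : ℝ)) = 2 * (π / 8 / (supNorm n : ℝ)) := by ring
  have hc : cos (π / (4 * (supNorm n : ℝ))) = 1 - 2 * sin (π / 8 / (supNorm n : ℝ)) ^ 2 := by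
    rw [hd, cos_two_mul, cos_sq']; ring
  rw [hc]
  change u n ^ 2 * (1 - (groundState n * _ - _) / groundState n) +
    u n ^ 2 * (1 - (groundState n * _ + _) / groundState n) = _
  generalize groundState n = p at *
  generalize sin (π / 8 / (supNorm n : ℝ)) = s
  field_simp
  ring

lemma sin_div_le_sin_div {x k : ℝ} (hx : 0 ≤ x) (hx' : x ≤ π) (hk : 1 ≤ k) :
    sin x / k ≤ sin (x / k) := by
  have hk0 : 0 < k := by linarith
  have h := strictConcaveOn_sin_Icc.concaveOn.2 ⟨hx, hx'⟩ ⟨le_rfl, pi_pos.le⟩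
    (show 0 ≤ 1 / k by positivity)
    (show 0 ≤ 1 - 1 / k by rw [sub_nonneg, div_le_one hk0]; exact hk) (by ring)
  simp only [smul_eq_mul, sin_zero, mul_zero, add_zero] at h
  calc sin x / k = 1 / k * sin x := by ring
    _ ≤ _ := h
    _ = _ := by ring_nf

lemma hardyWeight_le_edgeTerm_sum {u : ℤ × ℤ → ℝ} (hdiag : ∀ n : ℤ × ℤ, n.1 = n.2 → u n = 0)
    (n : ℤ × ℤ) :
    4 * sin (π / 8) ^ 2 * (|u n| ^ 2 / (supNorm n : ℝ) ^ 2) ≤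
      (edgeTerm u n (n.1 + 1, n.2) + edgeTerm u n (n.1, n.2 + 1)) +
      (edgeTerm u n (n.1 - 1, n.2) + edgeTerm u n (n.1, n.2 - 1)) := by
  by_cases hn : n.1 = n.2
  · simp [edgeTerm, hdiag n hn]
  rw [edgeTerm_neighbors_sum u hn, sq_abs]
  have hk : (1 : ℝ) ≤ supNorm n := by exact_mod_cast supNorm_pos hn
  have h := sin_div_le_sin_div (x := π / 8) (by positivity) (by linarith [pi_pos]) hk
  have h0 : 0 ≤ sin (π / 8) / (supNorm n : ℝ) :=
    div_nonneg (sin_nonneg_of_nonneg_of_le_pi (by positivity) (by linarith [pi_pos]))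
      (by linarith)
  calc _ = 4 * (sin (π / 8) / (supNorm n : ℝ)) ^ 2 * u n ^ 2 := by ring
    _ ≤ _ := by gcongr

lemma summable_of_eq_zero {u f : ℤ × ℤ → ℝ} (hu : (Function.support u).Finite)
    (hf : ∀ n, u n = 0 → f n = 0) : Summable f :=
  summable_of_hasFiniteSupport (hu.subset fun n hn h => hn (hf n h))

end DiscreteHardy

open DiscreteHardy in
/-- Discrete Hardy inequality on `ℤ²` for antisymmetric functions, with the
`ℓ^∞` norm in the weight. -/
theorem discrete_hardy_antisymmetric_dim_two (u : ℤ × ℤ → ℝ)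
    (hu : (Function.support u).Finite)
    (hanti : ∀ n : ℤ × ℤ, u n = -u (n.2, n.1)) :
    4 * Real.sin (π / 8) ^ 2 *
        ∑' n : {m : ℤ × ℤ // m ≠ 0},
          |u n.1| ^ 2 / ((max |n.1.1| |n.1.2| : ℤ) : ℝ) ^ 2 ≤
      ∑' n : ℤ × ℤ,
        (|u n - u (n.1 - 1, n.2)| ^ 2 + |u n - u (n.1, n.2 - 1)| ^ 2) := by
  have hdiag : ∀ n : ℤ × ℤ, n.1 = n.2 → u n = 0 := by
    rintro ⟨a, b⟩ (rfl : a = b)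
    linarith [hanti (a, a)]
  let e₁ : ℤ × ℤ ≃ ℤ × ℤ := (Equiv.subRight 1).prodCongr (Equiv.refl ℤ)
  let e₂ : ℤ × ℤ ≃ ℤ × ℤ := (Equiv.refl ℤ).prodCongr (Equiv.subRight 1)
  have hsub : ∀ (e : ℤ × ℤ ≃ ℤ × ℤ), Summable fun n => |u n - u (e n)| ^ 2 := by
    intro e
    refine summable_of_hasFiniteSupport
      ((hu.union (hu.preimage (e.injective.injOn (s := e ⁻¹' _)))).subset ?_)
    intro n hn
    by_contra h
    simp only [Set.mem_union, Set.mem_preimage, Function.mem_support, not_or, not_not] at h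
    exact hn (by simp [h.1, h.2])
  have hs : ∀ g : ℤ × ℤ → ℤ × ℤ, Summable fun n => edgeTerm u n (g n) := fun g =>
    summable_of_eq_zero hu fun n hn => by simp [edgeTerm, hn]
  have hedge : ∀ e : ℤ × ℤ ≃ ℤ × ℤ,
      ∑' n, edgeTerm u n (e.symm n) + ∑' n, edgeTerm u n (e n) ≤ ∑' n, |u n - u (e n)| ^ 2 := by
    intro e
    have h1 : Summable fun n => edgeTerm u (e n) n := by
      simpa [Function.comp_def] using e.summable_iff.2 (hs e.symm)
    have h2 : ∑' n, edgeTerm u n (e.symm n) = ∑' n, edgeTerm u (e n) n := by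
      simpa using (e.tsum_eq fun n => edgeTerm u n (e.symm n)).symm
    rw [h2, ← h1.tsum_add (hs e)]
    refine (h1.add (hs e)).tsum_le_tsum (fun n => ?_) (hsub e)
    rw [add_comm]
    exact edgeTerm_add_edgeTerm_le hdiag n (e n)
  have hweight : Summable fun n => |u n| ^ 2 / (supNorm n : ℝ) ^ 2 :=
    summable_of_eq_zero hu fun n hn => by simp [hn]
  have hL : ∑' n : {m : ℤ × ℤ // m ≠ 0}, |u n.1| ^ 2 / ((max |n.1.1| |n.1.2| : ℤ) : ℝ) ^ 2 =
      ∑' n, |u n| ^ 2 / (supNorm n : ℝ) ^ 2 := by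
    refine tsum_subtype_eq_of_support_subset (s := {m : ℤ × ℤ | m ≠ 0})
      (f := fun n => |u n| ^ 2 / (supNorm n : ℝ) ^ 2) ?_
    rintro n hn rfl
    exact hn (by simp [hdiag 0 rfl])
  calc _ = ∑' n, 4 * sin (π / 8) ^ 2 * (|u n| ^ 2 / (supNorm n : ℝ) ^ 2) := by
        rw [hL, tsum_mul_left]
    _ ≤ ∑' n, ((edgeTerm u n (e₁.symm n) + edgeTerm u n (e₂.symm n)) +
          (edgeTerm u n (e₁ n) + edgeTerm u n (e₂ n))) :=
        (hweight.mul_left _).tsum_le_tsum (hardyWeight_le_edgeTerm_sum hdiag)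
          (((hs _).add (hs _)).add ((hs _).add (hs _)))
    _ = (∑' n, edgeTerm u n (e₁.symm n) + ∑' n, edgeTerm u n (e₁ n)) +
          (∑' n, edgeTerm u n (e₂.symm n) + ∑' n, edgeTerm u n (e₂ n)) := by
        rw [((hs _).add (hs _)).tsum_add ((hs _).add (hs _)), (hs _).tsum_add (hs _),
          (hs _).tsum_add (hs _)]
        ring
    _ ≤ ∑' n, |u n - u (e₁ n)| ^ 2 + ∑' n, |u n - u (e₂ n)| ^ 2 :=
        add_le_add (hedge e₁) (hedge e₂)
    _ = _ := ((hsub e₁).tsum_add (hsub e₂)).symm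
end

section
/- Let 1 < α ≤ 2 and let u : ℕ → ℂ be finitely supported with |u(0)| = max_{n∈ℕ} |u(n)|. Then Σ_{n=1}^∞ |u(n) − u(n−1)|² n^α ≥ ((α−1)²/4) Σ_{n=1}^∞ |u(n)|² n^{α−2}. -/
/-- A difference square dominates the flux with ratio `1 - β / s`. -/
lemma flux_le_sq_sub {β s : ℝ} (hs : 0 < s) (hβ : β < s) (a b : ℝ) :
    β * (b ^ 2 / s - a ^ 2 / (s - β)) ≤ (a - b) ^ 2 := by
  have h : 0 < s - β := sub_pos.2 hβ
  have key : (a - b) ^ 2 - β * (b ^ 2 / s - a ^ 2 / (s - β)) =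
      (s * a - (s - β) * b) ^ 2 / (s * (s - β)) := by
    field_simp
    ring
  have : 0 ≤ (s * a - (s - β) * b) ^ 2 / (s * (s - β)) := by positivity
  linarith

lemma hardy_weight_rational {β x : ℝ} (h0 : 0 < β) (h1 : β ≤ 1 / 2) (hx : 1 ≤ x) :
    x ^ 2 / (x + 1 - β) + β ≤ x * (x + 1) ^ 2 / ((x + 2) * (x + 1 - 2 * β)) := by
  have hs : 0 < x + 1 - β := by linarith
  have ht : 0 < x + 1 - 2 * β := by linarith
  have hpos : 0 < x + 2 := by linarith
  rw [div_add' _ _ _ hs.ne', div_le_div_iff₀ hs (by positivity)]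
  obtain ⟨m, rfl, hm⟩ : ∃ m, x = m + 1 ∧ 0 ≤ m := ⟨x - 1, by ring, by linarith⟩
  have c0 : 0 ≤ 2 - 10 * β + 18 * β ^ 2 - 6 * β ^ 3 := by
    nlinarith [sq_nonneg (β - 1 / 3), mul_nonneg (sq_nonneg β) (sub_nonneg.2 h1)]
  have c1 : 0 ≤ 3 - 10 * β + 15 * β ^ 2 - 2 * β ^ 3 := by
    nlinarith [sq_nonneg (β - 1 / 3), mul_nonneg (sq_nonneg β) (sub_nonneg.2 h1)]
  have c2 : 0 ≤ 1 - 2 * β + 3 * β ^ 2 := by nlinarith [sq_nonneg (β - 1 / 3)]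
  nlinarith [mul_nonneg c1 hm, mul_nonneg c2 (sq_nonneg m)]

lemma hardy_weight_le {β x : ℝ} (h0 : 0 < β) (h1 : β ≤ 1 / 2) (hx : 1 ≤ x) :
    x ^ (2 * β + 1) / (x + 1 - β) + β * x ^ (2 * β - 1) ≤ (x + 1) ^ (2 * β + 1) / (x + 2) := by
  have hx0 : 0 < x := by linarith
  have ht : 0 < x + 1 - 2 * β := by linarith
  have bern : x ^ (2 * β) * (x + 1) ≤ (x + 1) ^ (2 * β) * (x + 1 - 2 * β) := by
    have h := rpow_one_add_le_one_add_mul_self (s := -1 / (x + 1)) (p := 2 * β)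
      (by rw [le_div_iff₀ (by linarith)]; linarith) (by linarith) (by linarith)
    have e : 1 + -1 / (x + 1) = x / (x + 1) := by field_simp; ring
    rw [e, Real.div_rpow hx0.le (by linarith), div_le_iff₀ (by positivity)] at h
    calc x ^ (2 * β) * (x + 1)
        ≤ (1 + 2 * β * (-1 / (x + 1))) * (x + 1) ^ (2 * β) * (x + 1) := by gcongr
      _ = _ := by field_simp; ring
  have e1 : x ^ (2 * β + 1) = x ^ (2 * β - 1) * x ^ 2 := by
    rw [← Real.rpow_natCast, ← Real.rpow_add hx0]; congr 1; push_cast; ring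
  have e2 : x ^ (2 * β) = x ^ (2 * β - 1) * x := by
    rw [← Real.rpow_add_one hx0.ne']; congr 1; ring
  have e3 : (x + 1) ^ (2 * β + 1) = (x + 1) ^ (2 * β) * (x + 1) :=
    Real.rpow_add_one (by positivity) _
  calc x ^ (2 * β + 1) / (x + 1 - β) + β * x ^ (2 * β - 1)
      = x ^ (2 * β - 1) * (x ^ 2 / (x + 1 - β) + β) := by rw [e1]; ring
    _ ≤ x ^ (2 * β - 1) * (x * (x + 1) ^ 2 / ((x + 2) * (x + 1 - 2 * β))) := by
        gcongr
        exact hardy_weight_rational h0 h1 hx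
    _ = x ^ (2 * β) * (x + 1) / (x + 1 - 2 * β) * ((x + 1) / (x + 2)) := by
        rw [e2]; field_simp
    _ ≤ (x + 1) ^ (2 * β) * ((x + 1) / (x + 2)) := by
        gcongr
        rwa [div_le_iff₀ ht]
    _ = (x + 1) ^ (2 * β + 1) / (x + 2) := by rw [e3]; ring

lemma hardy_step {β x : ℝ} (h0 : 0 < β) (h1 : β ≤ 1 / 2) (hx : 1 ≤ x) (a b : ℝ) :
    β ^ 2 * (a ^ 2 * x ^ (2 * β - 1)) +
      (β * (x ^ (2 * β + 1) / (x + 1)) * b ^ 2 -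
        β * ((x + 1) ^ (2 * β + 1) / (x + 2)) * a ^ 2) ≤ (a - b) ^ 2 * x ^ (2 * β + 1) := by
  have hflux := mul_le_mul_of_nonneg_right
    (flux_le_sq_sub (β := β) (s := x + 1) (by linarith) (by linarith) a b)
    (Real.rpow_nonneg (by linarith : 0 ≤ x) (2 * β + 1))
  have hweight := mul_le_mul_of_nonneg_left (hardy_weight_le h0 h1 hx)
    (mul_nonneg h0.le (sq_nonneg a))
  refine le_trans ?_ hflux
  linear_combination hweight

/-- Weighted discrete Hardy inequality on `ℕ` with weights `n^α`, `1 < α ≤ 2`,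
for finitely supported functions whose modulus is maximized at the origin. -/
theorem discrete_hardy_rearrangement_proof (α : ℝ) (hα : 1 < α ∧ α ≤ 2) (u : ℕ → ℂ)
    (hu : (Function.support u).Finite) (hmax : ∀ n : ℕ, ‖u n‖ ≤ ‖u 0‖) :
    (α - 1) ^ 2 / 4 * ∑' n : ℕ, ‖u (n + 1)‖ ^ 2 * ((n : ℝ) + 1) ^ (α - 2) ≤
      ∑' n : ℕ, ‖u (n + 1) - u n‖ ^ 2 * ((n : ℝ) + 1) ^ α := by
  obtain ⟨β, rfl⟩ : ∃ β, α = 2 * β + 1 := ⟨(α - 1) / 2, by ring⟩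
  have h0 : 0 < β := by linarith [hα.1]
  have h1 : β ≤ 1 / 2 := by linarith [hα.2]
  obtain ⟨N, hN⟩ := hu.bddAbove
  have hz : ∀ n, N < n → u n = 0 := fun n hn => by
    by_contra h
    exact absurd (hN h) (by simpa using hn)
  rw [tsum_eq_sum (s := Finset.range (N + 1)) fun n hn => by
      rw [hz (n + 1) (by simp at hn; lia)]; simp,
    tsum_eq_sum (s := Finset.range (N + 1)) fun n hn => by
      rw [hz (n + 1) (by simp at hn; lia), hz n (by simp at hn; lia)]; simp]
  let g : ℕ → ℝ := fun n => β * (((n : ℝ) + 1) ^ (2 * β + 1) / ((n : ℝ) + 2)) * ‖u n‖ ^ 2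
  have hg0 : 0 ≤ g 0 := by positivity
  have hgN : g (N + 1) = 0 := by simp [g, hz (N + 1) (by lia)]
  have hstep : ∀ n : ℕ, β ^ 2 * (‖u (n + 1)‖ ^ 2 * ((n : ℝ) + 1) ^ (2 * β - 1)) +
      (g n - g (n + 1)) ≤ ‖u (n + 1) - u n‖ ^ 2 * ((n : ℝ) + 1) ^ (2 * β + 1) := fun n => by
    have h := hardy_step h0 h1 (x := (n : ℝ) + 1) (by simp) ‖u (n + 1)‖ ‖u n‖
    have hnorm : (‖u (n + 1)‖ - ‖u n‖) ^ 2 ≤ ‖u (n + 1) - u n‖ ^ 2 :=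
      sq_le_sq.2 (by simpa using abs_norm_sub_norm_le (u (n + 1)) (u n))
    refine le_trans (le_of_eq ?_)
      (h.trans (mul_le_mul_of_nonneg_right hnorm (by positivity)))
    simp only [g]
    push_cast
    ring_nf
  have hsum := Finset.sum_le_sum fun n (_ : n ∈ Finset.range (N + 1)) => hstep n
  rw [Finset.sum_add_distrib, ← Finset.mul_sum, Finset.sum_range_sub', hgN] at hsum
  have e1 : (2 * β + 1 - 1) ^ 2 / 4 = β ^ 2 := by ring
  have e2 : 2 * β + 1 - 2 = 2 * β - 1 := by ring
  rw [e1, e2]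
  linarith
end
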